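/- arXiv:1906.11908 — 3 statements merged into one kernel-verified Lean document; each statement's English description precedes it below -/
import Mathlib

section
/- There exist 53 distinct points in ℝ² and a set E of 106 unordered pairs of these points such that every point is an endpoint of exactly 4 pairs in E, the closed segments of any two distinct pairs intersect at most in a common endpoint, exactly 104 of the pairs join points at distance exactly 1, and the remaining 2 pairs join points at one common distance t with |t − 1| < 0.082. -/
open scoped Classical

namespace G53

/-- Fixed-point scale. -/
def K : ℤ := 100000000000000000000

theorem K_pos : (0 : ℝ) < (K : ℝ) := by norm_num [K]
theorem K_posZ : (0 : ℤ) < K := by norm_num [K]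

/-- Closed interval `[lo / K, hi / K]`. -/
structure Iv where
  lo : ℤ
  hi : ℤ

def Mem (x : ℝ) (I : Iv) : Prop := (I.lo : ℝ) ≤ x * K ∧ x * K ≤ (I.hi : ℝ)

def imin (a b : ℤ) : ℤ := if a ≤ b then a else b
def imax (a b : ℤ) : ℤ := if a ≤ b then b else a

theorem imin_le_left (a b : ℤ) : imin a b ≤ a := by unfold imin; split <;> omega
theorem imin_le_right (a b : ℤ) : imin a b ≤ b := by unfold imin; split <;> omega
theorem le_imax_left (a b : ℤ) : a ≤ imax a b := by unfold imax; split <;> omega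
theorem le_imax_right (a b : ℤ) : b ≤ imax a b := by unfold imax; split <;> omega

def Iv.add (a b : Iv) : Iv := ⟨a.lo + b.lo, a.hi + b.hi⟩
def Iv.sub (a b : Iv) : Iv := ⟨a.lo - b.hi, a.hi - b.lo⟩
def Iv.mul (a b : Iv) : Iv :=
  ⟨imin (imin (a.lo * b.lo) (a.lo * b.hi)) (imin (a.hi * b.lo) (a.hi * b.hi)) / K,
   -((-(imax (imax (a.lo * b.lo) (a.lo * b.hi)) (imax (a.hi * b.lo) (a.hi * b.hi)))) / K)⟩
def Iv.inv (b : Iv) : Iv := ⟨K * K / b.hi, -((-(K * K)) / b.lo)⟩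
def cst (n : ℤ) : Iv := ⟨n * K, n * K⟩
/-- the constant `n / 2` -/
def hcst (n : ℤ) : Iv := ⟨n * 50000000000000000000, n * 50000000000000000000⟩
def Iv.le (a b : Iv) : Bool := decide (b.lo ≤ a.lo) && decide (a.hi ≤ b.hi)
def sqrtOk (a j : Iv) : Bool :=
  decide (0 ≤ a.lo) && decide (0 ≤ j.lo) && decide (0 ≤ j.hi) &&
    decide (j.lo * j.lo ≤ a.lo * K) && decide (a.hi * K ≤ j.hi * j.hi)

theorem mem_add {x y : ℝ} {a b : Iv} (hx : Mem x a) (hy : Mem y b) : Mem (x + y) (a.add b) := by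
  obtain ⟨h1, h2⟩ := hx; obtain ⟨h3, h4⟩ := hy
  constructor <;> simp only [Iv.add] <;> push_cast <;> nlinarith

theorem mem_sub {x y : ℝ} {a b : Iv} (hx : Mem x a) (hy : Mem y b) : Mem (x - y) (a.sub b) := by
  obtain ⟨h1, h2⟩ := hx; obtain ⟨h3, h4⟩ := hy
  constructor <;> simp only [Iv.sub] <;> push_cast <;> nlinarith

theorem floor_div_le (p q : ℤ) (hq : 0 < q) : ((p / q : ℤ) : ℝ) ≤ (p : ℝ) / q := by
  rw [le_div_iff₀ (by exact_mod_cast hq)]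
  exact_mod_cast Int.ediv_mul_le p hq.ne'

theorem le_ceil_div (p q : ℤ) (hq : 0 < q) : (p : ℝ) / q ≤ ((-((-p) / q) : ℤ) : ℝ) := by
  have := floor_div_le (-p) q hq
  push_cast at this ⊢
  have h2 : -(p : ℝ) / q = -((p : ℝ) / q) := by ring
  linarith

theorem prod_lower {u v a b c d m : ℝ} (hu1 : a ≤ u) (hu2 : u ≤ b) (hv1 : c ≤ v) (hv2 : v ≤ d)
    (h1 : m ≤ a * c) (h2 : m ≤ a * d) (h3 : m ≤ b * c) (h4 : m ≤ b * d) : m ≤ u * v := by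
  have ha : m ≤ a * v := by
    rcases le_total 0 a with h | h <;> nlinarith
  have hb : m ≤ b * v := by
    rcases le_total 0 b with h | h <;> nlinarith
  rcases le_total 0 v with h | h <;> nlinarith

theorem mem_mul {x y : ℝ} {a b : Iv} (hx : Mem x a) (hy : Mem y b) : Mem (x * y) (a.mul b) := by
  obtain ⟨h1, h2⟩ := hx; obtain ⟨h3, h4⟩ := hy
  have e : x * y * K = (x * K) * (y * K) / K := by field_simp [K_pos.ne']
  constructor
  · refine (floor_div_le _ _ K_posZ).trans ?_
    rw [e]
    refine div_le_div_of_nonneg_right ?_ K_pos.le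
    set m := imin (imin (a.lo * b.lo) (a.lo * b.hi)) (imin (a.hi * b.lo) (a.hi * b.hi)) with hm
    have g1 : m ≤ a.lo * b.lo := (imin_le_left _ _).trans (imin_le_left _ _)
    have g2 : m ≤ a.lo * b.hi := (imin_le_left _ _).trans (imin_le_right _ _)
    have g3 : m ≤ a.hi * b.lo := (imin_le_right _ _).trans (imin_le_left _ _)
    have g4 : m ≤ a.hi * b.hi := (imin_le_right _ _).trans (imin_le_right _ _)
    exact prod_lower h1 h2 h3 h4 (by exact_mod_cast g1) (by exact_mod_cast g2)
      (by exact_mod_cast g3) (by exact_mod_cast g4)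
  · refine le_trans ?_ (le_ceil_div _ _ K_posZ)
    rw [e]
    refine div_le_div_of_nonneg_right ?_ K_pos.le
    set m := imax (imax (a.lo * b.lo) (a.lo * b.hi)) (imax (a.hi * b.lo) (a.hi * b.hi)) with hm
    have g1 : a.lo * b.lo ≤ m := (le_imax_left _ _).trans (le_imax_left _ _)
    have g2 : a.lo * b.hi ≤ m := (le_imax_right _ _).trans (le_imax_left _ _)
    have g3 : a.hi * b.lo ≤ m := (le_imax_left _ _).trans (le_imax_right _ _)
    have g4 : a.hi * b.hi ≤ m := (le_imax_right _ _).trans (le_imax_right _ _)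
    have g1' : (a.lo : ℝ) * b.lo ≤ m := by exact_mod_cast g1
    have g2' : (a.lo : ℝ) * b.hi ≤ m := by exact_mod_cast g2
    have g3' : (a.hi : ℝ) * b.lo ≤ m := by exact_mod_cast g3
    have g4' : (a.hi : ℝ) * b.hi ≤ m := by exact_mod_cast g4
    have := prod_lower (u := -(x * K)) (v := y * K) (m := -(m : ℝ)) (neg_le_neg h2) (neg_le_neg h1) h3 h4
      (by linarith) (by linarith) (by linarith) (by linarith)
    linarith

theorem mem_inv {x : ℝ} {a : Iv} (hx : Mem x a) (h : 0 < a.lo) : 0 < x ∧ Mem x⁻¹ a.inv := by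
  obtain ⟨h1, h2⟩ := hx
  have hK := K_pos
  have hl : (0 : ℝ) < a.lo := by exact_mod_cast h
  have hxK : 0 < x * K := hl.trans_le h1
  have hx : 0 < x := pos_of_mul_pos_left hxK hK.le
  have hh : (0 : ℝ) < a.hi := hxK.trans_le h2
  have hhZ : 0 < a.hi := by exact_mod_cast hh
  have e : x⁻¹ * (K : ℝ) = (K * K : ℝ) / (x * K) := by field_simp
  refine ⟨hx, ?_, ?_⟩
  · refine (floor_div_le _ _ hhZ).trans ?_
    rw [e]; push_cast
    exact div_le_div_of_nonneg_left (by positivity) hxK h2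
  · refine le_trans ?_ (le_ceil_div _ _ h)
    rw [e]; push_cast
    exact div_le_div_of_nonneg_left (by positivity) hl h1

theorem mem_sqrt {x : ℝ} {a j : Iv} (hx : Mem x a) (h : sqrtOk a j = true) :
    0 ≤ x ∧ Mem (Real.sqrt x) j := by
  simp only [sqrtOk, Bool.and_eq_true, decide_eq_true_eq] at h
  obtain ⟨⟨⟨⟨h1, h2⟩, h3⟩, h4⟩, h5⟩ := h
  obtain ⟨g1, g2⟩ := hx
  have hK := K_pos
  have h1' : (0 : ℝ) ≤ a.lo := by exact_mod_cast h1
  have h2' : (0 : ℝ) ≤ j.lo := by exact_mod_cast h2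
  have h3' : (0 : ℝ) ≤ j.hi := by exact_mod_cast h3
  have h4' : (j.lo : ℝ) * j.lo ≤ a.lo * K := by exact_mod_cast h4
  have h5' : (a.hi : ℝ) * K ≤ j.hi * j.hi := by exact_mod_cast h5
  have hx0 : 0 ≤ x := nonneg_of_mul_nonneg_left (h1'.trans g1) hK
  have hs := Real.sqrt_nonneg x
  have hss := Real.mul_self_sqrt hx0
  have e : √x * K * (√x * K) = x * K * K := by linear_combination (K * K : ℝ) * hss
  refine ⟨hx0, ?_, ?_⟩
  · refine (mul_self_le_mul_self_iff h2' (by positivity)).2 ?_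
    rw [e]; exact h4'.trans (mul_le_mul_of_nonneg_right g1 hK.le)
  · refine (mul_self_le_mul_self_iff (by positivity) h3').2 ?_
    rw [e]; exact (mul_le_mul_of_nonneg_right g2 hK.le).trans h5'

theorem mem_cst (n : ℤ) : Mem (n : ℝ) (cst n) := by
  constructor <;> simp [cst]
theorem mem_hcst (n : ℤ) : Mem ((n : ℝ) / 2) (hcst n) := by
  constructor <;> simp only [hcst, K] <;> push_cast <;> apply le_of_eq <;> ring

theorem mem_le {x : ℝ} {a b : Iv} (hx : Mem x a) (h : a.le b = true) : Mem x b := by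
  simp only [Iv.le, Bool.and_eq_true, decide_eq_true_eq] at h
  exact ⟨(by exact_mod_cast h.1 : (b.lo : ℝ) ≤ a.lo).trans hx.1, hx.2.trans (by exact_mod_cast h.2)⟩

/-- `f` is continuous on `S` with values in `I`. -/
def Good (S : Set ℝ) (I : Iv) (f : ℝ → ℝ) : Prop := ContinuousOn f S ∧ ∀ s ∈ S, Mem (f s) I

section
variable {S : Set ℝ} {a b : Iv} {f g : ℝ → ℝ}
theorem Good.add (hf : Good S a f) (hg : Good S b g) : Good S (a.add b) (fun s => f s + g s) :=
  ⟨hf.1.add hg.1, fun s hs => mem_add (hf.2 s hs) (hg.2 s hs)⟩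
theorem Good.sub (hf : Good S a f) (hg : Good S b g) : Good S (a.sub b) (fun s => f s - g s) :=
  ⟨hf.1.sub hg.1, fun s hs => mem_sub (hf.2 s hs) (hg.2 s hs)⟩
theorem Good.mul (hf : Good S a f) (hg : Good S b g) : Good S (a.mul b) (fun s => f s * g s) :=
  ⟨hf.1.mul hg.1, fun s hs => mem_mul (hf.2 s hs) (hg.2 s hs)⟩
theorem Good.inv (hf : Good S a f) (h : 0 < a.lo) : Good S a.inv (fun s => (f s)⁻¹) :=
  ⟨hf.1.inv₀ (fun s hs => (mem_inv (hf.2 s hs) h).1.ne'), fun s hs => (mem_inv (hf.2 s hs) h).2⟩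
theorem Good.sqrt (hf : Good S a f) (h : sqrtOk a b = true) : Good S b (fun s => Real.sqrt (f s)) :=
  ⟨hf.1.sqrt, fun s hs => (mem_sqrt (hf.2 s hs) h).2⟩
theorem Good.le (hf : Good S a f) (h : a.le b = true) : Good S b f :=
  ⟨hf.1, fun s hs => mem_le (hf.2 s hs) h⟩
theorem good_cst (n : ℤ) : Good S (cst n) (fun _ => (n : ℝ)) :=
  ⟨continuousOn_const, fun _ _ => mem_cst n⟩
theorem good_hcst (n : ℤ) : Good S (hcst n) (fun _ => (n : ℝ) / 2) :=
  ⟨continuousOn_const, fun _ _ => mem_hcst n⟩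
end

/-- Half the square root of three. -/
noncomputable def r3 : ℝ := Real.sqrt (3 / 4)
def r3I : Iv := ⟨86602540378443864676, 86602540378443864677⟩
theorem r3_sq : r3 * r3 = 3 / 4 := Real.mul_self_sqrt (by norm_num)
theorem good_r3 (S : Set ℝ) : Good S r3I (fun _ => r3) := by
  refine ⟨continuousOn_const, fun _ _ => ?_⟩
  refine (mem_sqrt (a := ⟨75000000000000000000, 75000000000000000000⟩) ?_ (by decide +kernel)).2
  constructor <;> norm_num [K]

structure Bx where
  x : Iv
  y : Iv

def GoodP (S : Set ℝ) (B : Bx) (A : ℝ → ℝ × ℝ) : Prop :=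
  Good S B.x (fun s => (A s).1) ∧ Good S B.y (fun s => (A s).2)

def dsq (A B : ℝ × ℝ) : ℝ := (A.1 - B.1) * (A.1 - B.1) + (A.2 - B.2) * (A.2 - B.2)

theorem dsq_comm (A B : ℝ × ℝ) : dsq A B = dsq B A := by unfold dsq; ring

/-- Triangular lattice point with half-integer coordinates `p/2, q/2` in the frame `A, B`. -/
noncomputable def lat (A B : ℝ × ℝ) (p q : ℤ) : ℝ × ℝ :=
  (A.1 + ((p : ℝ) / 2 * (B.1 - A.1) + (q : ℝ) / 2 * (((1 : ℤ) : ℝ) / 2 * (B.1 - A.1) - r3 * (B.2 - A.2))),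
   A.2 + ((p : ℝ) / 2 * (B.2 - A.2) + (q : ℝ) / 2 * (((1 : ℤ) : ℝ) / 2 * (B.2 - A.2) + r3 * (B.1 - A.1))))

theorem dsq_lat (A B : ℝ × ℝ) (p q p' q' : ℤ) :
    dsq (lat A B p q) (lat A B p' q') =
      ((p - p' : ℝ) ^ 2 + (p - p') * (q - q') + (q - q') ^ 2) / 4 * dsq A B := by
  have := r3_sq
  simp only [dsq, lat]
  push_cast
  linear_combination ((q - q' : ℝ) ^ 2 / 4 * ((A.1 - B.1) * (A.1 - B.1) + (A.2 - B.2) * (A.2 - B.2))) * this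

theorem lat_zero (A B : ℝ × ℝ) : lat A B 0 0 = A := by simp [lat]
theorem lat_two (A B : ℝ × ℝ) : lat A B 2 0 = B := by simp [lat]

def latI (A B : Bx) (p q : ℤ) : Bx :=
  ⟨A.x.add (((hcst p).mul (B.x.sub A.x)).add ((hcst q).mul (((hcst 1).mul (B.x.sub A.x)).sub (r3I.mul (B.y.sub A.y))))),
   A.y.add (((hcst p).mul (B.y.sub A.y)).add ((hcst q).mul (((hcst 1).mul (B.y.sub A.y)).add (r3I.mul (B.x.sub A.x)))))⟩

def Bx.le (A B : Bx) : Bool := A.x.le B.x && A.y.le B.y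

theorem GoodP.le {S : Set ℝ} {A B : Bx} {f : ℝ → ℝ × ℝ} (h : GoodP S A f) (hl : A.le B = true) :
    GoodP S B f := by
  simp only [Bx.le, Bool.and_eq_true] at hl
  exact ⟨h.1.le hl.1, h.2.le hl.2⟩

theorem GoodP.lat {S : Set ℝ} {A B C : Bx} {f g : ℝ → ℝ × ℝ} (p q : ℤ) (hf : GoodP S A f) (hg : GoodP S B g)
    (h : (latI A B p q).le C = true) : GoodP S C (fun s => lat (f s) (g s) p q) := by
  refine GoodP.le ⟨?_, ?_⟩ h
  · exact hf.1.add (((good_hcst p).mul (hg.1.sub hf.1)).add ((good_hcst q).mul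
      (((good_hcst 1).mul (hg.1.sub hf.1)).sub ((good_r3 S).mul (hg.2.sub hf.2)))))
  · exact hf.2.add (((good_hcst p).mul (hg.2.sub hf.2)).add ((good_hcst q).mul
      (((good_hcst 1).mul (hg.2.sub hf.2)).add ((good_r3 S).mul (hg.1.sub hf.1)))))

/-- The point of the vertical axis at distance one from `A`. -/
noncomputable def axp (A : ℝ × ℝ) (σ : ℤ) : ℝ × ℝ :=
  (0, A.2 + (σ : ℝ) * Real.sqrt (((1 : ℤ) : ℝ) - A.1 * A.1))

def axOk (A : Bx) (σ : ℤ) (j : Iv) (C : Bx) : Bool :=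
  sqrtOk ((cst 1).sub (A.x.mul A.x)) j && (cst 0).le C.x && (A.y.add ((cst σ).mul j)).le C.y
    && decide (σ * σ = 1)

theorem GoodP.ax {S : Set ℝ} {A C : Bx} {f : ℝ → ℝ × ℝ} (σ : ℤ) (j : Iv) (hf : GoodP S A f)
    (h : axOk A σ j C = true) :
    GoodP S C (fun s => axp (f s) σ) ∧ ∀ s ∈ S, dsq (axp (f s) σ) (f s) = 1 := by
  simp only [axOk, Bool.and_eq_true, decide_eq_true_eq] at h
  obtain ⟨⟨⟨h1, h2⟩, h3⟩, h4⟩ := h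
  have hm := (good_cst (S := S) 1).sub (hf.1.mul hf.1)
  refine ⟨⟨?_, ?_⟩, ?_⟩
  · have := (good_cst (S := S) 0).le h2
    simpa [axp] using this
  · exact (hf.2.add ((good_cst σ).mul (hm.sqrt h1))).le h3
  · intro s hs
    have h0 := Real.mul_self_sqrt (mem_sqrt (hm.2 s hs) h1).1
    have h4' : (σ : ℝ) * σ = 1 := by exact_mod_cast h4
    simp only [dsq, axp]
    set w := Real.sqrt (((1 : ℤ) : ℝ) - (f s).1 * (f s).1)
    push_cast at h0
    linear_combination (σ * σ : ℝ) * h0 + (1 - (f s).1 * (f s).1) * h4'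

noncomputable def cl (D : ℝ) (R₁ R₂ : ℤ) : ℝ := (D + ((R₁ - R₂ : ℤ) : ℝ)) * (((2 : ℤ) : ℝ) * D)⁻¹
noncomputable def cm (D : ℝ) (R₁ R₂ : ℤ) : ℝ := (R₁ : ℝ) * D⁻¹ - cl D R₁ R₂ * cl D R₁ R₂

/-- Intersection of the circles around `A`, `B` with squared radii `R₁`, `R₂`. -/
noncomputable def circ (A B : ℝ × ℝ) (R₁ R₂ σ : ℤ) : ℝ × ℝ :=
  (A.1 + (cl (dsq B A) R₁ R₂ * (B.1 - A.1) - (σ : ℝ) * Real.sqrt (cm (dsq B A) R₁ R₂) * (B.2 - A.2)),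
   A.2 + (cl (dsq B A) R₁ R₂ * (B.2 - A.2) + (σ : ℝ) * Real.sqrt (cm (dsq B A) R₁ R₂) * (B.1 - A.1)))

def dI (A B : Bx) : Iv := ((B.x.sub A.x).mul (B.x.sub A.x)).add ((B.y.sub A.y).mul (B.y.sub A.y))
def clI (D : Iv) (R₁ R₂ : ℤ) : Iv := (D.add (cst (R₁ - R₂))).mul ((cst 2).mul D).inv
def cmI (D l : Iv) (R₁ : ℤ) : Iv := ((cst R₁).mul D.inv).sub (l.mul l)

/-- `D`, `l`, `j` are certificates for the intermediate quantities. -/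
def circOk (A B : Bx) (R₁ R₂ σ : ℤ) (D l j : Iv) (C : Bx) : Bool :=
  (dI A B).le D && decide (0 < D.lo) && decide (0 < ((cst 2).mul D).lo) && (clI D R₁ R₂).le l
    && sqrtOk (cmI D l R₁) j
    && (A.x.add ((l.mul (B.x.sub A.x)).sub (((cst σ).mul j).mul (B.y.sub A.y)))).le C.x
    && (A.y.add ((l.mul (B.y.sub A.y)).add (((cst σ).mul j).mul (B.x.sub A.x)))).le C.y
    && decide (σ * σ = 1)

theorem circ_dsq (A B : ℝ × ℝ) (R₁ R₂ σ : ℤ) (hpos : 0 < dsq B A)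
    (h0 : Real.sqrt (cm (dsq B A) R₁ R₂) * Real.sqrt (cm (dsq B A) R₁ R₂) = cm (dsq B A) R₁ R₂)
    (hs1 : (σ : ℝ) * σ = 1) :
    dsq (circ A B R₁ R₂ σ) A = R₁ ∧ dsq (circ A B R₁ R₂ σ) B = R₂ := by
  have hE : dsq B A = (B.1 - A.1) * (B.1 - A.1) + (B.2 - A.2) * (B.2 - A.2) := rfl
  unfold circ
  generalize dsq B A = E at *
  have e1 : cl E R₁ R₂ * (2 * E) = E + R₁ - R₂ := by
    unfold cl; push_cast; field_simp; ring
  have e2 : (cm E R₁ R₂ + cl E R₁ R₂ * cl E R₁ R₂) * E = R₁ := by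
    unfold cm; field_simp; ring
  generalize cl E R₁ R₂ = L at *
  generalize cm E R₁ R₂ = M at *
  generalize Real.sqrt M = w at *
  simp only [dsq]
  constructor
  · have : (L * L + w * w * (σ * σ)) * E = R₁ := by rw [hs1, h0]; linarith
    rw [hE] at this
    linear_combination this
  · have : (L * L + w * w * (σ * σ)) * E - L * (2 * E) + E = R₂ := by rw [hs1, h0]; linarith
    rw [hE] at this
    linear_combination this

theorem GoodP.circ {S : Set ℝ} {A B C : Bx} {f g : ℝ → ℝ × ℝ} (R₁ R₂ σ : ℤ) (D l j : Iv)
    (hf : GoodP S A f) (hg : GoodP S B g) (h : circOk A B R₁ R₂ σ D l j C = true) :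
    GoodP S C (fun s => circ (f s) (g s) R₁ R₂ σ) ∧
      ∀ s ∈ S, dsq (circ (f s) (g s) R₁ R₂ σ) (f s) = R₁ ∧ dsq (circ (f s) (g s) R₁ R₂ σ) (g s) = R₂ := by
  simp only [circOk, Bool.and_eq_true, decide_eq_true_eq] at h
  obtain ⟨⟨⟨⟨⟨⟨⟨h1, h2⟩, h3⟩, h4⟩, h5⟩, h6⟩, h7⟩, h8⟩ := h
  have hD : Good S D (fun s => dsq (g s) (f s)) :=
    (((hg.1.sub hf.1).mul (hg.1.sub hf.1)).add ((hg.2.sub hf.2).mul (hg.2.sub hf.2))).le h1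
  have hl : Good S l (fun s => cl (dsq (g s) (f s)) R₁ R₂) :=
    ((hD.add (good_cst (R₁ - R₂))).mul (((good_cst 2).mul hD).inv h3)).le h4
  have hm : Good S (cmI D l R₁) (fun s => cm (dsq (g s) (f s)) R₁ R₂) :=
    ((good_cst R₁).mul (hD.inv h2)).sub (hl.mul hl)
  have hj := hm.sqrt h5
  refine ⟨⟨?_, ?_⟩, ?_⟩
  · exact (hf.1.add ((hl.mul (hg.1.sub hf.1)).sub (((good_cst σ).mul hj).mul (hg.2.sub hf.2)))).le h6
  · exact (hf.2.add ((hl.mul (hg.2.sub hf.2)).add (((good_cst σ).mul hj).mul (hg.1.sub hf.1)))).le h7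
  · intro s hs
    have h0 := Real.mul_self_sqrt (mem_sqrt (hm.2 s hs) h5).1
    have hpos := (mem_inv (hD.2 s hs) h2).1
    have hs1 : (σ : ℝ) * σ = 1 := by exact_mod_cast h8
    exact circ_dsq _ _ R₁ R₂ σ hpos h0 hs1

end G53
namespace G53

noncomputable def p0 (_ : ℝ) : ℝ × ℝ := (((0 : ℤ) : ℝ), ((0 : ℤ) : ℝ))
noncomputable def p6 (s : ℝ) : ℝ × ℝ := (s, (axp (s, ((0 : ℤ) : ℝ)) (-1)).2)
noncomputable def p7 (s : ℝ) : ℝ × ℝ := lat (p0 s) (p6 s) 4 0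
noncomputable def p9 (s : ℝ) : ℝ × ℝ := lat (p0 s) (p6 s) 6 0
noncomputable def p8 (s : ℝ) : ℝ × ℝ := lat (p0 s) (p6 s) 2 (-2)
noncomputable def p10 (s : ℝ) : ℝ × ℝ := lat (p0 s) (p6 s) 4 (-2)
noncomputable def p11 (s : ℝ) : ℝ × ℝ := lat (p0 s) (p6 s) 6 (-2)
noncomputable def p1 (s : ℝ) : ℝ × ℝ := axp (p8 s) (-1)
noncomputable def p13 (s : ℝ) : ℝ × ℝ := circ (p1 s) (p11 s) 1 1 (-1)
noncomputable def p15 (s : ℝ) : ℝ × ℝ := circ (p9 s) (p13 s) 4 1 1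
noncomputable def p17 (s : ℝ) : ℝ × ℝ := lat (p9 s) (p15 s) 0 2
noncomputable def p12 (s : ℝ) : ℝ × ℝ := lat (p9 s) (p15 s) 1 0
noncomputable def p14 (s : ℝ) : ℝ × ℝ := lat (p9 s) (p15 s) 0 1
noncomputable def p16 (s : ℝ) : ℝ × ℝ := lat (p9 s) (p15 s) 1 1
noncomputable def p2 (s : ℝ) : ℝ × ℝ := axp (p13 s) (-1)
noncomputable def p18 (s : ℝ) : ℝ × ℝ := circ (p15 s) (p2 s) 1 1 1
noncomputable def p20 (s : ℝ) : ℝ × ℝ := circ (p17 s) (p18 s) 4 1 1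
noncomputable def p26 (s : ℝ) : ℝ × ℝ := lat (p17 s) (p20 s) 0 2
noncomputable def p19 (s : ℝ) : ℝ × ℝ := lat (p17 s) (p20 s) 1 0
noncomputable def p21 (s : ℝ) : ℝ × ℝ := lat (p17 s) (p20 s) 0 1
noncomputable def p23 (s : ℝ) : ℝ × ℝ := lat (p17 s) (p20 s) 1 1
noncomputable def p22 (s : ℝ) : ℝ × ℝ := lat (p18 s) (p20 s) 2 (-2)
noncomputable def p24 (s : ℝ) : ℝ × ℝ := circ (p22 s) (p26 s) 1 1 1
noncomputable def p28 (s : ℝ) : ℝ × ℝ := lat (p24 s) (p26 s) 2 (-2)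
noncomputable def p25 (s : ℝ) : ℝ × ℝ := lat (p24 s) (p26 s) 0 (-2)
noncomputable def p5 (s : ℝ) : ℝ × ℝ := lat (p24 s) (p26 s) 2 (-4)
noncomputable def p27 (s : ℝ) : ℝ × ℝ := lat (p24 s) (p26 s) 0 (-4)
noncomputable def p4 (s : ℝ) : ℝ × ℝ := lat (p24 s) (p26 s) 2 (-6)
noncomputable def p3 (s : ℝ) : ℝ × ℝ := axp (p27 s) 1

noncomputable def pt (s : ℝ) : ℕ → ℝ × ℝ
  | 0 => p0 s
  | 1 => p1 s
  | 2 => p2 s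
  | 3 => p3 s
  | 4 => p4 s
  | 5 => p5 s
  | 6 => p6 s
  | 7 => p7 s
  | 8 => p8 s
  | 9 => p9 s
  | 10 => p10 s
  | 11 => p11 s
  | 12 => p12 s
  | 13 => p13 s
  | 14 => p14 s
  | 15 => p15 s
  | 16 => p16 s
  | 17 => p17 s
  | 18 => p18 s
  | 19 => p19 s
  | 20 => p20 s
  | 21 => p21 s
  | 22 => p22 s
  | 23 => p23 s
  | 24 => p24 s
  | 25 => p25 s
  | 26 => p26 s
  | 27 => p27 s
  | 28 => p28 s
  | _ => (0, 0)

def bx (L : List Bx) (i : ℕ) : Bx := L.getD i ⟨⟨0, 0⟩, ⟨0, 0⟩⟩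
def ct (J : List Iv) (i : ℕ) : Iv := J.getD i ⟨0, 0⟩

def chk (L : List Bx) (J : List Iv) : Bool :=
  (Bx.mk (cst 0) (cst 0)).le (bx L 0) &&
  (axOk ⟨(bx L 6).x, cst 0⟩ (-1) (ct J 0) ⟨cst 0, (bx L 6).y⟩ &&
  ((latI (bx L 0) (bx L 6) 4 0).le (bx L 7) &&
  ((latI (bx L 0) (bx L 6) 6 0).le (bx L 9) &&
  ((latI (bx L 0) (bx L 6) 2 (-2)).le (bx L 8) &&
  ((latI (bx L 0) (bx L 6) 4 (-2)).le (bx L 10) &&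
  ((latI (bx L 0) (bx L 6) 6 (-2)).le (bx L 11) &&
  (axOk (bx L 8) (-1) (ct J 1) (bx L 1) &&
  (circOk (bx L 1) (bx L 11) 1 1 (-1) (ct J 2) (ct J 3) (ct J 4) (bx L 13) &&
  (circOk (bx L 9) (bx L 13) 4 1 1 (ct J 5) (ct J 6) (ct J 7) (bx L 15) &&
  ((latI (bx L 9) (bx L 15) 0 2).le (bx L 17) &&
  ((latI (bx L 9) (bx L 15) 1 0).le (bx L 12) &&
  ((latI (bx L 9) (bx L 15) 0 1).le (bx L 14) &&
  ((latI (bx L 9) (bx L 15) 1 1).le (bx L 16) &&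
  (axOk (bx L 13) (-1) (ct J 8) (bx L 2) &&
  (circOk (bx L 15) (bx L 2) 1 1 1 (ct J 9) (ct J 10) (ct J 11) (bx L 18) &&
  (circOk (bx L 17) (bx L 18) 4 1 1 (ct J 12) (ct J 13) (ct J 14) (bx L 20) &&
  ((latI (bx L 17) (bx L 20) 0 2).le (bx L 26) &&
  ((latI (bx L 17) (bx L 20) 1 0).le (bx L 19) &&
  ((latI (bx L 17) (bx L 20) 0 1).le (bx L 21) &&
  ((latI (bx L 17) (bx L 20) 1 1).le (bx L 23) &&
  ((latI (bx L 18) (bx L 20) 2 (-2)).le (bx L 22) &&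
  (circOk (bx L 22) (bx L 26) 1 1 1 (ct J 15) (ct J 16) (ct J 17) (bx L 24) &&
  ((latI (bx L 24) (bx L 26) 2 (-2)).le (bx L 28) &&
  ((latI (bx L 24) (bx L 26) 0 (-2)).le (bx L 25) &&
  ((latI (bx L 24) (bx L 26) 2 (-4)).le (bx L 5) &&
  ((latI (bx L 24) (bx L 26) 0 (-4)).le (bx L 27) &&
  ((latI (bx L 24) (bx L 26) 2 (-6)).le (bx L 4) &&
  (axOk (bx L 27) 1 (ct J 18) (bx L 3)))))))))))))))))))))))))))))

/-- Half of the unit edges. -/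
def HE : List (ℕ × ℕ) := [(0, 6), (0, 8), (1, 8), (1, 13), (2, 13), (2, 18), (3, 27), (4, 5), (4, 27), (5, 25), (5, 27), (5, 28), (6, 7), (6, 8), (6, 10), (7, 9), (7, 10), (7, 11), (8, 10), (9, 11), (9, 12), (9, 14), (10, 11), (11, 13), (12, 14), (12, 15), (12, 16), (13, 15), (14, 16), (14, 17), (15, 16), (15, 18), (16, 17), (17, 19), (17, 21), (18, 20), (18, 22), (19, 20), (19, 21), (19, 23), (20, 22), (20, 23), (21, 23), (21, 26), (22, 24), (23, 26), (24, 25), (24, 26), (24, 28), (25, 27), (25, 28), (26, 28)]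

theorem lat_edge {P Q A B : ℝ × ℝ} (p q p' q' : ℤ) (d : ℝ) (hP : P = lat A B p q) (hQ : Q = lat A B p' q')
    (hd : dsq B A = d) (hn : ((p - p' : ℝ) ^ 2 + (p - p') * (q - q') + (q - q') ^ 2) / 4 * d = 1) :
    dsq P Q = 1 := by
  rw [hP, hQ, dsq_lat, dsq_comm A B, hd, hn]

theorem chain (S : Set ℝ) (L : List Bx) (J : List Iv) (hs : Good S (bx L 6).x (fun s => s))
    (h : chk L J = true) :
    (∀ i < 29, GoodP S (bx L i) (fun s => pt s i)) ∧
      ∀ s ∈ S, ∀ e ∈ HE, dsq (pt s e.1) (pt s e.2) = 1 := by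
  simp only [chk, Bool.and_eq_true] at h
  obtain ⟨h0, h6, h7, h9, h8, h10, h11, h1, h13, h15, h17, h12, h14, h16, h2, h18, h20, h26, h19, h21, h23, h22, h24, h28, h25, h5, h27, h4, h3⟩ := h
  have g0 : GoodP S (bx L 0) p0 := GoodP.le ⟨good_cst 0, good_cst 0⟩ h0
  have gs : GoodP S ⟨(bx L 6).x, cst 0⟩ (fun s => (s, ((0 : ℤ) : ℝ))) := ⟨hs, good_cst 0⟩
  obtain ⟨gx, dx⟩ := GoodP.ax (-1) (ct J 0) gs h6
  have g6 : GoodP S (bx L 6) p6 := ⟨hs, gx.2⟩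
  have g7 : GoodP S (bx L 7) p7 := GoodP.lat 4 0 g0 g6 h7
  have g9 : GoodP S (bx L 9) p9 := GoodP.lat 6 0 g0 g6 h9
  have g8 : GoodP S (bx L 8) p8 := GoodP.lat 2 (-2) g0 g6 h8
  have g10 : GoodP S (bx L 10) p10 := GoodP.lat 4 (-2) g0 g6 h10
  have g11 : GoodP S (bx L 11) p11 := GoodP.lat 6 (-2) g0 g6 h11
  obtain ⟨g1, d1⟩ := GoodP.ax (-1) (ct J 1) g8 h1
  change GoodP S (bx L 1) p1 at g1
  obtain ⟨g13, d13⟩ := GoodP.circ 1 1 (-1) (ct J 2) (ct J 3) (ct J 4) g1 g11 h13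
  change GoodP S (bx L 13) p13 at g13
  obtain ⟨g15, d15⟩ := GoodP.circ 4 1 1 (ct J 5) (ct J 6) (ct J 7) g9 g13 h15
  change GoodP S (bx L 15) p15 at g15
  have g17 : GoodP S (bx L 17) p17 := GoodP.lat 0 2 g9 g15 h17
  have g12 : GoodP S (bx L 12) p12 := GoodP.lat 1 0 g9 g15 h12
  have g14 : GoodP S (bx L 14) p14 := GoodP.lat 0 1 g9 g15 h14
  have g16 : GoodP S (bx L 16) p16 := GoodP.lat 1 1 g9 g15 h16
  obtain ⟨g2, d2⟩ := GoodP.ax (-1) (ct J 8) g13 h2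
  change GoodP S (bx L 2) p2 at g2
  obtain ⟨g18, d18⟩ := GoodP.circ 1 1 1 (ct J 9) (ct J 10) (ct J 11) g15 g2 h18
  change GoodP S (bx L 18) p18 at g18
  obtain ⟨g20, d20⟩ := GoodP.circ 4 1 1 (ct J 12) (ct J 13) (ct J 14) g17 g18 h20
  change GoodP S (bx L 20) p20 at g20
  have g26 : GoodP S (bx L 26) p26 := GoodP.lat 0 2 g17 g20 h26
  have g19 : GoodP S (bx L 19) p19 := GoodP.lat 1 0 g17 g20 h19
  have g21 : GoodP S (bx L 21) p21 := GoodP.lat 0 1 g17 g20 h21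
  have g23 : GoodP S (bx L 23) p23 := GoodP.lat 1 1 g17 g20 h23
  have g22 : GoodP S (bx L 22) p22 := GoodP.lat 2 (-2) g18 g20 h22
  obtain ⟨g24, d24⟩ := GoodP.circ 1 1 1 (ct J 15) (ct J 16) (ct J 17) g22 g26 h24
  change GoodP S (bx L 24) p24 at g24
  have g28 : GoodP S (bx L 28) p28 := GoodP.lat 2 (-2) g24 g26 h28
  have g25 : GoodP S (bx L 25) p25 := GoodP.lat 0 (-2) g24 g26 h25
  have g5 : GoodP S (bx L 5) p5 := GoodP.lat 2 (-4) g24 g26 h5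
  have g27 : GoodP S (bx L 27) p27 := GoodP.lat 0 (-4) g24 g26 h27
  have g4 : GoodP S (bx L 4) p4 := GoodP.lat 2 (-6) g24 g26 h4
  obtain ⟨g3, d3⟩ := GoodP.ax 1 (ct J 18) g27 h3
  change GoodP S (bx L 3) p3 at g3
  refine ⟨?_, ?_⟩
  · intro i hi
    interval_cases i
    · exact g0
    · exact g1
    · exact g2
    · exact g3
    · exact g4
    · exact g5
    · exact g6
    · exact g7
    · exact g8
    · exact g9
    · exact g10
    · exact g11
    · exact g12
    · exact g13
    · exact g14
    · exact g15
    · exact g16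
    · exact g17
    · exact g18
    · exact g19
    · exact g20
    · exact g21
    · exact g22
    · exact g23
    · exact g24
    · exact g25
    · exact g26
    · exact g27
    · exact g28
  · intro s hs
    have f0 : dsq (p6 s) (p0 s) = 1 := by
      have := dx s hs
      simp only [dsq, p6, p0, axp] at this ⊢
      linear_combination this
    have f1 : dsq (p15 s) (p9 s) = 4 := by
      have := (d15 s hs).1
      push_cast at this
      exact this
    have f2 : dsq (p20 s) (p17 s) = 4 := by
      have := (d20 s hs).1
      push_cast at this
      exact this
    have f3 : dsq (p20 s) (p18 s) = 1 := by
      have := (d20 s hs).2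
      push_cast at this
      exact this
    have f4 : dsq (p26 s) (p24 s) = 1 := by
      have := (dsq_comm _ _).trans (d24 s hs).2
      push_cast at this
      exact this
    simp only [HE, List.forall_mem_cons, List.not_mem_nil, false_imp_iff, implies_true, and_true]
    refine ⟨?_, ?_, ?_, ?_, ?_, ?_, ?_, ?_, ?_, ?_, ?_, ?_, ?_, ?_, ?_, ?_, ?_, ?_, ?_, ?_, ?_, ?_, ?_, ?_, ?_, ?_, ?_, ?_, ?_, ?_, ?_, ?_, ?_, ?_, ?_, ?_, ?_, ?_, ?_, ?_, ?_, ?_, ?_, ?_, ?_, ?_, ?_, ?_, ?_, ?_, ?_, ?_⟩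
    · exact lat_edge 0 0 2 0 1 (lat_zero _ _).symm (lat_two _ _).symm f0 (by norm_num)
    · exact lat_edge 0 0 2 (-2) 1 (lat_zero _ _).symm rfl f0 (by norm_num)
    · exact d1 s hs
    · have := (d13 s hs).1; push_cast at this; exact (dsq_comm _ _).trans this
    · exact d2 s hs
    · have := (d18 s hs).2; push_cast at this; exact (dsq_comm _ _).trans this
    · exact d3 s hs
    · exact lat_edge 2 (-6) 2 (-4) 1 rfl rfl f4 (by norm_num)
    · exact lat_edge 2 (-6) 0 (-4) 1 rfl rfl f4 (by norm_num)
    · exact lat_edge 2 (-4) 0 (-2) 1 rfl rfl f4 (by norm_num)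
    · exact lat_edge 2 (-4) 0 (-4) 1 rfl rfl f4 (by norm_num)
    · exact lat_edge 2 (-4) 2 (-2) 1 rfl rfl f4 (by norm_num)
    · exact lat_edge 2 0 4 0 1 (lat_two _ _).symm rfl f0 (by norm_num)
    · exact lat_edge 2 0 2 (-2) 1 (lat_two _ _).symm rfl f0 (by norm_num)
    · exact lat_edge 2 0 4 (-2) 1 (lat_two _ _).symm rfl f0 (by norm_num)
    · exact lat_edge 4 0 6 0 1 rfl rfl f0 (by norm_num)
    · exact lat_edge 4 0 4 (-2) 1 rfl rfl f0 (by norm_num)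
    · exact lat_edge 4 0 6 (-2) 1 rfl rfl f0 (by norm_num)
    · exact lat_edge 2 (-2) 4 (-2) 1 rfl rfl f0 (by norm_num)
    · exact lat_edge 6 0 6 (-2) 1 rfl rfl f0 (by norm_num)
    · exact lat_edge 0 0 1 0 4 (lat_zero _ _).symm rfl f1 (by norm_num)
    · exact lat_edge 0 0 0 1 4 (lat_zero _ _).symm rfl f1 (by norm_num)
    · exact lat_edge 4 (-2) 6 (-2) 1 rfl rfl f0 (by norm_num)
    · have := (d13 s hs).2; push_cast at this; exact (dsq_comm _ _).trans this
    · exact lat_edge 1 0 0 1 4 rfl rfl f1 (by norm_num)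
    · exact lat_edge 1 0 2 0 4 rfl (lat_two _ _).symm f1 (by norm_num)
    · exact lat_edge 1 0 1 1 4 rfl rfl f1 (by norm_num)
    · have := (d15 s hs).2; push_cast at this; exact (dsq_comm _ _).trans this
    · exact lat_edge 0 1 1 1 4 rfl rfl f1 (by norm_num)
    · exact lat_edge 0 1 0 2 4 rfl rfl f1 (by norm_num)
    · exact lat_edge 2 0 1 1 4 (lat_two _ _).symm rfl f1 (by norm_num)
    · have := (d18 s hs).1; push_cast at this; exact (dsq_comm _ _).trans this
    · exact lat_edge 1 1 0 2 4 rfl rfl f1 (by norm_num)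
    · exact lat_edge 0 0 1 0 4 (lat_zero _ _).symm rfl f2 (by norm_num)
    · exact lat_edge 0 0 0 1 4 (lat_zero _ _).symm rfl f2 (by norm_num)
    · have := (d20 s hs).2; push_cast at this; exact (dsq_comm _ _).trans this
    · exact lat_edge 0 0 2 (-2) 1 (lat_zero _ _).symm rfl f3 (by norm_num)
    · exact lat_edge 1 0 2 0 4 rfl (lat_two _ _).symm f2 (by norm_num)
    · exact lat_edge 1 0 0 1 4 rfl rfl f2 (by norm_num)
    · exact lat_edge 1 0 1 1 4 rfl rfl f2 (by norm_num)
    · exact lat_edge 2 0 2 (-2) 1 (lat_two _ _).symm rfl f3 (by norm_num)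
    · exact lat_edge 2 0 1 1 4 (lat_two _ _).symm rfl f2 (by norm_num)
    · exact lat_edge 0 1 1 1 4 rfl rfl f2 (by norm_num)
    · exact lat_edge 0 1 0 2 4 rfl rfl f2 (by norm_num)
    · have := (d24 s hs).1; push_cast at this; exact (dsq_comm _ _).trans this
    · exact lat_edge 1 1 0 2 4 rfl rfl f2 (by norm_num)
    · exact lat_edge 0 0 0 (-2) 1 (lat_zero _ _).symm rfl f4 (by norm_num)
    · have := (d24 s hs).2; push_cast at this; exact this
    · exact lat_edge 0 0 2 (-2) 1 (lat_zero _ _).symm rfl f4 (by norm_num)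
    · exact lat_edge 0 (-2) 0 (-4) 1 rfl rfl f4 (by norm_num)
    · exact lat_edge 0 (-2) 2 (-2) 1 rfl rfl f4 (by norm_num)
    · exact lat_edge 2 0 2 (-2) 1 (lat_two _ _).symm rfl f4 (by norm_num)

def La : List Bx := [
  ⟨⟨0, 0⟩, ⟨0, 0⟩⟩,
  ⟨⟨0, 0⟩, ⟨-198942250121634848411, -198942250121634848402⟩⟩,
  ⟨⟨0, 0⟩, ⟨-230937123027024072945, -230937123027024072541⟩⟩,
  ⟨⟨0, 0⟩, ⟨-392020629048952986689, -392020629048916558894⟩⟩,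
  ⟨⟨4519877724, 4569053872⟩, ⟨-589532223203259265276, -589532223203206721254⟩⟩,
  ⟨⟨93387798015952581076, 93387798015989648729⟩, ⟨-553773040011002727985, -553773040010960968146⟩⟩,
  ⟨⟨91280065986393961636, 91280065986393961636⟩, ⟨-40840538114960779244, -40840538114960779241⟩⟩,
  ⟨⟨182560131972787923272, 182560131972787923272⟩, ⟨-81681076229921558488, -81681076229921558482⟩⟩,
  ⟨⟨10271089481414315191, 10271089481414315195⟩, ⟨-99471125060817424207, -99471125060817424200⟩⟩,
  ⟨⟨273840197959181884908, 273840197959181884908⟩, ⟨-122521614344882337732, -122521614344882337723⟩⟩,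
  ⟨⟨101551155467808276827, 101551155467808276831⟩, ⟨-140311663175778203451, -140311663175778203441⟩⟩,
  ⟨⟨192831221454202238463, 192831221454202238467⟩, ⟨-181152201290738982695, -181152201290738982682⟩⟩,
  ⟨⟨219256785630947646535, 219256785630947646921⟩, ⟨-206310940029040738325, -206310940029040737796⟩⟩,
  ⟨⟨98712116920578689510, 98712116920578689551⟩, ⟨-214939686574329460646, -214939686574329460500⟩⟩,
  ⟨⟨319112176403513880113, 319112176403513880758⟩, ⟨-211686898888453100697, -211686898888453100092⟩⟩,
  ⟨⟨164673373302713408163, 164673373302713408934⟩, ⟨-290100265713199138909, -290100265713199137878⟩⟩,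
  ⟨⟨264528764075279641740, 264528764075279642771⟩, ⟨-295476224572611501290, -295476224572611500165⟩⟩,
  ⟨⟨364384154847845875318, 364384154847845876607⟩, ⟨-300852183432023863661, -300852183432023862462⟩⟩,
  ⟨⟨65961256382134716110, 65961256382134721924⟩, ⟨-306097702165893754686, -306097702165893746414⟩⟩,
  ⟨⟨264779382236512419455, 264779382236512435831⟩, ⟨-309734146787305147236, -309734146787304988150⟩⟩,
  ⟨⟨165174609625178964881, 165174609625178993766⟩, ⟨-318616110142586429612, -318616110142586115037⟩⟩,
  ⟨⟨322273774443335071753, 322273774443335217321⟩, ⟨-391553428529251756969, -391553428529251663759⟩⟩,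
  ⟨⟨104726673680903201652, 104726673680903539110⟩, ⟨-398278190457355823773, -398278190457355301178⟩⟩,
  ⟨⟨222669001832001615890, 222669001832001776545⟩, ⟨-400435391884533040544, -400435391884532789447⟩⟩,
  ⟨⟨202501133970036938584, 202501133970043218993⟩, ⟨-419258059741224771537, -419258059741214768411⟩⟩,
  ⟨⟨109113335958604235232, 109113335958622624136⟩, ⟨-455017242933481308828, -455017242933460521519⟩⟩,
  ⟨⟨280163394038824268189, 280163394038824558034⟩, ⟨-482254673626479650277, -482254673626479465056⟩⟩,
  ⟨⟨15725537947171531880, 15725537947202029279⟩, ⟨-490776426125737846119, -490776426125706274627⟩⟩,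
  ⟨⟨186775596027385284428, 186775596027410243586⟩, ⟨-518013856818746190694, -518013856818715215038⟩⟩]
def Ja : List Iv := [
  ⟨40840538114960779241, 40840538114960779244⟩,
  ⟨99471125060817424202, 99471125060817424204⟩,
  ⟨375003658049252450120, 375003658049252450145⟩,
  ⟨49999999999999999996, 50000000000000000008⟩,
  ⟨12908936986666627086, 12908936986666627149⟩,
  ⟨392109448428708735250, 392109448428708735683⟩,
  ⟨88254625233105599532, 88254625233105599692⟩,
  ⟨49115725795908859104, 49115725795908859512⟩,
  ⟨15997436452694612041, 15997436452694612299⟩,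
  ⟨306175973273995151184, 306175973273995155424⟩,
  ⟨49999999999999999306, 50000000000000000695⟩,
  ⟨27678432087497118939, 27678432087497122270⟩,
  ⟨890837417954635281682, 890837417954635325072⟩,
  ⟨66838089305274166508, 66838089305274172207⟩,
  ⟨4777757433493881677, 4777757433493984352⟩,
  ⟨378300925753973837901, 378300925753977227740⟩,
  ⟨49999999999999551963, 50000000000000448036⟩,
  ⟨11974900270498076273, 11974900270502806760⟩,
  ⟨98755797076784859430, 98755797076789715733⟩]

def Lb : List Bx := [
  ⟨⟨0, 0⟩, ⟨0, 0⟩⟩,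
  ⟨⟨0, 0⟩, ⟨-198942250121534251405, -198942250121534251398⟩⟩,
  ⟨⟨0, 0⟩, ⟨-230937123022355750402, -230937123022355750044⟩⟩,
  ⟨⟨0, 0⟩, ⟨-392020629031860214441, -392020629031828578473⟩⟩,
  ⟨⟨-4565819476, -4523112121⟩, ⟨-589532223185929363496, -589532223185883731287⟩⟩,
  ⟨⟨93387798008780031051, 93387798008812222703⟩, ⟨-553773039998671943161, -553773039998635676547⟩⟩,
  ⟨⟨91280065986593961636, 91280065986593961636⟩, ⟨-40840538114513772078, -40840538114513772076⟩⟩,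
  ⟨⟨182560131973187923272, 182560131973187923272⟩, ⟨-81681076229027544156, -81681076229027544152⟩⟩,
  ⟨⟨10271089481901434753, 10271089481901434756⟩, ⟨-99471125060767125703, -99471125060767125698⟩⟩,
  ⟨⟨273840197959781884908, 273840197959781884908⟩, ⟨-122521614343541316234, -122521614343541316228⟩⟩,
  ⟨⟨101551155468495396389, 101551155468495396392⟩, ⟨-140311663175280897781, -140311663175280897774⟩⟩,
  ⟨⟨192831221455089358025, 192831221455089358028⟩, ⟨-181152201289794669859, -181152201289794669850⟩⟩,
  ⟨⟨219256785631140470865, 219256785631140471201⟩, ⟨-206310940027434467744, -206310940027434467289⟩⟩,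
  ⟨⟨98712116920948815799, 98712116920948815836⟩, ⟨-214939686571945000872, -214939686571945000746⟩⟩,
  ⟨⟨319112176403680579895, 319112176403680580453⟩, ⟨-211686898887332079131, -211686898887332078609⟩⟩,
  ⟨⟨164673373302499056823, 164673373302499057493⟩, ⟨-290100265711327619247, -290100265711327618356⟩⟩,
  ⟨⟨264528764075039165852, 264528764075039166746⟩, ⟨-295476224571225230641, -295476224571225229670⟩⟩,
  ⟨⟨364384154847579274882, 364384154847579275998⟩, ⟨-300852183431122842028, -300852183431122840991⟩⟩,
  ⟨⟨65961256381550238817, 65961256381550243868⟩, ⟨-306097702161738371813, -306097702161738364631⟩⟩,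
  ⟨⟨264779382236094990268, 264779382236095004482⟩, ⟨-309734146784712669102, -309734146784712530943⟩⟩,
  ⟨⟨165174609624610706770, 165174609624610731849⟩, ⟨-318616110138302495138, -318616110138302221933⟩⟩,
  ⟨⟨322273774441528230626, 322273774441528357042⟩, ⟨-391553428527635628616, -391553428527635547673⟩⟩,
  ⟨⟨104726673680438166512, 104726673680438459581⟩, ⟨-398278190453150186251, -398278190453149732393⟩⟩,
  ⟨⟨222669001830043946012, 222669001830044085526⟩, ⟨-400435391881225455690, -400435391881225237625⟩⟩,
  ⟨⟨202501133970062027000, 202501133970067481265⟩, ⟨-419258059734736163146, -419258059734727475858⟩⟩,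
  ⟨⟨109113335956716176473, 109113335956732146441⟩, ⟨-455017242921993583481, -455017242921975530598⟩⟩,
  ⟨⟨280163394035477186370, 280163394035477438086⟩, ⟨-482254673624148415203, -482254673624148254355⟩⟩,
  ⟨⟨15725537943370325946, 15725537943396811617⟩, ⟨-490776426109251003816, -490776426109223585338⟩⟩,
  ⟨⟨186775596022125881578, 186775596022147557527⟩, ⟨-518013856811414522826, -518013856811387621807⟩⟩]
def Jb : List Iv := [
  ⟨40840538114513772076, 40840538114513772078⟩,
  ⟨99471125060767125700, 99471125060767125702⟩,
  ⟨375003658052973932011, 375003658052973932030⟩,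
  ⟨49999999999999999994, 50000000000000000005⟩,
  ⟨12908936985641625778, 12908936985641625833⟩,
  ⟨392109448427585231060, 392109448427585231436⟩,
  ⟨88254625233215209843, 88254625233215209982⟩,
  ⟨49115725796009460112, 49115725796009460466⟩,
  ⟨15997436450410749298, 15997436450410749530⟩,
  ⟨306175973276598545144, 306175973276598548830⟩,
  ⟨49999999999999999397, 50000000000000000603⟩,
  ⟨27678432086995439893, 27678432086995442787⟩,
  ⟨890837417956191104753, 890837417956191142425⟩,
  ⟨66838089305244759678, 66838089305244764627⟩,
  ⟨4777757433084608670, 4777757433084697845⟩,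
  ⟨378300925747009812752, 378300925747012756677⟩,
  ⟨49999999999999610898, 50000000000000389099⟩,
  ⟨11974900272530264930, 11974900272534373153⟩,
  ⟨98755797077390789375, 98755797077395006865⟩]

def Lm : List Bx := [
  ⟨⟨0, 0⟩, ⟨0, 0⟩⟩,
  ⟨⟨0, 0⟩, ⟨-198942250122041882772, -198942250121127217035⟩⟩,
  ⟨⟨0, 0⟩, ⟨-230937123047051658446, -230937123002328164509⟩⟩,
  ⟨⟨0, 0⟩, ⟨-392022643521717397481, -392018614619215893195⟩⟩,
  ⟨⟨-2719426182826611, 2719446384092248⟩, ⟨-589535128884625287722, -589529317532592416017⟩⟩,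
  ⟨⟨93385748180811898769, 93389847857416970579⟩, ⟨-553775349325680240349, -553770730702670913338⟩⟩,
  ⟨⟨91280065986393961636, 91280065986593961636⟩, ⟨-40840538114960779244, -40840538114513772076⟩⟩,
  ⟨⟨182560131972787923272, 182560131973187923272⟩, ⟨-81681076229921558488, -81681076229027544152⟩⟩,
  ⟨⟨10271089481314315191, 10271089482001434756⟩, ⟨-99471125061214132869, -99471125060370417035⟩⟩,
  ⟨⟨273840197959181884908, 273840197959781884908⟩, ⟨-122521614344882337732, -122521614343541316228⟩⟩,
  ⟨⟨101551155467708276827, 101551155468595396392⟩, ⟨-140311663176174912113, -140311663174884189111⟩⟩,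
  ⟨⟨192831221454102238463, 192831221455189358028⟩, ⟨-181152201291135691357, -181152201289397961187⟩⟩,
  ⟨⟨219256785609121880562, 219256785652966237184⟩, ⟨-206310940057670448502, -206310939998804757062⟩⟩,
  ⟨⟨98712116918402461302, 98712116923125044045⟩, ⟨-214939686580928638799, -214939686565345822582⟩⟩,
  ⟨⟨319112176367577228384, 319112176439617232206⟩, ⟨-211686898921669623575, -211686898854115555697⟩⟩,
  ⟨⟨164673373259661876216, 164673373345550589460⟩, ⟨-290100265769117537768, -290100265655409219401⟩⟩,
  ⟨⟨264528764017517224038, 264528764132801584482⟩, ⟨-295476224634457734345, -295476224509378996531⟩⟩,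
  ⟨⟨364384154775972571861, 364384154919452579503⟩, ⟨-300852183498456909418, -300852183364689795166⟩⟩,
  ⟨⟨65961256060116095050, 65961256703568865683⟩, ⟨-306097702620719503355, -306097701706912612751⟩⟩,
  ⟨⟨264779381329584962886, 264779383143022310319⟩, ⟨-309734155583720850144, -309734137988286715827⟩⟩,
  ⟨⟨165174608026677361553, 165174611223112033492⟩, ⟨-318616127535217676618, -318616092745650750740⟩⟩,
  ⟨⟨322273766392074352364, 322273782492780261703⟩, ⟨-391553433683854241432, -391553423373028137651⟩⟩,
  ⟨⟨104726655019023182940, 104726692342335843317⟩, ⟨-398278219352401421873, -398278161558093733602⟩⟩,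
  ⟨⟨222668992945686743389, 222669010716349992519⟩, ⟨-400435405769118182158, -400435377996625058312⟩⟩,
  ⟨⟨202500786660986956153, 202501481274361739491⟩, ⟨-419258612912499177104, -419257506573960604947⟩⟩,
  ⟨⟨109112319053992230773, 109114352863328861160⟩, ⟨-455018392471444224477, -455016093403882107626⟩⟩,
  ⟨⟨280163378008176132867, 280163410066107943903⟩, ⟨-482254683869251573446, -482254663381366480137⟩⟩,
  ⟨⟨15723851446997505393, 15727224452295982829⟩, ⟨-490778172030389271850, -490774680233803610305⟩⟩,
  ⟨⟨186774215787806624149, 186776976268449848910⟩, ⟨-518015569766735192976, -518012143872749410659⟩⟩]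
def Jm : List Iv := [
  ⟨40840538114513772076, 40840538114960779244⟩,
  ⟨99471125060756800000, 99471125060827749903⟩,
  ⟨375003658048545022611, 375003658053681359539⟩,
  ⟨49999999999315161755, 50000000000684838246⟩,
  ⟨12908936982794206130, 12908936989514046792⟩,
  ⟨392109448403184961768, 392109448453109004947⟩,
  ⟨88254625224358997518, 88254625241961812014⟩,
  ⟨49115725773533053170, 49115725818385266407⟩,
  ⟨15997436436982341927, 15997436466123019647⟩,
  ⟨306175973040127769606, 306175973510465930729⟩,
  ⟨49999999923191530064, 50000000076808470054⟩,
  ⟨27678431903177236303, 27678432271315324058⟩,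
  ⟨890837415552074919839, 890837420358751512970⟩,
  ⟨66838088990048801985, 66838089620470131117⟩,
  ⟨4777751755947645015, 4777763110624155663⟩,
  ⟨378300738291647529068, 378301113209272108120⟩,
  ⟨49999950447195172320, 50000049552853937340⟩,
  ⟨11974638672927864765, 11975161864053955255⟩,
  ⟨98755528508671874369, 98756065614587717110⟩]

theorem chk_a : chk La Ja = true := by decide +kernel
theorem chk_b : chk Lb Jb = true := by decide +kernel
theorem chk_m : chk Lm Jm = true := by decide +kernel

def cen : List (ℤ × ℤ) := [(0, 0), (0, -198942), (0, -230937), (0, -392021), (0, -589532), (93388, -553773), (91280, -40841), (182560, -81681), (10271, -99471), (273840, -122522), (101551, -140312), (192831, -181152), (219257, -206311), (98712, -214940), (319112, -211687), (164673, -290100), (264529, -295476), (364384, -300852), (65961, -306098), (264779, -309734), (165175, -318616), (322274, -391553), (104727, -398278), (222669, -400435), (202501, -419258), (109113, -455017), (280163, -482255), (15726, -490776), (186776, -518014)]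

end G53
namespace G53

def ctr (i : ℕ) : ℤ × ℤ := cen.getD i (0, 0)

def s1 : ℤ := 91280065986493961636 - 100000000
def s2 : ℤ := 91280065986493961636 + 100000000

def big (i : ℕ) : Bx :=
  ⟨⟨((ctr i).1 - 10) * 1000000000000000, ((ctr i).1 + 10) * 1000000000000000⟩,
   ⟨((ctr i).2 - 10) * 1000000000000000, ((ctr i).2 + 10) * 1000000000000000⟩⟩

theorem big_ok : ∀ i < 29, (bx Lm i).le (big i) = true := by decide +kernel

def Near (A : ℝ × ℝ) (c : ℤ × ℤ) : Prop :=
  |A.1 * 100000 - c.1| ≤ 10 ∧ |A.2 * 100000 - c.2| ≤ 10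

theorem near_of_mem {x : ℝ} {c : ℤ} (h : Mem x ⟨(c - 10) * 1000000000000000, (c + 10) * 1000000000000000⟩) :
    |x * 100000 - c| ≤ 10 := by
  obtain ⟨h1, h2⟩ := h
  simp only [K] at h1 h2
  push_cast at h1 h2
  rw [abs_le]
  constructor <;> linarith

theorem good_id (S : Set ℝ) (I : Iv) (h : ∀ s ∈ S, Mem s I) : Good S I (fun s => s) :=
  ⟨continuousOn_id, h⟩

theorem exists_conf : ∃ H : ℕ → ℝ × ℝ, (∀ i < 5, (H i).1 = 0) ∧
    (∀ e ∈ HE, dsq (H e.1) (H e.2) = 1) ∧ ∀ i < 29, Near (H i) (ctr i) := by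
  have hK := K_pos
  set a : ℝ := (s1 : ℝ) / K with ha
  set b : ℝ := (s2 : ℝ) / K with hb
  have haK : a * K = s1 := by rw [ha]; field_simp
  have hbK : b * K = s2 := by rw [hb]; field_simp
  have hab : a ≤ b := by
    rw [ha, hb]; refine div_le_div_of_nonneg_right ?_ hK.le
    norm_num [s1, s2]
  have A := chain {a} La Ja (good_id _ _ (by
    intro s hs
    rw [Set.mem_singleton_iff] at hs
    subst hs
    have : (Iv.mk s1 s1).le (bx La 6).x = true := by decide +kernel
    refine mem_le ?_ this
    exact ⟨haK.ge, haK.le⟩)) chk_a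
  have B := chain {b} Lb Jb (good_id _ _ (by
    intro s hs
    rw [Set.mem_singleton_iff] at hs
    subst hs
    have : (Iv.mk s2 s2).le (bx Lb 6).x = true := by decide +kernel
    refine mem_le ?_ this
    exact ⟨hbK.ge, hbK.le⟩)) chk_b
  have M := chain (Set.Icc a b) Lm Jm (good_id _ _ (by
    intro s hs
    have : (Iv.mk s1 s2).le (bx Lm 6).x = true := by decide +kernel
    refine mem_le ?_ this
    exact ⟨haK.ge.trans (mul_le_mul_of_nonneg_right hs.1 hK.le),
      (mul_le_mul_of_nonneg_right hs.2 hK.le).trans hbK.le⟩)) chk_m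
  have hA : 0 ≤ (pt a 4).1 := by
    have h1 := ((A.1 4 (by norm_num)).1.2 a rfl).1
    have h2 : 0 ≤ (bx La 4).x.lo := by decide +kernel
    have h3 : (0 : ℝ) ≤ (bx La 4).x.lo := by exact_mod_cast h2
    exact nonneg_of_mul_nonneg_left (h3.trans h1) hK
  have hB : (pt b 4).1 ≤ 0 := by
    have h1 := ((B.1 4 (by norm_num)).1.2 b rfl).2
    have h2 : (bx Lb 4).x.hi ≤ 0 := by decide +kernel
    have h3 : ((bx Lb 4).x.hi : ℝ) ≤ 0 := by exact_mod_cast h2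
    exact nonpos_of_mul_nonpos_left (h1.trans h3) hK
  obtain ⟨s, hs, h0⟩ := intermediate_value_Icc' hab (M.1 4 (by norm_num)).1.1 ⟨hB, hA⟩
  refine ⟨pt s, ?_, M.2 s hs, ?_⟩
  · intro i hi
    interval_cases i
    · simp [pt, p0]
    · rfl
    · rfl
    · rfl
    · exact h0
  · intro i hi
    have h := (M.1 i hi).le (big_ok i hi)
    exact ⟨near_of_mem (h.1.2 s hs), near_of_mem (h.2.2 s hs)⟩

end G53
namespace G53

/-- All edges. -/
def EL : List (ℕ × ℕ) := [(0, 6), (0, 8), (0, 30), (0, 32), (1, 8), (1, 13), (1, 32), (1, 37), (2, 13), (2, 18), (2, 37), (2, 42), (3, 22), (3, 27), (3, 46), (3, 51), (4, 5), (4, 27), (4, 29), (4, 51), (5, 25), (5, 27), (5, 28), (6, 7), (6, 8), (6, 10), (7, 9), (7, 10), (7, 11), (8, 10), (9, 11), (9, 12), (9, 14), (10, 11), (11, 13), (12, 14), (12, 15), (12, 16), (13, 15), (14, 16), (14, 17), (15, 16), (15, 18), (16, 17), (17, 19), (17, 21), (18, 20), (18, 22), (19, 20), (19, 21), (19, 23),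 (20, 22), (20, 23), (21, 23), (21, 26), (22, 24), (23, 26), (24, 25), (24, 26), (24, 28), (25, 27), (25, 28), (26, 28), (29, 49), (29, 51), (29, 52), (30, 31), (30, 32), (30, 34), (31, 33), (31, 34), (31, 35), (32, 34), (33, 35), (33, 36), (33, 38), (34, 35), (35, 37), (36, 38), (36, 39), (36, 40), (37, 39), (38, 40), (38, 41), (39, 40), (39, 42), (40, 41), (41, 43), (41, 45), (42, 44), (42, 46), (43, 44), (43, 45), (43, 47), (44, 46), (44, 47), (45, 47), (45, 50), (46, 48), (47, 50), (48, 49), (48, 50), (48, 52), (49, 51), (49, 52), (50, 52)]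

def half (v : ℕ) : ℕ := if v < 29 then v else v - 24

noncomputable def full (H : ℕ → ℝ × ℝ) (v : ℕ) : ℝ × ℝ :=
  if v < 29 then H v else (-(H (v - 24)).1, (H (v - 24)).2)

def fctr (v : ℕ) : ℤ × ℤ := if v < 29 then ctr v else (-(ctr (v - 24)).1, (ctr (v - 24)).2)

theorem near_full {H : ℕ → ℝ × ℝ} (h : ∀ i < 29, Near (H i) (ctr i)) (v : ℕ) (hv : v < 53) :
    Near (full H v) (fctr v) := by
  unfold full fctr
  split
  · exact h v (by assumption)
  · have := h (v - 24) (by omega)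
    refine ⟨?_, this.2⟩
    have h1 := this.1
    rw [← abs_neg] at h1
    refine le_trans (le_of_eq ?_) h1
    congr 1
    push_cast
    ring

def ifn (n c : ℤ × ℤ) : ℤ := n.1 * c.1 + n.2 * c.2
def rfn (n : ℤ × ℤ) (c : ℝ × ℝ) : ℝ := n.1 * c.1 + n.2 * c.2
def iabs (a : ℤ) : ℤ := if 0 ≤ a then a else -a
def ltB (n c d : ℤ × ℤ) : Bool := decide (ifn n c + 20 * (iabs n.1 + iabs n.2) < ifn n d)

def ltX (c d : ℤ × ℤ) : Bool := decide (c.1 + 20 < d.1)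
def ltY (c d : ℤ × ℤ) : Bool := decide (c.2 + 20 < d.2)

theorem ltB_of_ltX {c d : ℤ × ℤ} (h : ltX c d = true) : ltB (1, 0) c d = true := by
  simp only [ltX, decide_eq_true_eq] at h
  simp [ltB, ifn, iabs, h]

theorem ltB_of_ltY {c d : ℤ × ℤ} (h : ltY c d = true) : ltB (0, 1) c d = true := by
  simp only [ltY, decide_eq_true_eq] at h
  simp [ltB, ifn, iabs, h]

theorem iabs_eq (a : ℤ) : iabs a = |a| := by
  unfold iabs
  split
  · rw [abs_of_nonneg]; assumption
  · rw [abs_of_neg]; omega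

theorem rfn_near {A : ℝ × ℝ} {c : ℤ × ℤ} (n : ℤ × ℤ) (h : Near A c) :
    |rfn n A * 100000 - (ifn n c : ℤ)| ≤ 10 * (|(n.1 : ℝ)| + |(n.2 : ℝ)|) := by
  have e : rfn n A * 100000 - (ifn n c : ℤ) =
      n.1 * (A.1 * 100000 - c.1) + n.2 * (A.2 * 100000 - c.2) := by
    simp only [rfn, ifn]; push_cast; ring
  rw [e]
  refine (abs_add_le _ _).trans ?_
  rw [abs_mul, abs_mul]
  have := mul_le_mul_of_nonneg_left h.1 (abs_nonneg (n.1 : ℝ))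
  have := mul_le_mul_of_nonneg_left h.2 (abs_nonneg (n.2 : ℝ))
  linarith

theorem lt_of_ltB {A B : ℝ × ℝ} {c d : ℤ × ℤ} {n : ℤ × ℤ} (hA : Near A c) (hB : Near B d)
    (h : ltB n c d = true) : rfn n A < rfn n B := by
  simp only [ltB, decide_eq_true_eq, iabs_eq] at h
  have h' : ((ifn n c : ℤ) : ℝ) + 20 * (|(n.1 : ℝ)| + |(n.2 : ℝ)|) < (ifn n d : ℤ) := by exact_mod_cast h
  have h1 := (abs_le.1 (rfn_near n hA)).2
  have h2 := (abs_le.1 (rfn_near n hB)).1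
  linarith

def sepB (n a b c d : ℤ × ℤ) : Bool := ltB n a c && (ltB n a d && (ltB n b c && ltB n b d))
def sepX (a b c d : ℤ × ℤ) : Bool := ltX a c && (ltX a d && (ltX b c && ltX b d))
def sepY (a b c d : ℤ × ℤ) : Bool := ltY a c && (ltY a d && (ltY b c && ltY b d))
def fanB (o p q : ℤ × ℤ) : Bool :=
  ltB (q.1 - p.1, q.2 - p.2) p o && ltB (q.1 - p.1, q.2 - p.2) o q

def disB (a b c d : ℤ × ℤ) : Bool :=
  sepX a b c d || (sepX c d a b || (sepY a b c d || (sepY c d a b ||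
  (sepB (a.2 - b.2, b.1 - a.1) a b c d || (sepB (b.2 - a.2, a.1 - b.1) a b c d ||
  (sepB (c.2 - d.2, d.1 - c.1) a b c d || sepB (d.2 - c.2, c.1 - d.1) a b c d))))))

def pairOk (e f : ℕ × ℕ) : Bool :=
  if e.1 = f.1 then fanB (fctr e.1) (fctr e.2) (fctr f.2)
  else if e.1 = f.2 then fanB (fctr e.1) (fctr e.2) (fctr f.1)
  else if e.2 = f.1 then fanB (fctr e.2) (fctr e.1) (fctr f.2)
  else if e.2 = f.2 then fanB (fctr e.2) (fctr e.1) (fctr f.1)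
  else disB (fctr e.1) (fctr e.2) (fctr f.1) (fctr f.2)

def allP : List (ℕ × ℕ) → Bool
  | [] => true
  | e :: l => l.all (pairOk e) && allP l

theorem allP_EL : allP EL = true := by decide +kernel

theorem of_allP : ∀ l : List (ℕ × ℕ), allP l = true → ∀ e ∈ l, ∀ f ∈ l, e ≠ f →
    pairOk e f = true ∨ pairOk f e = true
  | [], _, e, he, _, _, _ => by simp at he
  | a :: l, h, e, he, f, hf, hne => by
    simp only [allP, Bool.and_eq_true, List.all_eq_true] at h
    rcases List.mem_cons.1 he with rfl | he2 <;> rcases List.mem_cons.1 hf with rfl | hf2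
    · exact absurd rfl hne
    · exact Or.inl (h.1 f hf2)
    · exact Or.inr (h.1 e he2)
    · exact of_allP l h.2 e he2 f hf2 hne

/-- `Z` lies on the segment `A B`. -/
def OnSeg (Z A B : ℝ × ℝ) : Prop :=
  ∃ a b : ℝ, 0 ≤ a ∧ 0 ≤ b ∧ a + b = 1 ∧ Z = (a * A.1 + b * B.1, a * A.2 + b * B.2)

theorem OnSeg.symm {Z A B : ℝ × ℝ} (h : OnSeg Z A B) : OnSeg Z B A := by
  obtain ⟨a, b, ha, hb, hab, rfl⟩ := h
  exact ⟨b, a, hb, ha, by linarith, by ext <;> simp <;> ring⟩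

theorem rfn_seg (n : ℤ × ℤ) (A B : ℝ × ℝ) (a b : ℝ) :
    rfn n (a * A.1 + b * B.1, a * A.2 + b * B.2) = a * rfn n A + b * rfn n B := by
  simp only [rfn]; ring

theorem no_sep {Z A B C D : ℝ × ℝ} {a b c d n : ℤ × ℤ} (hA : Near A a) (hB : Near B b)
    (hC : Near C c) (hD : Near D d) (h : sepB n a b c d = true) (h1 : OnSeg Z A B)
    (h2 : OnSeg Z C D) : False := by
  simp only [sepB, Bool.and_eq_true] at h
  obtain ⟨k1, k2, k3, k4⟩ := h
  replace k1 := lt_of_ltB hA hC k1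
  replace k2 := lt_of_ltB hA hD k2
  replace k3 := lt_of_ltB hB hC k3
  replace k4 := lt_of_ltB hB hD k4
  obtain ⟨s, t, hs, ht, hst, rfl⟩ := h1
  obtain ⟨u, v, hu, hv, huv, e⟩ := h2
  have e2 := congrArg (rfn n) e
  rw [rfn_seg, rfn_seg] at e2
  obtain rfl : t = 1 - s := by linarith
  obtain rfl : v = 1 - u := by linarith
  generalize rfn n A = x at *
  generalize rfn n B = y at *
  generalize rfn n C = z at *
  generalize rfn n D = w at *
  have m1 : s * x + (1 - s) * y ≤ max x y := by
    have := le_max_left x y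
    have := le_max_right x y
    nlinarith
  have m2 : min z w ≤ u * z + (1 - u) * w := by
    have := min_le_left z w
    have := min_le_right z w
    nlinarith
  have m3 : max x y < min z w := by
    rw [max_lt_iff, lt_min_iff, lt_min_iff]; exact ⟨⟨k1, k2⟩, k3, k4⟩
  linarith

theorem no_sepX {Z A B C D : ℝ × ℝ} {a b c d : ℤ × ℤ} (hA : Near A a) (hB : Near B b)
    (hC : Near C c) (hD : Near D d) (h : sepX a b c d = true) (h1 : OnSeg Z A B)
    (h2 : OnSeg Z C D) : False := by
  simp only [sepX, Bool.and_eq_true] at h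
  refine no_sep (n := (1, 0)) hA hB hC hD ?_ h1 h2
  simp only [sepB, ltB_of_ltX h.1, ltB_of_ltX h.2.1, ltB_of_ltX h.2.2.1, ltB_of_ltX h.2.2.2, Bool.and_self]

theorem no_sepY {Z A B C D : ℝ × ℝ} {a b c d : ℤ × ℤ} (hA : Near A a) (hB : Near B b)
    (hC : Near C c) (hD : Near D d) (h : sepY a b c d = true) (h1 : OnSeg Z A B)
    (h2 : OnSeg Z C D) : False := by
  simp only [sepY, Bool.and_eq_true] at h
  refine no_sep (n := (0, 1)) hA hB hC hD ?_ h1 h2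
  simp only [sepB, ltB_of_ltY h.1, ltB_of_ltY h.2.1, ltB_of_ltY h.2.2.1, ltB_of_ltY h.2.2.2, Bool.and_self]

theorem fan {Z O A B : ℝ × ℝ} {o a b : ℤ × ℤ} (hO : Near O o) (hA : Near A a)
    (hB : Near B b) (h : fanB o a b = true) (h1 : OnSeg Z O A) (h2 : OnSeg Z O B) : Z = O := by
  simp only [fanB, Bool.and_eq_true] at h
  obtain ⟨k1, k2⟩ := h
  generalize ((b.1 - a.1, b.2 - a.2) : ℤ × ℤ) = n at *
  replace k1 := lt_of_ltB hA hO k1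
  replace k2 := lt_of_ltB hO hB k2
  obtain ⟨s, t, hs, ht, hst, rfl⟩ := h1
  obtain ⟨u, v, hu, hv, huv, e⟩ := h2
  have e2 := congrArg (rfn n) e
  rw [rfn_seg, rfn_seg] at e2
  obtain rfl : s = 1 - t := by linarith
  obtain rfl : u = 1 - v := by linarith
  have : t = 0 := by
    by_contra hne
    have ht' : 0 < t := lt_of_le_of_ne ht (Ne.symm hne)
    nlinarith
  subst this
  ext <;> simp

theorem pair_sound {F : ℕ → ℝ × ℝ} (hF : ∀ v < 53, Near (F v) (fctr v)) {e f : ℕ × ℕ}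
    (he1 : e.1 < 53) (he2 : e.2 < 53) (hf1 : f.1 < 53) (hf2 : f.2 < 53) (h : pairOk e f = true)
    {Z : ℝ × ℝ} (h1 : OnSeg Z (F e.1) (F e.2)) (h2 : OnSeg Z (F f.1) (F f.2)) :
    (Z = F e.1 ∨ Z = F e.2) ∧ (Z = F f.1 ∨ Z = F f.2) := by
  unfold pairOk at h
  replace he1 := hF _ he1
  replace he2 := hF _ he2
  replace hf1 := hF _ hf1
  replace hf2 := hF _ hf2
  split_ifs at h with g1 g2 g3 g4
  · have := fan he1 he2 hf2 h h1 (by rw [g1]; exact h2)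
    exact ⟨Or.inl this, Or.inl (by rw [← g1]; exact this)⟩
  · have := fan he1 he2 hf1 h h1 (by rw [g2]; exact h2.symm)
    exact ⟨Or.inl this, Or.inr (by rw [← g2]; exact this)⟩
  · have := fan he2 he1 hf2 h h1.symm (by rw [g3]; exact h2)
    exact ⟨Or.inr this, Or.inl (by rw [← g3]; exact this)⟩
  · have := fan he2 he1 hf1 h h1.symm (by rw [g4]; exact h2.symm)
    exact ⟨Or.inr this, Or.inr (by rw [← g4]; exact this)⟩
  · exfalso
    simp only [disB, Bool.or_eq_true] at h
    rcases h with h | h | h | h | h | h | h | h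
    · exact no_sepX he1 he2 hf1 hf2 h h1 h2
    · exact no_sepX hf1 hf2 he1 he2 h h2 h1
    · exact no_sepY he1 he2 hf1 hf2 h h1 h2
    · exact no_sepY hf1 hf2 he1 he2 h h2 h1
    all_goals exact no_sep he1 he2 hf1 hf2 h h1 h2

def apart (v w : ℕ) : Bool :=
  ((ltX (fctr v) (fctr w) || ltX (fctr w) (fctr v)) || ltY (fctr v) (fctr w)) || ltY (fctr w) (fctr v)

def apartAll : List ℕ → Bool
  | [] => true
  | v :: l => l.all (apart v) && apartAll l

theorem of_apartAll : ∀ l : List ℕ, apartAll l = true → ∀ e ∈ l, ∀ f ∈ l, e ≠ f →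
    apart e f = true ∨ apart f e = true
  | [], _, e, he, _, _, _ => by simp at he
  | a :: l, h, e, he, f, hf, hne => by
    simp only [apartAll, Bool.and_eq_true, List.all_eq_true] at h
    rcases List.mem_cons.1 he with rfl | he2 <;> rcases List.mem_cons.1 hf with rfl | hf2
    · exact absurd rfl hne
    · exact Or.inl (h.1 f hf2)
    · exact Or.inr (h.1 e he2)
    · exact of_apartAll l h.2 e he2 f hf2 hne

theorem apart_ok : apartAll (List.range 53) = true := by decide +kernel

theorem apart_ne {H : ℕ → ℝ × ℝ} (h : ∀ i < 29, Near (H i) (ctr i)) {v w : ℕ} (hv : v < 53)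
    (hw : w < 53) (k : apart v w = true) : full H v ≠ full H w := by
  intro e
  have nv := near_full h v hv
  have nw := near_full h w hw
  rw [e] at nv
  simp only [apart, Bool.or_eq_true] at k
  rcases k with ((k | k) | k) | k
  · exact lt_irrefl _ (lt_of_ltB nv nw (ltB_of_ltX k))
  · exact lt_irrefl _ (lt_of_ltB nw nv (ltB_of_ltX k))
  · exact lt_irrefl _ (lt_of_ltB nv nw (ltB_of_ltY k))
  · exact lt_irrefl _ (lt_of_ltB nw nv (ltB_of_ltY k))

theorem full_inj {H : ℕ → ℝ × ℝ} (h : ∀ i < 29, Near (H i) (ctr i)) (v w : ℕ) (hv : v < 53)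
    (hw : w < 53) (e : full H v = full H w) : v = w := by
  by_contra hne
  rcases of_apartAll _ apart_ok v (List.mem_range.2 hv) w (List.mem_range.2 hw) hne with k | k
  · exact apart_ne h hv hw k e
  · exact apart_ne h hw hv k e.symm

def sideOk (e : ℕ × ℕ) : Bool :=
  (decide (e.1 < 29) && decide (e.2 < 29)) ||
  ((decide (e.1 < 5) || decide (29 ≤ e.1)) && (decide (e.2 < 5) || decide (29 ≤ e.2)))

theorem side_EL : ∀ e ∈ EL, sideOk e = true := by decide +kernel
theorem half_EL : ∀ e ∈ EL, ((half e.1, half e.2) ∈ HE ∧ e ≠ (3, 22) ∧ e ≠ (3, 46)) ∨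
    ((half e.1, half e.2) = (3, 22) ∧ (e = (3, 22) ∨ e = (3, 46))) := by decide +kernel

theorem full_left {H : ℕ → ℝ × ℝ} (h0 : ∀ i < 5, (H i).1 = 0) (v : ℕ) (h : v < 5 ∨ 29 ≤ v) :
    full H v = (-(H (half v)).1, (H (half v)).2) := by
  unfold full half
  rcases h with h | h
  · rw [if_pos (by omega), if_pos (by omega)]
    ext
    · simp [h0 v h]
    · rfl
  · rw [if_neg (by omega), if_neg (by omega)]

theorem dsq_full {H : ℕ → ℝ × ℝ} (h0 : ∀ i < 5, (H i).1 = 0) (e : ℕ × ℕ) (h : sideOk e = true) :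
    dsq (full H e.1) (full H e.2) = dsq (H (half e.1)) (H (half e.2)) := by
  simp only [sideOk, Bool.or_eq_true, Bool.and_eq_true, decide_eq_true_eq] at h
  rcases h with h | h
  · simp [full, half, h.1, h.2]
  · rw [full_left h0 _ h.1, full_left h0 _ h.2]
    simp only [dsq]; ring

noncomputable def toE (A : ℝ × ℝ) : EuclideanSpace ℝ (Fin 2) := !₂[A.1, A.2]

theorem toE_inj {A B : ℝ × ℝ} (h : toE A = toE B) : A = B := by
  have h0 := congrArg (fun z : EuclideanSpace ℝ (Fin 2) => z 0) h
  have h1 := congrArg (fun z : EuclideanSpace ℝ (Fin 2) => z 1) h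
  simp [toE] at h0 h1
  exact Prod.ext h0 h1

theorem dist_toE (A B : ℝ × ℝ) : dist (toE A) (toE B) = Real.sqrt (dsq A B) := by
  rw [EuclideanSpace.dist_eq]
  simp [toE, Fin.sum_univ_two, Real.dist_eq, dsq, sq]

theorem onSeg_of_mem {A B : ℝ × ℝ} {z : EuclideanSpace ℝ (Fin 2)} (h : z ∈ segment ℝ (toE A) (toE B)) :
    OnSeg (z 0, z 1) A B ∧ z = toE (z 0, z 1) := by
  obtain ⟨a, b, ha, hb, hab, rfl⟩ := h
  refine ⟨⟨a, b, ha, hb, hab, ?_⟩, ?_⟩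
  · simp [toE]
  · ext i
    fin_cases i <;> simp [toE]

def toF (e : ℕ × ℕ) : Fin 53 × Fin 53 := (Fin.ofNat 53 e.1, Fin.ofNat 53 e.2)

def EF : List (Fin 53 × Fin 53) := EL.map toF

theorem EF_nodup : EF.Nodup := by decide +kernel

theorem EF_mem : ∀ e ∈ EF, (e.1.val, e.2.val) ∈ EL := by
  have hb : ∀ e ∈ EL, e.1 < 53 ∧ e.2 < 53 := by decide +kernel
  intro e he
  obtain ⟨f, hf, rfl⟩ := List.mem_map.1 he
  have h : ((toF f).1.val, (toF f).2.val) = f :=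
    Prod.ext (Nat.mod_eq_of_lt (hb f hf).1) (Nat.mod_eq_of_lt (hb f hf).2)
  rw [h]
  exact hf

def EE : Finset (Fin 53 × Fin 53) := ⟨(EF : Multiset (Fin 53 × Fin 53)), EF_nodup⟩

theorem EE_mem {e : Fin 53 × Fin 53} (h : e ∈ EE) : (e.1.val, e.2.val) ∈ EL :=
  EF_mem e h

theorem EE_filter (p : Fin 53 × Fin 53 → Prop) [DecidablePred p] :
    (EE.filter p).card = EF.countP (fun e => decide (p e)) := by
  rw [List.countP_eq_length_filter]
  rfl

theorem deg_ok : ∀ v : Fin 53, EF.countP (fun e => decide (e.1 = v ∨ e.2 = v)) = 4 := by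
  decide +kernel

theorem cnt_ok : EF.countP (fun e => decide ((e.1.val, e.2.val) ≠ (3, 22) ∧ (e.1.val, e.2.val) ≠ (3, 46))) = 104 := by
  decide +kernel

theorem ord_ok : ∀ e ∈ EF, e.1 < e.2 := by
  have hb : ∀ e ∈ EL, e.1 < e.2 := by decide +kernel
  intro e he
  exact hb _ (EF_mem e he)

theorem special {H : ℕ → ℝ × ℝ} (h : ∀ i < 29, Near (H i) (ctr i)) :
    1.04 < Real.sqrt (dsq (H 3) (H 22)) ∧ Real.sqrt (dsq (H 3) (H 22)) < 1.06 := by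
  have a := h 3 (by norm_num)
  have b := h 22 (by norm_num)
  have ea : ctr 3 = (0, -392021) := by decide +kernel
  have eb : ctr 22 = (104727, -398278) := by decide +kernel
  rw [ea] at a
  rw [eb] at b
  obtain ⟨a1, a2⟩ := a
  obtain ⟨b1, b2⟩ := b
  rw [abs_le] at a1 a2 b1 b2
  push_cast at a1 a2 b1 b2
  have lx := (⟨by linarith, by linarith⟩ : (104707 : ℝ) / 100000 ≤ (H 22).1 - (H 3).1 ∧ (H 22).1 - (H 3).1 ≤ (104747 : ℝ) / 100000)
  have ly := (⟨by linarith, by linarith⟩ : (-6277 : ℝ) / 100000 ≤ (H 22).2 - (H 3).2 ∧ (H 22).2 - (H 3).2 ≤ (-6237 : ℝ) / 100000)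
  constructor
  · apply Real.lt_sqrt_of_sq_lt
    unfold dsq
    nlinarith
  · rw [Real.sqrt_lt' (by norm_num)]
    unfold dsq
    nlinarith

end G53

open G53 in
theorem near_matchstick_53_two_equal :
    ∃ (P : Fin 53 → EuclideanSpace ℝ (Fin 2)) (E : Finset (Fin 53 × Fin 53)),
      Function.Injective P ∧
      (∀ e ∈ E, e.1 < e.2) ∧
      E.card = 106 ∧
      (∀ v : Fin 53, (E.filter (fun e => e.1 = v ∨ e.2 = v)).card = 4) ∧
      (∀ e ∈ E, ∀ f ∈ E, e ≠ f →
        ∀ x ∈ segment ℝ (P e.1) (P e.2) ∩ segment ℝ (P f.1) (P f.2),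
          (x = P e.1 ∨ x = P e.2) ∧ (x = P f.1 ∨ x = P f.2)) ∧
      (E.filter (fun e => dist (P e.1) (P e.2) = 1)).card = 104 ∧
      (∃ t : ℝ, |t - 1| < 0.082 ∧
        ∀ e ∈ E, dist (P e.1) (P e.2) = 1 ∨ dist (P e.1) (P e.2) = t) := by
  obtain ⟨H, h0, hE, hN⟩ := exists_conf
  obtain ⟨t1, t2⟩ := special hN
  have hd : ∀ e ∈ EE, dist (toE (full H e.1.val)) (toE (full H e.2.val)) =
      Real.sqrt (dsq (H (half e.1.val)) (H (half e.2.val))) := by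
    intro e he
    rw [dist_toE, dsq_full h0 (e.1.val, e.2.val) (side_EL _ (EE_mem he))]
  have hc : ∀ e ∈ EE, (dist (toE (full H e.1.val)) (toE (full H e.2.val)) = 1 ∧
      ((e.1.val, e.2.val) ≠ (3, 22) ∧ (e.1.val, e.2.val) ≠ (3, 46))) ∨
      (dist (toE (full H e.1.val)) (toE (full H e.2.val)) = Real.sqrt (dsq (H 3) (H 22)) ∧
      ((e.1.val, e.2.val) = (3, 22) ∨ (e.1.val, e.2.val) = (3, 46))) := by
    intro e he
    rw [hd e he]
    rcases half_EL _ (EE_mem he) with h | h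
    · left
      refine ⟨?_, h.2⟩
      have := hE _ h.1
      dsimp only at this
      rw [this, Real.sqrt_one]
    · right
      refine ⟨?_, h.2⟩
      have h1 := congrArg Prod.fst h.1
      have h2 := congrArg Prod.snd h.1
      dsimp only at h1 h2
      rw [h1, h2]
  refine ⟨fun v => toE (full H v.val), EE, ?_, ord_ok, ?_, ?_, ?_, ?_, ?_⟩
  · intro v w e
    exact Fin.ext (full_inj hN _ _ v.2 w.2 (toE_inj e))
  · change EF.length = 106
    decide +kernel
  · intro v
    rw [EE_filter]
    convert deg_ok v
  · intro e he f hf hne x hx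
    have hne' : ((e.1.val, e.2.val) : ℕ × ℕ) ≠ (f.1.val, f.2.val) := by
      intro hh
      have h1 := congrArg Prod.fst hh
      have h2 := congrArg Prod.snd hh
      exact hne (Prod.ext (Fin.ext h1) (Fin.ext h2))
    obtain ⟨o1, ex⟩ := onSeg_of_mem hx.1
    obtain ⟨o2, -⟩ := onSeg_of_mem hx.2
    have hF := near_full hN
    have key : ((x 0, x 1) = full H e.1.val ∨ (x 0, x 1) = full H e.2.val) ∧
        ((x 0, x 1) = full H f.1.val ∨ (x 0, x 1) = full H f.2.val) := by
      rcases of_allP EL allP_EL _ (EE_mem he) _ (EE_mem hf) hne' with k | k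
      · exact pair_sound hF e.1.2 e.2.2 f.1.2 f.2.2 k o1 o2
      · exact (pair_sound hF f.1.2 f.2.2 e.1.2 e.2.2 k o2 o1).symm
    obtain ⟨k1, k2⟩ := key
    exact ⟨k1.imp (fun h => ex.trans (congrArg toE h)) (fun h => ex.trans (congrArg toE h)),
      k2.imp (fun h => ex.trans (congrArg toE h)) (fun h => ex.trans (congrArg toE h))⟩
  · rw [← cnt_ok, ← EE_filter]
    congr 1
    refine Finset.filter_congr ?_
    intro e he
    rcases hc e he with h | h
    · exact ⟨fun _ => h.2, fun _ => h.1⟩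
    · constructor
      · intro h'
        rw [h.1] at h'
        linarith
      · intro h'
        rcases h.2 with g | g
        · exact absurd g h'.1
        · exact absurd g h'.2
  · refine ⟨Real.sqrt (dsq (H 3) (H 22)), ?_, ?_⟩
    · rw [abs_lt]; constructor <;> linarith
    · intro e he
      rcases hc e he with h | h
      · exact Or.inl h.1
      · exact Or.inr h.1
end

section
/- There exist 54 distinct points in ℝ² and a set E of 108 unordered pairs of these points such that every point is an endpoint of exactly 4 pairs in E, the closed segments of any two distinct pairs intersect at most in a common endpoint, exactly 106 of the pairs join points at distance exactly 1, and the remaining 2 pairs join points at one common distance t with |t − 1| < 0.01. -/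
namespace NM

def xN : ℕ := 488937153394923757504947842914142495793287904714227645748865811562481105193454861580014247409881660479022829144819307765448524057821502456617385025318219549270023385471675225684912314851648156677649500532193784778929747648339952523475349027414976504396348746875113512260017595005586660453125328746501706597915214215671949987977648527919501084922786676851808778081490451846265245857147148285073745514753994444810239160351618437045491360869855062566688649256117868511638668824706686754951414762441480348817115045098980647768156558521251928334734228072250701885365487361707205020009424746800142396
def oN : ℕ := 20402026114200111200911001030010800104015201142510614006150062010305003040121301012009100020901621016190001900003004050010702122021260232402223015260182101113010110171900017006070171802325015170000501324118190132512425022240071200714002050080901622008100020801618023260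
def aN : List ℕ := [
  499305045749832499984945449485504535000349603500425020950464502675000349997499775008949998494534980649533493394948250003494754572745799503175479550492495974945650002501944988250511497915036750085494794936349806503874966249103498984979949479500024972850090504905019454807,
  488804942350539501094921949482504545000350385505895016750257500315000349997497735031050109493274989250282501734947950003494724667646772498295317650514496494911049891501085061950149497585057350802493604886549892508514982549942495115020449360498915039050201506025010852825,
  497545035949861499714930850457506225000449691500715021550432502025000449996500185006849971492794981849600494185045450004495984590845981502605455350482496104933750029501824995750422497925038450154493134924749818504184966449186499554981249313500294978250097506465018254526,
  495584980050426502164978349715498035000050047504755014350381502825000050000496135039150216499984984350026498704971550000489974597646069500495411150552495984956749784501575032850491497545050750535499984931349843507324981449622492925015649998497845018350175500025015753911,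
  492565007949920499484895650021499795000249950501675026950375499885000249998500984989149948489044983849793496315002050002500224602646111501225426850506496094900850052501625020650152497705046550406496704890749838505444964849387501894981549670500524995549943499255016254128,
  490704952950514501234935949331505934999850287505535015050282501104999850002497395036650123494814988250209500914933349998493184659346686498835332350510496464923649877501185052750250497645054550711503424899349882508074982949862494295020050342498775032650243507675011853015,
  498425040849846499854938149559505374985849647500575021250448502345014850142499985007849985493664981249566493785052449858495364581745890502885467450487496044939750015501884992050466497925037550119492514930549812504024966349144499274980549396500154975550094505685018854666,
  492194961250482501624950149193501295056150216505325015550319501564944349439496935035150162496634986750154500214944350561492354632646421499395364350533496234933849838501335047350320497565054050669502384908949867507914982049782494025018049679498385028750188503025013353368,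
  495055022049902499314910049847508624930449815501135022450387501094959350407500775003849931490324983649694495295025350416497734616546240501795420950468496294916950069501645006450296497945040850252494904908249836504624966849303500364982949078500694985850107508675016454126,
  493124966450467501774957849114500395071450170505165015250336501914959650404496715036250177497554986150119499804951850406491694623046324499695377250538496164940249823501395043350367497555053150632501724915149861507754981849738493715017349767498235025850185502195013953518,
  495935026949888499454917349772507774944849771500995022150403501424944850552500575004949945491194983049661494905032449448497114607546149502075433050473496234922850055501705002750340497935040050218494284914049830504464966749262500074982349161500554983150103507895017054266,
  489744947550523501244929649402503655015750339505735016450274500655015749843497515032150124494204988550247501314924650157494074657946675498595330550520496424917349876501155057950196497575056450765504114892749885508354982449898494815019749448498765036250198505205011552975,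
  497815043049137499434983349730502385000149878490344970650870494555000149999500924993449943497764961250020496334972950001497254052940730510095969651170490694989050057503885046050454494575042350935497864991949612499674892349087501444968849786500575040849991502015038860066,
  497404992550465500934979849995500045000149909502394983450243504505000149999498285018750093498914990649973498794999450001499954774647792500375233550305497804970549907500945007949699498745028050191498964957749906503934988249750496745033949896499075006750094500975009452231,
  494345015149635501854939449797501775000249979502705065950773497395000249998496485040650185495794966149787494484979550002497934156541750504435885551075491654920949815503395051450042495045080150941495994891949661509284938248934493114945649599498155012650221503775033958743,
  496984989150525501224974550003499975000149922503894994950232504845000149999497745024450122498674991249944498565000250001500034787147916499695223450293497924962349878500885008550656498805032650192498744945649912505094993849732495735031149874498785003350122501195008852071,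
  494845019849808501584934450098499115000249871501685037750524499805000249998499254954750158495024977449725494995009550002501004454244656502735584950682494664918649842502265022150209496925054650493495254902749774506254956849172503444969849525498424995149390504465022655757,
  493364966850383503694981249420505144999950195505545027650455501004999950001495374996550369501814980750129499364942149999494094485744983500605517350716494794944349631501935054450316496725064050813501724913349807509024973549611496115006250172496315032249596498385019354920,
  491405001849977498404875749982500145000149990501675021450299499925000149999501875006749840497324987149828496994998150001499824678746858500455345650415496824891750160501295019950123498115042350362497454884649871505024968949497501094987549745497754995750227502405012953292,
  494004970250351504284992149441504944999950173505555030650497500984999950001494884986850428501384978950110498994944249999494304444044574501025561750766494394949349572502115054850332496505066350837501314916749789509254971249550496545002950131506615032149440498765021155378,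
  493675013749865500504914550059499465000249911501675032250447499845000249998500144972450435495804980749760495675005650002500604530445402501965503850591495394909549950501935021350180497325050450449496004896549807505834960949282502644975849600495654995350424503765019354921,
  496664984150220506745037449531504155000050081505555043250670500895000050000492864946649586499604971450030497454953050000495214270542871502785746750972492724970049326502865056550398495585075850939499624930749714510204961849299498364989249962504145031649670500365028657283,
  490234995750035497324969349943500495000150031501665015950223499965000149999502755024350117498104990449863497674994250001499424754947605499685264550325497554882749883500965019250094498515038250317498194878549904504604973149607500294993649819498834995950127501705009652456,
  497304987450188507335027249552503965000050058505565046250712500875000050000492384937049645499174969650011497074955250000495434228742462503215791251021492324975050355503045056950414495365078050963499214934049696510434959649238498804985949921503555031549725500745030457741,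
  492505007649923503274933150019499815000249952501675026650371499885000249998501035065050327496584984049795496355001850002500204606546149501185422750501496124900449673501605020650151497725046350404496744890449840505424965049392501854981849674496734995550323503065016054085,
  499965001450057498914984849641503165000149966505575058850886500785000149999490354984649891497394962149932495534964050001496344055240759504975976251227490654995750109503795058650480494445087551064497514948049621511384950248987500614972149751501095031149955502345037959647,
  489064989650093500094988049904500845000150071501665010350147500005000149999499795003550009498884993749898498354990450001499024831048352498905183450235498294987149991500635018450065498925034050273498944872349937504194977249718499504999649894499914996150026501005006351621,
  500605004750025499504974649663502975000249944505575061950927500765000249998500764996049950496964960349913495164966150002496564013440350505406020751277490244979650050503975059050496494215089851089497114951449603511614947948926501054968849711500505031050010502725039760105,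
  495715026149438500894956849771502015000249939497815073550811496275000249998498245021950089496574964249879495214976950002497664115541347506675918751113491274947849911503585049249931494855065150938496734931449642505484920148994496405024149673499115023750130503075035859266,
  500205014950064498985015249940500535000049828492435012850321502225000050000501864980749898500504986750161500274994050000499394691246971504945301350381497025025450102501335003550395498364997550186500475038349867496184951249873503454960250047501025029449909499565013353297,
  500825060749696499854964049633503225000249502497955005250240502635000249998500085003649985496254982349602494254963150002496264504745176504805547250552494914965550015501775067050408496675031650935496434960749823502194954549060499754980849643500154977950051503355017755596,
  495614982050134500684991250052499545000050132497894962949454499725000050000498785012650068499804978150220500015005250000500534507345162503505483550670495314984549932502194995449726497495034350191499814976249781502444951449766497745026849981499325043950058500185021954876,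
  505815008350006500054973849764502075000149915501255013850253500895000149999499785005350005497434917749362496134976350001497604816547501502385261550320504674973349995497495044250214502165014350210497554968250251502024994148973499324993049755499954928050047502304974952683,
  491374927550607501124933149592503575000350508506215013950173499615000349997497735029650112494424964349139492064959050003495854763947444497985231550447499934921949888499325084050032499265048550852494694899150068507784993649891495255025649469498885021350184505004993251986,
  499815042749846499994947749507504335000349628500495020350448502535000349997499775008649999494764975649448492044950450003494974591945933503115462350478496664947850001502445091650487499105034950095495014938849756503724968449092499014981049501500014969250087504705024454639,
  492264922450631501124936949631503245000350551506335013050144499365000349997497745029150112494824955749710492674962850003496244797247677497875201650423501124925749888504435076949991505555045450869495074903549557507534997449873495295027449507498885015250178504645044351696,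
  503075024049933500024961849647503105000249784500905016850342501645000249998499785006850002496214944248910494264964550002496404713846784502715353350392501014961649998494845065850339504895023750157496394954750516502804982349028499184987549639499984946950066503405055853577,
  493554915050665501144942549686502755000250613506495011650103499015000249998497745028450114495394943349497493554968450002496804845448013497725158650389502844931149886501425066849932497095041050894495614909849858507165002949848495365029949561498865006450170504135056751276,
  502555027049919500024959649624503305000249759500835017450359501785000249998499785007150002495984949148995493914962250002496174694646650502785370550406500324959449998494355069950362505415025550147496174952249491502944980149038499154986549617499984950450069503605050953745,
  490094934950573501104927549537504065000350447506055015350215499965000349997497735030350110493854976750069491194953450003495284715747108498135274550480498214916449890498085094150090500545052950827494144892849767508144988049917495185023049414498905030250193505515023352406,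
  499144939150297500145036250368496774999849497501964994349755497394999850002499934996250014503765017450403505775037049998503755489754768495264458149455505045034849986498264932749593503304968549065503585039750174497785044750940500285019150358499865022949948496634982644459,
  500894997449217498835031250060499484999949739493274996850109502444999950001502204975549883501944997450266502405006149999500624967849673502645007350047499805042950117500264980150327500064978149809501855060149974494634976350265504234959250185501175029249872498265002650317,
  506325005350019500064976049786501885000149940501315013350236500755000149999499785005050006497665020249446496484978550001497824835747635502325244350307503664975449994497985040150190501655012650220497774970750202501874996348963499354994149777499944924550044502104979852515,
  494844907650700501154948149741502275000250674506655010250061498665000249998497745027650115495964973349709494424973950002497364893548349497565115550356493144936649885502675056649874495805036650919496164916149733506805008449822495435032549616498854997550161503615026750857,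
  509064989650093500094988049904500845000150071501665010350147500005000149999499795003550009498884993749898498354990450001499024831048352501995152550235498294987149991500635018450065498925003150273498944984149937501105008148909499504999649894499914996150026501005006351621,
  492664920150641501134938749648503095000250570506385012550131499265000249998497745028950113494994994349350492944964550002496414769647781497825188450413497414927449887500575073849973497975044150877495234905449943507414999149865495315028249523498874940750176504485005751567,
  506614962250335500324956449653503045000250258506005037450532500015000249998499245012550032495964977249630494024965150002496474388544036499125663450849493804953349968502285066750236496075011350988496154942549772503975029348979498174998549615499684985850093503625022855864,
  495164947950395500904970849903500855000150380501954985049739499255000149999498295019650090497975011149623497354990250001499015220252175500754810849787501984961849910498895024649799500875035750149498074947750111504494977549794496665029349807499104951250107501824988947245,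
  510005000050000500005000050000500005000050000500005000050000500005000050000500005000050000500005000050000500005000050000500005000050000500005000050000500005000050000500005000050000500005000050000500005000050000500005000050000500005000050000500005000050000500005000050000,
  496034957750308500824982049993500065000050313500404975349602499255000050000498495016450082499025017049719498894999250000499925378153715490654639549568503584973949918498305007449738501885032849894499064962650170503474970050058497135029749906499184954950083500884983045731,
  507554972750242500234968549749502205000150187504345027050385500005000149999499455009050023497074983549732495674974850001497444557545685497125480050614495514966249977501655048350171497165089150715497224958449835502875052149261498684998949722499774989750068502625016554243,
  498534985550061500585014150248497824999950123495984947849210499254999950001499055007250058502005033849992503305024949999502535828758110493584150648943508155008349942496624958349565504774942049166501905004950338500545059750810498485030850190499424965450014498214966241410,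
  503874978050262500294944549536504085000350127505655040350621500755000349997499245014050029494735003749178492154953350003495274962149678499455119450921499174941649971499635088450361498815020850935494994929150037504745017549033498034993049499499714914250112504714996351071,
  497334935450453500924980249997500025000150484502234982649669498665000149999498305018450092498944990149982498834999650001499974764947697500495242649730497714971049908500995007449700498705028250191498994958449901503874986949751496775033649899499085008050092500955009952328]
def incN : List (List ℕ) := [[14, 19, 31, 32], [29, 46, 47, 48], [2, 6, 35], [31, 39, 40, 48], [30, 39, 46], [6, 14, 30, 40], [18, 41, 42, 43], [7, 8, 18, 29], [2, 3, 5, 47], [5, 35, 36, 49], [3, 21, 36, 37], [21, 22, 49, 50], [8, 37, 38, 50], [11, 13, 22, 38], [7, 43, 44, 51], [15, 24, 42, 45], [1, 4, 33, 34], [15, 17, 19, 20], [1, 12, 17, 23], [12, 20, 32, 33], [41, 45, 51, 52], [23, 27, 28, 34], [4, 9, 25, 28], [0, 16, 25, 26], [9, 10, 13, 26, 53], [10, 11, 16, 44], [0, 24, 27, 52]]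

/-- `all n f`: the test `f` holds for all naturals below `n`. -/
def allB : ℕ → (ℕ → Bool) → Bool
  | 0, _ => true
  | n + 1, f => f n && allB n f

theorem allB_spec {f : ℕ → Bool} : ∀ {n : ℕ}, allB n f = true → ∀ i < n, f i = true
  | 0, _, i, hi => absurd hi (Nat.not_lt_zero i)
  | n + 1, h, i, hi => by
    have h' : f n = true ∧ allB n f = true := by
      simpa [allB] using h
    rcases Nat.lt_succ_iff_lt_or_eq.mp hi with h1 | h1
    · exact allB_spec h'.2 i h1
    · exact h1 ▸ h'.1

/-- sum of natural numbers `f 0 + ... + f (n-1)` -/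
def sumN : ℕ → (ℕ → ℕ) → ℕ
  | 0, _ => 0
  | n + 1, f => sumN n f + f n

theorem sumN_eq (f : ℕ → ℕ) : ∀ n, sumN n f = ∑ i ∈ Finset.range n, f i
  | 0 => rfl
  | n + 1 => by rw [sumN, sumN_eq f n, Finset.sum_range_succ]

/-- approximate coordinates, unit `10⁻⁹` -/
def xI (i : ℕ) : ℤ := ((xN / 10 ^ (11 * i) % 100000000000 : ℕ) : ℤ) - 50000000000
/-- orbit data -/
def oI (k : ℕ) : ℕ := oN / 10 ^ (5 * k) % 100000
def oa (k : ℕ) : ℕ := oI k / 1000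
def ob (k : ℕ) : ℕ := oI k / 10 % 100
def os (k : ℕ) : ℕ := oI k % 10
/-- sign of the second endpoint of an orbit -/
def sgn (k : ℕ) : ℤ := bif Nat.beq (os k) 0 then 1 else -1
/-- approximate inverse Jacobian, unit `10⁻³` -/
def aI (i k : ℕ) : ℤ := (((aN.getD i 0) / 10 ^ (5 * k) % 100000 : ℕ) : ℤ) - 50000
def dX (k : ℕ) : ℤ := xI (2 * oa k) - sgn k * xI (2 * ob k)
def dY (k : ℕ) : ℤ := xI (2 * oa k + 1) - sgn k * xI (2 * ob k + 1)
/-- indicator -/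
def ind (i j : ℕ) : ℤ := bif Nat.beq i j then 1 else 0
/-- Jacobian, unit `10⁻⁹` -/
def jI (k j : ℕ) : ℤ :=
  bif Nat.beq k 53 then 1000000000 * ind j 48 else
    dX k * (ind j (2 * oa k) - sgn k * ind j (2 * ob k))
      + dY k * (ind j (2 * oa k + 1) - sgn k * ind j (2 * ob k + 1))
def inc (j : ℕ) : List ℕ := incN.getD (j / 2) []
/-- a row of `A * J` -/
def ajI (i j : ℕ) : ℤ := ((inc j).map (fun k => aI i k * jI k j)).sum

theorem chk_orb : allB 54 (fun k => Nat.blt (oa k) 27 && Nat.blt (ob k) 27 &&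
    Nat.ble (os k) 1 && (Nat.blt (oa k) (ob k) || Nat.beq (os k) 1)) = true := by decide +kernel

theorem chk_res : allB 53 (fun k =>
    Nat.ble (dX k * dX k + dY k * dY k - 1000000000000000000).natAbs 4000000000) = true := by
  decide +kernel

theorem chk_norm : allB 54 (fun i =>
    Nat.ble (sumN 54 (fun k => (aI i k).natAbs)) 60000) = true := by decide +kernel

theorem chk_inc : allB 54 (fun j => allB 54 (fun k =>
    (inc j).elem k || Nat.beq (jI k j).natAbs 0)) = true := by decide +kernel

theorem chk_inc2 : allB 54 (fun j => decide ((inc j).Nodup) && (inc j).all (fun k => Nat.blt k 54)) = true := by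
  decide +kernel

theorem chk_con : allB 54 (fun i =>
    Nat.ble (sumN 54 (fun j => (1000000000000 * ind i j - ajI i j).natAbs)) 250000000000) = true := by
  decide +kernel

/-- approximate vertices, unit `10⁻⁹` -/
def vX (i : ℕ) : ℤ := bif Nat.blt i 27 then xI (2 * i) else -xI (2 * (i - 27))
def vY (i : ℕ) : ℤ := bif Nat.blt i 27 then xI (2 * i + 1) else -xI (2 * (i - 27) + 1)

/-- endpoints of the edge with index `e < 108` -/
def eu (e : ℕ) : ℕ :=
  bif Nat.blt e 54 then oa e else
    bif Nat.beq (os (e - 54)) 0 then oa (e - 54) + 27 else ob (e - 54)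
def ev (e : ℕ) : ℕ :=
  bif Nat.blt e 54 then (bif Nat.beq (os e) 0 then ob e else ob e + 27) else
    bif Nat.beq (os (e - 54)) 0 then ob (e - 54) + 27 else oa (e - 54) + 27

/-- the functional `(p, q)` is safely larger at vertex `i` than at vertex `j` -/
def gtB (p q : ℤ) (i j : ℕ) : Bool :=
  decide (2000 * ((p.natAbs + q.natAbs : ℕ) : ℤ) < p * (vX i - vX j) + q * (vY i - vY j))
def sepB (a b c d : ℕ) (p q : ℤ) : Bool :=
  gtB p q c a && gtB p q c b && gtB p q d a && gtB p q d b
def shrB (v a b : ℕ) (p q : ℤ) : Bool := gtB p q a v && gtB p q v b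
/-- edges `ab`, `cd` with distinct endpoints are separated -/
def sepAny (a b c d : ℕ) : Bool :=
  sepB a b c d (-1) 0 || sepB a b c d 1 0 || sepB a b c d 0 1 || sepB a b c d 0 (-1) ||
  sepB a b c d (vY a - vY b) (vX b - vX a) || sepB a b c d (vY b - vY a) (vX a - vX b)
/-- edges `va`, `vb` meet only in `v` -/
def shrAny (v a b : ℕ) : Bool :=
  shrB v a b (vX a - vX b) (vY a - vY b) ||
  shrB v a b (2 * vY v - vY a - vY b) (vX a + vX b - 2 * vX v) ||
  shrB v a b (vY a + vY b - 2 * vY v) (2 * vX v - vX a - vX b)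
def prB (a b c d : ℕ) : Bool :=
  bif Nat.beq a c then shrAny a b d else
  bif Nat.beq a d then shrAny a b c else
  bif Nat.beq b c then shrAny b a d else
  bif Nat.beq b d then shrAny b a c else sepAny a b c d

theorem chk_pr : allB 108 (fun e => allB e (fun f => prB (eu e) (ev e) (eu f) (ev f))) = true := by
  decide +kernel

theorem chk_inj : allB 54 (fun i => allB i (fun j =>
    gtB 1 0 i j || gtB (-1) 0 i j || gtB 0 1 i j || gtB 0 (-1) i j)) = true := by
  decide +kernel

theorem chk_edge : allB 108 (fun e => Nat.blt (eu e) (ev e) && Nat.blt (ev e) 54) = true := by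
  decide +kernel

theorem chk_edge_inj : allB 108 (fun e => allB e (fun f =>
    !(Nat.beq (eu e) (eu f) && Nat.beq (ev e) (ev f)))) = true := by
  decide +kernel

theorem chk_deg : ∀ v : Fin 54, (Finset.univ.filter
    (fun e : Fin 108 => eu e = v.1 ∨ ev e = v.1)).card = 4 := by
  decide +kernel

theorem sum_abs_bound {n : ℕ} (c v : Fin n → ℝ) (C V : ℝ) (hc : ∑ k, |c k| ≤ C)
    (hv : ∀ k, |v k| ≤ V) (hV : 0 ≤ V) : |∑ k, c k * v k| ≤ C * V := by
  calc |∑ k, c k * v k| ≤ ∑ k, |c k * v k| := Finset.abs_sum_le_sum_abs _ _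
    _ ≤ ∑ k, |c k| * V := Finset.sum_le_sum fun k _ => by
        rw [abs_mul]; exact mul_le_mul_of_nonneg_left (hv k) (abs_nonneg _)
    _ = (∑ k, |c k|) * V := by rw [Finset.sum_mul]
    _ ≤ C * V := mul_le_mul_of_nonneg_right hc hV

theorem kraw {n : ℕ} (A J : Matrix (Fin n) (Fin n) ℝ) (F : (Fin n → ℝ) → Fin n → ℝ)
    (x0 : Fin n → ℝ) (r : ℝ) (hr : 0 < r) (hr' : r ≤ 1 / 1000000)
    (hF : ∀ z w, ‖z - x0‖ ≤ r → ‖w - x0‖ ≤ r → ∀ k,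
      |F z k - F w k - (J.mulVec (z - w)) k| ≤ 8 * r * ‖z - w‖)
    (hAJ : ∀ i, ∑ j, |(1 - A * J) i j| ≤ 1 / 4)
    (hA : ∀ i, ∑ k, |A i k| ≤ 60)
    (hF0 : ∀ k, |F x0 k| ≤ r / 200) :
    ∃ z, ‖z - x0‖ ≤ r ∧ F z = 0 := by
  have hdet : A.det ≠ 0 := by
    have h1 : (A * J).det ≠ 0 := by
      apply det_ne_zero_of_sum_row_lt_diag
      intro k
      have h2 := hAJ k
      rw [← Finset.add_sum_erase _ _ (Finset.mem_univ k)] at h2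
      have h3 : ∑ j ∈ Finset.univ.erase k, ‖(A * J) k j‖
          = ∑ j ∈ Finset.univ.erase k, |(1 - A * J) k j| := by
        apply Finset.sum_congr rfl
        intro j hj
        rw [Matrix.sub_apply, Matrix.one_apply_ne (Finset.ne_of_mem_erase hj).symm,
          zero_sub, abs_neg, Real.norm_eq_abs]
      rw [h3, Real.norm_eq_abs]
      rw [Matrix.sub_apply, Matrix.one_apply_eq] at h2
      have h4 : 1 - |(A * J) k k| ≤ |1 - (A * J) k k| := by
        have := abs_sub_abs_le_abs_sub 1 ((A * J) k k)
        rwa [abs_one] at this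
      have h5 : 1 - |1 - (A * J) k k| ≤ |(A * J) k k| := by
        have := abs_sub_abs_le_abs_sub 1 (1 - (A * J) k k)
        rw [abs_one, sub_sub_cancel] at this
        exact this
      linarith
    intro h
    apply h1
    rw [Matrix.det_mul, h, zero_mul]
  let T : (Fin n → ℝ) → Fin n → ℝ := fun z => z - A.mulVec (F z)
  have hT : ∀ z w, ‖z - x0‖ ≤ r → ‖w - x0‖ ≤ r → ‖T z - T w‖ ≤ 1 / 2 * ‖z - w‖ := by
    intro z w hz hw
    rw [pi_norm_le_iff_of_nonneg (by positivity)]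
    intro i
    let ρ : Fin n → ℝ := F z - F w - J.mulVec (z - w)
    have e1 : T z - T w = (1 - A * J).mulVec (z - w) - A.mulVec ρ := by
      simp only [T, ρ, Matrix.sub_mulVec, Matrix.one_mulVec, Matrix.mulVec_sub,
        Matrix.mulVec_mulVec]
      abel
    have b1 := sum_abs_bound (fun j => (1 - A * J) i j) (z - w) (1 / 4) ‖z - w‖ (hAJ i)
      (fun k => norm_le_pi_norm (z - w) k) (norm_nonneg _)
    have b2 := sum_abs_bound (fun j => A i j) ρ 60 (8 * r * ‖z - w‖) (hA i)
      (fun k => hF z w hz hw k) (by positivity)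
    rw [e1, Real.norm_eq_abs]
    have e2 : ((1 - A * J).mulVec (z - w) - A.mulVec ρ) i =
      ∑ k, (1 - A * J) i k * (z - w) k - ∑ k, A i k * ρ k := rfl
    rw [e2]
    refine (abs_sub _ _).trans ?_
    have : 60 * (8 * r * ‖z - w‖) ≤ 1 / 4 * ‖z - w‖ := by
      nlinarith [norm_nonneg (z - w)]
    linarith
  have h0 : ‖x0 - x0‖ ≤ r := by simpa using hr.le
  have hT0 : ‖T x0 - x0‖ ≤ r / 2 := by
    rw [pi_norm_le_iff_of_nonneg (by positivity)]
    intro i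
    have b2 := sum_abs_bound (fun j => A i j) (F x0) 60 (r / 200) (hA i) hF0 (by positivity)
    have e2 : (T x0 - x0) i = - ∑ k, A i k * F x0 k := by
      simp only [T, sub_sub_cancel_left, Pi.neg_apply]
      rfl
    rw [e2, Real.norm_eq_abs, abs_neg]
    linarith
  let s : Set (Fin n → ℝ) := Metric.closedBall x0 r
  have hs : IsComplete s := Metric.isClosed_closedBall.isComplete
  have hm : Set.MapsTo T s s := by
    intro z hz
    rw [Metric.mem_closedBall, dist_eq_norm] at hz ⊢
    have := hT z x0 hz h0
    calc ‖T z - x0‖ = ‖(T z - T x0) + (T x0 - x0)‖ := by congr 1; abel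
      _ ≤ ‖T z - T x0‖ + ‖T x0 - x0‖ := norm_add_le _ _
      _ ≤ r := by linarith
  have hc : ContractingWith (1 / 2 : NNReal) (hm.restrict T s s) := by
    refine ⟨by
      rw [← NNReal.coe_lt_coe]; push_cast; norm_num, ?_⟩
    apply LipschitzWith.of_dist_le_mul
    rintro ⟨z, hz⟩ ⟨w, hw⟩
    simp only [s, Metric.mem_closedBall, dist_eq_norm] at hz hw
    have := hT z w hz hw
    rw [Subtype.dist_eq, Subtype.dist_eq, dist_eq_norm, dist_eq_norm]
    push_cast
    exact this
  obtain ⟨y, hy, hfix, -⟩ := hc.exists_fixedPoint' hs hm (x := x0)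
    (Metric.mem_closedBall_self hr.le) (edist_ne_top _ _)
  rw [Metric.mem_closedBall, dist_eq_norm] at hy
  refine ⟨y, hy, ?_⟩
  have h1 : A.mulVec (F y) = 0 := by
    have : y - A.mulVec (F y) = y := hfix
    simpa using this
  exact Matrix.eq_zero_of_mulVec_eq_zero hdet h1

theorem orb_spec {k : ℕ} (hk : k < 54) : oa k < 27 ∧ ob k < 27 ∧ os k ≤ 1 ∧
    (oa k < ob k ∨ os k = 1) := by
  have h := allB_spec chk_orb k hk
  simp only [Bool.and_eq_true, Bool.or_eq_true, Nat.blt_eq, Nat.ble_eq, Nat.beq_eq] at h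
  tauto

theorem sgn_cases (k : ℕ) : (os k = 0 ∧ sgn k = 1) ∨ (os k ≠ 0 ∧ sgn k = -1) := by
  unfold sgn
  by_cases h : os k = 0
  · left; simp [h]
  · right
    have : Nat.beq (os k) 0 = false := by
      rw [← Bool.not_eq_true, Nat.beq_eq]; exact h
    rw [this]
    exact ⟨h, rfl⟩

theorem ind_eq (i j : ℕ) : ind i j = if i = j then 1 else 0 := by
  unfold ind
  by_cases h : i = j
  · have : Nat.beq i j = true := by rw [Nat.beq_eq]; exact h
    rw [this, if_pos h]; rfl
  · have : Nat.beq i j = false := by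
      rw [← Bool.not_eq_true, Nat.beq_eq]; exact h
    rw [this, if_neg h]; rfl

theorem jI_last (j : ℕ) : jI 53 j = 1000000000 * ind j 48 := rfl

theorem jI_ne {k : ℕ} (hk : k ≠ 53) (j : ℕ) : jI k j =
    dX k * (ind j (2 * oa k) - sgn k * ind j (2 * ob k))
      + dY k * (ind j (2 * oa k + 1) - sgn k * ind j (2 * ob k + 1)) := by
  unfold jI
  have : Nat.beq k 53 = false := by
    rw [← Bool.not_eq_true, Nat.beq_eq]; exact hk
  rw [this]; rfl

/-- coordinate of a vector by natural index -/
def g (z : Fin 54 → ℝ) (m : ℕ) : ℝ := z (Fin.ofNat 54 m)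

theorem sum_ind (v : Fin 54 → ℝ) {m : ℕ} (hm : m < 54) :
    ∑ j : Fin 54, ((ind j.1 m : ℤ) : ℝ) * v j = g v m := by
  rw [Finset.sum_eq_single (Fin.ofNat 54 m)]
  · rw [ind_eq, if_pos]
    · simp [g]
    · simp [Fin.ofNat, Nat.mod_eq_of_lt hm]
  · intro j _ hj
    rw [ind_eq, if_neg]
    · simp
    · intro h
      apply hj
      ext
      simp [Fin.ofNat, h, Nat.mod_eq_of_lt hm]
  · intro h; exact absurd (Finset.mem_univ _) h

/-- coordinate differences along an orbit -/
def eX (z : Fin 54 → ℝ) (k : ℕ) : ℝ := g z (2 * oa k) - sgn k * g z (2 * ob k)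
def eY (z : Fin 54 → ℝ) (k : ℕ) : ℝ := g z (2 * oa k + 1) - sgn k * g z (2 * ob k + 1)

/-- starting point -/
noncomputable def x0 (i : Fin 54) : ℝ := (xI i.1 : ℝ) / 1000000000

noncomputable def matA : Matrix (Fin 54) (Fin 54) ℝ := fun i k => (aI i.1 k.1 : ℝ) / 1000
noncomputable def matJ : Matrix (Fin 54) (Fin 54) ℝ :=
  fun k j => (jI k.1 j.1 : ℝ) / 1000000000

noncomputable def FF (z : Fin 54 → ℝ) (k : Fin 54) : ℝ :=
  if k.1 = 53 then g z 48 - g x0 48 else (eX z k.1 ^ 2 + eY z k.1 ^ 2 - 1) / 2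

theorem matJ_mul_last (v : Fin 54 → ℝ) {k : Fin 54} (hk : k.1 = 53) :
    (matJ.mulVec v) k = g v 48 := by
  rw [← sum_ind v (m := 48) (by norm_num)]
  show ∑ j, matJ k j * v j = _
  apply Finset.sum_congr rfl
  intro j _
  simp only [matJ, hk, jI_last]
  push_cast
  ring

theorem matJ_mul (v : Fin 54 → ℝ) {k : Fin 54} (hk : k.1 ≠ 53) :
    (matJ.mulVec v) k = ((dX k.1 : ℝ) * eX v k.1 + (dY k.1 : ℝ) * eY v k.1) / 1000000000 := by
  obtain ⟨h1, h2, -⟩ := orb_spec k.2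
  unfold eX eY
  rw [← sum_ind v (m := 2 * oa k.1) (by omega), ← sum_ind v (m := 2 * ob k.1) (by omega),
    ← sum_ind v (m := 2 * oa k.1 + 1) (by omega), ← sum_ind v (m := 2 * ob k.1 + 1) (by omega),
    Finset.mul_sum, Finset.mul_sum, ← Finset.sum_sub_distrib, ← Finset.sum_sub_distrib,
    Finset.mul_sum, Finset.mul_sum, ← Finset.sum_add_distrib, Finset.sum_div]
  show ∑ j, matJ k j * v j = _
  apply Finset.sum_congr rfl
  intro j _
  simp only [matJ, jI_ne hk]
  push_cast
  ring

theorem g_sub (z w : Fin 54 → ℝ) (m : ℕ) : g (z - w) m = g z m - g w m := rfl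

theorem g_abs (z : Fin 54 → ℝ) (m : ℕ) : |g z m| ≤ ‖z‖ := norm_le_pi_norm z _

theorem eX_sub (z w : Fin 54 → ℝ) (k : ℕ) : eX (z - w) k = eX z k - eX w k := by
  simp only [eX, g_sub]; ring
theorem eY_sub (z w : Fin 54 → ℝ) (k : ℕ) : eY (z - w) k = eY z k - eY w k := by
  simp only [eY, g_sub]; ring

theorem sgn_diff (k : ℕ) {a b c : ℝ} (ha : |a| ≤ c) (hb : |b| ≤ c) :
    |a - (sgn k : ℝ) * b| ≤ 2 * c := by
  rw [abs_le] at ha hb ⊢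
  rcases sgn_cases k with h | h <;> rw [h.2] <;> push_cast <;> constructor <;> linarith

theorem eX_abs (z : Fin 54 → ℝ) (k : ℕ) : |eX z k| ≤ 2 * ‖z‖ :=
  sgn_diff k (g_abs _ _) (g_abs _ _)
theorem eY_abs (z : Fin 54 → ℝ) (k : ℕ) : |eY z k| ≤ 2 * ‖z‖ :=
  sgn_diff k (g_abs _ _) (g_abs _ _)

theorem g_x0 {m : ℕ} (hm : m < 54) : g x0 m = (xI m : ℝ) / 1000000000 := by
  simp [g, x0, Fin.ofNat, Nat.mod_eq_of_lt hm]

theorem eX_x0 {k : ℕ} (hk : k < 54) : eX x0 k = (dX k : ℝ) / 1000000000 := by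
  obtain ⟨h1, h2, -⟩ := orb_spec hk
  rw [eX, g_x0 (by omega), g_x0 (by omega), dX]; push_cast; ring
theorem eY_x0 {k : ℕ} (hk : k < 54) : eY x0 k = (dY k : ℝ) / 1000000000 := by
  obtain ⟨h1, h2, -⟩ := orb_spec hk
  rw [eY, g_x0 (by omega), g_x0 (by omega), dY]; push_cast; ring

theorem ajI_eq {i j : ℕ} (hj : j < 54) :
    ∑ k : Fin 54, aI i k.1 * jI k.1 j = ajI i j := by
  have h1 := allB_spec chk_inc j hj
  have h2 := allB_spec chk_inc2 j hj
  simp only [Bool.and_eq_true, decide_eq_true_eq, List.all_eq_true, Nat.blt_eq] at h2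
  rw [Fin.sum_univ_eq_sum_range (fun k => aI i k * jI k j) 54, ajI,
    ← List.sum_toFinset _ h2.1]
  symm
  apply Finset.sum_subset
  · intro k hk
    exact Finset.mem_range.mpr (h2.2 k (List.mem_toFinset.mp hk))
  · intro k hk hk'
    have h3 := allB_spec h1 k (Finset.mem_range.mp hk)
    simp only [Bool.or_eq_true, List.elem_eq_mem, decide_eq_true_eq, Nat.beq_eq] at h3
    rcases h3 with h3 | h3
    · exact absurd (List.mem_toFinset.mpr h3) hk'
    · rw [Int.natAbs_eq_zero.mp h3, mul_zero]

theorem abs_cast_nat (a : ℤ) : |(a : ℝ)| = ((a.natAbs : ℕ) : ℝ) := by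
  rw [Nat.cast_natAbs]; push_cast; rfl

theorem hAJ (i : Fin 54) : ∑ j, |(1 - matA * matJ) i j| ≤ 1 / 4 := by
  have h1 := allB_spec chk_con i.1 i.2
  rw [Nat.ble_eq, sumN_eq, ← Fin.sum_univ_eq_sum_range
    (fun j => (1000000000000 * ind i.1 j - ajI i.1 j).natAbs)] at h1
  have h2 : ∀ j : Fin 54, |(1 - matA * matJ) i j| =
      (((1000000000000 * ind i.1 j.1 - ajI i.1 j.1).natAbs : ℕ) : ℝ) / 1000000000000 := by
    intro j
    rw [← abs_cast_nat, ← ajI_eq j.2, ind_eq, Matrix.sub_apply, Matrix.mul_apply,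
      Matrix.one_apply]
    have h3 : ∑ k, matA i k * matJ k j =
        ((∑ k : Fin 54, aI i.1 k.1 * jI k.1 j.1 : ℤ) : ℝ) / 1000000000000 := by
      push_cast
      rw [Finset.sum_div]
      apply Finset.sum_congr rfl
      intro k _
      simp only [matA, matJ]
      ring
    rw [h3, ← abs_of_pos (show (0 : ℝ) < 1000000000000 by norm_num), ← abs_div,
      abs_of_pos (show (0 : ℝ) < 1000000000000 by norm_num)]
    congr 1
    by_cases h : i = j
    · subst h; simp; ring
    · have : i.1 ≠ j.1 := fun h' => h (Fin.ext h')
      simp [h, this]; ring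
  rw [Finset.sum_congr rfl (fun j _ => h2 j), ← Finset.sum_div, div_le_iff₀ (by norm_num)]
  have h4 : ((∑ j : Fin 54, (1000000000000 * ind i.1 j.1 - ajI i.1 j.1).natAbs : ℕ) : ℝ)
      ≤ ((250000000000 : ℕ) : ℝ) := Nat.cast_le.mpr h1
  rw [Nat.cast_sum] at h4
  norm_num at h4 ⊢
  linarith

theorem hA (i : Fin 54) : ∑ k, |matA i k| ≤ 60 := by
  have h1 := allB_spec chk_norm i.1 i.2
  rw [Nat.ble_eq, sumN_eq, ← Fin.sum_univ_eq_sum_range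
    (fun j => (aI i.1 j).natAbs)] at h1
  have h2 : ∀ j : Fin 54, |matA i j| = (((aI i.1 j.1).natAbs : ℕ) : ℝ) / 1000 := by
    intro j
    rw [← abs_cast_nat, matA, abs_div, abs_of_pos (show (0 : ℝ) < 1000 by norm_num)]
  rw [Finset.sum_congr rfl (fun j _ => h2 j), ← Finset.sum_div, div_le_iff₀ (by norm_num)]
  have h4 : ((∑ j : Fin 54, (aI i.1 j.1).natAbs : ℕ) : ℝ)
      ≤ ((60000 : ℕ) : ℝ) := Nat.cast_le.mpr h1
  rw [Nat.cast_sum] at h4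
  norm_num at h4 ⊢
  linarith

theorem hF0 (k : Fin 54) : |FF x0 k| ≤ 1 / 1000000 / 200 := by
  unfold FF
  split_ifs with h
  · rw [sub_self, abs_zero]; norm_num
  · have h1 := allB_spec chk_res k.1 (by omega)
    rw [Nat.ble_eq] at h1
    have h2 : |((dX k.1 * dX k.1 + dY k.1 * dY k.1 - 1000000000000000000 : ℤ) : ℝ)|
        ≤ ((4000000000 : ℕ) : ℝ) := by
      rw [abs_cast_nat]; exact Nat.cast_le.mpr h1
    rw [eX_x0 k.2, eY_x0 k.2]
    push_cast at h2
    rw [abs_le] at h2 ⊢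
    constructor <;> linarith [h2.1, h2.2]

theorem hF (z w : Fin 54 → ℝ) (hz : ‖z - x0‖ ≤ 1 / 1000000) (hw : ‖w - x0‖ ≤ 1 / 1000000)
    (k : Fin 54) :
    |FF z k - FF w k - (matJ.mulVec (z - w)) k| ≤ 8 * (1 / 1000000) * ‖z - w‖ := by
  by_cases h : k.1 = 53
  · rw [matJ_mul_last _ h, FF, FF, if_pos h, if_pos h, g_sub]
    have : g z 48 - g x0 48 - (g w 48 - g x0 48) - (g z 48 - g w 48) = 0 := by ring
    rw [this, abs_zero]; positivity
  · rw [matJ_mul _ h, FF, FF, if_neg h, if_neg h]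
    have a1 := eX_abs (z - x0) k.1
    have a2 := eY_abs (z - x0) k.1
    have a3 := eX_abs (w - x0) k.1
    have a4 := eY_abs (w - x0) k.1
    have a5 := eX_abs (z - w) k.1
    have a6 := eY_abs (z - w) k.1
    have e : (eX z k.1 ^ 2 + eY z k.1 ^ 2 - 1) / 2 - (eX w k.1 ^ 2 + eY w k.1 ^ 2 - 1) / 2 -
        ((dX k.1 : ℝ) * eX (z - w) k.1 + (dY k.1 : ℝ) * eY (z - w) k.1) / 1000000000 =
        (eX (z - x0) k.1 + eX (w - x0) k.1) / 2 * eX (z - w) k.1 +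
        (eY (z - x0) k.1 + eY (w - x0) k.1) / 2 * eY (z - w) k.1 := by
      simp only [eX_sub, eY_sub, eX_x0 k.2, eY_x0 k.2]
      ring
    rw [e]
    have b1 : |(eX (z - x0) k.1 + eX (w - x0) k.1) / 2| ≤ 2 * (1 / 1000000) := by
      rw [abs_le] at a1 a3 ⊢
      constructor <;> linarith [a1.1, a1.2, a3.1, a3.2]
    have b2 : |(eY (z - x0) k.1 + eY (w - x0) k.1) / 2| ≤ 2 * (1 / 1000000) := by
      rw [abs_le] at a2 a4 ⊢
      constructor <;> linarith [a2.1, a2.2, a4.1, a4.2]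
    refine (abs_add_le _ _).trans ?_
    rw [abs_mul, abs_mul]
    have c1 := mul_le_mul b1 a5 (abs_nonneg _) (by norm_num)
    have c2 := mul_le_mul b2 a6 (abs_nonneg _) (by norm_num)
    linarith

theorem exists_sol : ∃ z : Fin 54 → ℝ,
    (∀ m < 54, |1000000000 * g z m - (xI m : ℝ)| ≤ 1000) ∧
    ∀ k < 53, eX z k ^ 2 + eY z k ^ 2 = 1 := by
  obtain ⟨z, hz, hFz⟩ := kraw matA matJ FF x0 (1 / 1000000) (by norm_num) le_rfl hF hAJ hA hF0
  refine ⟨z, fun m hm => ?_, fun k hk => ?_⟩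
  · have h1 := (g_abs (z - x0) m).trans hz
    rw [g_sub, g_x0 hm] at h1
    rw [abs_le] at h1 ⊢
    constructor <;> linarith [h1.1, h1.2]
  · have h1 : FF z ⟨k, by omega⟩ = 0 := by rw [hFz]; rfl
    rw [FF, if_neg (by simp; omega)] at h1
    simp only at h1
    linarith

/-- coordinates of the 54 vertices -/
def px (z : Fin 54 → ℝ) (i : ℕ) : ℝ := if i < 27 then g z (2 * i) else -g z (2 * (i - 27))
def py (z : Fin 54 → ℝ) (i : ℕ) : ℝ :=
  if i < 27 then g z (2 * i + 1) else -g z (2 * (i - 27) + 1)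

def Near (z : Fin 54 → ℝ) : Prop := ∀ m < 54, |1000000000 * g z m - (xI m : ℝ)| ≤ 1000

theorem blt_false {i j : ℕ} (h : ¬ i < j) : Nat.blt i j = false := by
  rw [← Bool.not_eq_true, Nat.blt_eq]; exact h

theorem blt_true {i j : ℕ} (h : i < j) : Nat.blt i j = true := by
  rw [Nat.blt_eq]; exact h

theorem px_near {z : Fin 54 → ℝ} (hz : Near z) {i : ℕ} (hi : i < 54) :
    |1000000000 * px z i - (vX i : ℝ)| ≤ 1000 := by
  unfold px vX
  by_cases h : i < 27
  · rw [if_pos h, blt_true h]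
    exact hz _ (by omega)
  · rw [if_neg h, blt_false h, ← abs_neg]
    have := hz (2 * (i - 27)) (by omega)
    simp only [cond_false]
    push_cast
    convert this using 2
    ring

theorem py_near {z : Fin 54 → ℝ} (hz : Near z) {i : ℕ} (hi : i < 54) :
    |1000000000 * py z i - (vY i : ℝ)| ≤ 1000 := by
  unfold py vY
  by_cases h : i < 27
  · rw [if_pos h, blt_true h]
    exact hz _ (by omega)
  · rw [if_neg h, blt_false h, ← abs_neg]
    have := hz (2 * (i - 27) + 1) (by omega)
    simp only [cond_false]
    push_cast
    convert this using 2
    ring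

theorem gt_real {z : Fin 54 → ℝ} (hz : Near z) {p q : ℤ} {i j : ℕ} (hi : i < 54) (hj : j < 54)
    (h : gtB p q i j = true) :
    (p : ℝ) * px z j + q * py z j < p * px z i + q * py z i := by
  rw [gtB, decide_eq_true_eq] at h
  have h' : ((2000 * ((p.natAbs + q.natAbs : ℕ) : ℤ) : ℤ) : ℝ) <
    ((p * (vX i - vX j) + q * (vY i - vY j) : ℤ) : ℝ) := Int.cast_lt.mpr h
  push_cast at h'
  have key : ∀ (p : ℤ) (a b : ℝ), |a| ≤ 1000 → |b| ≤ 1000 →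
      -(2000 * |(p : ℝ)|) ≤ p * (a - b) := by
    intro p a b ha hb
    have h1 : |a - b| ≤ 2000 := by
      rw [abs_le] at ha hb ⊢
      constructor <;> linarith [ha.1, ha.2, hb.1, hb.2]
    have h2 : |(p : ℝ) * (a - b)| ≤ |(p : ℝ)| * 2000 := by
      rw [abs_mul]; exact mul_le_mul_of_nonneg_left h1 (abs_nonneg _)
    linarith [(abs_le.mp h2).1]
  have k1 := key p _ _ (px_near hz hi) (px_near hz hj)
  have k2 := key q _ _ (py_near hz hi) (py_near hz hj)
  nlinarith

noncomputable def pt (z : Fin 54 → ℝ) (i : Fin 54) : EuclideanSpace ℝ (Fin 2) :=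
  !₂[px z i.1, py z i.1]

theorem pt_zero (z : Fin 54 → ℝ) (i : Fin 54) : pt z i 0 = px z i.1 := rfl
theorem pt_one (z : Fin 54 → ℝ) (i : Fin 54) : pt z i 1 = py z i.1 := rfl

/-- linear functional -/
def lin (p q : ℤ) (x : EuclideanSpace ℝ (Fin 2)) : ℝ := p * x 0 + q * x 1

theorem lin_gt {z : Fin 54 → ℝ} (hz : Near z) {p q : ℤ} {i j : Fin 54}
    (h : gtB p q i.1 j.1 = true) : lin p q (pt z j) < lin p q (pt z i) :=
  gt_real hz i.2 j.2 h

theorem lin_comb (p q : ℤ) (s t : ℝ) (a b : EuclideanSpace ℝ (Fin 2)) :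
    lin p q (s • a + t • b) = s * lin p q a + t * lin p q b := by
  simp only [lin, PiLp.add_apply, PiLp.smul_apply, smul_eq_mul]
  ring

theorem pt_inj {z : Fin 54 → ℝ} (hz : Near z) : Function.Injective (pt z) := by
  have key : ∀ i j : Fin 54, j < i → pt z i ≠ pt z j := by
    intro i j hij he
    have h := allB_spec (allB_spec chk_inj i.1 i.2) j.1 hij
    simp only [Bool.or_eq_true] at h
    rcases h with ((h | h) | h) | h <;>
    · have := lin_gt hz h
      rw [he] at this
      exact lt_irrefl _ this
  intro i j he
  rcases lt_trichotomy i j with h | h | h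
  · exact absurd he.symm (key _ _ h)
  · exact h
  · exact absurd he (key _ _ h)

theorem sep_real {z : Fin 54 → ℝ} (hz : Near z) {p q : ℤ} {a b c d : Fin 54}
    (h : sepB a.1 b.1 c.1 d.1 p q = true) {x : EuclideanSpace ℝ (Fin 2)}
    (h1 : x ∈ segment ℝ (pt z a) (pt z b)) (h2 : x ∈ segment ℝ (pt z c) (pt z d)) : False := by
  simp only [sepB, Bool.and_eq_true] at h
  obtain ⟨⟨⟨k1, k2⟩, k3⟩, k4⟩ := h
  have k1 := lin_gt hz k1
  have k2 := lin_gt hz k2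
  have k3 := lin_gt hz k3
  have k4 := lin_gt hz k4
  obtain ⟨s, t, hs, ht, hst, rfl⟩ := h1
  obtain ⟨s', t', hs', ht', hst', he⟩ := h2
  have he := congrArg (lin p q) he
  rw [lin_comb, lin_comb] at he
  generalize lin p q (pt z a) = A at *
  generalize lin p q (pt z b) = B at *
  generalize lin p q (pt z c) = C at *
  generalize lin p q (pt z d) = D at *
  have m1 : max A B < min C D := by
    rw [max_lt_iff, lt_min_iff, lt_min_iff]; exact ⟨⟨k1, k3⟩, ⟨k2, k4⟩⟩
  have m2 : s * A + t * B ≤ max A B := by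
    have := mul_le_mul_of_nonneg_left (le_max_left A B) hs
    have := mul_le_mul_of_nonneg_left (le_max_right A B) ht
    have : (s + t) * max A B = max A B := by rw [hst, one_mul]
    linarith
  have m3 : min C D ≤ s' * C + t' * D := by
    have := mul_le_mul_of_nonneg_left (min_le_left C D) hs'
    have := mul_le_mul_of_nonneg_left (min_le_right C D) ht'
    have : (s' + t') * min C D = min C D := by rw [hst', one_mul]
    linarith
  linarith

theorem shr_real {z : Fin 54 → ℝ} (hz : Near z) {p q : ℤ} {v a b : Fin 54}
    (h : shrB v.1 a.1 b.1 p q = true) {x : EuclideanSpace ℝ (Fin 2)}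
    (h1 : x ∈ segment ℝ (pt z v) (pt z a)) (h2 : x ∈ segment ℝ (pt z v) (pt z b)) :
    x = pt z v := by
  simp only [shrB, Bool.and_eq_true] at h
  have k1 := lin_gt hz h.1
  have k2 := lin_gt hz h.2
  obtain ⟨s, t, hs, ht, hst, hx⟩ := h1
  obtain ⟨s', t', hs', ht', hst', he⟩ := h2
  rw [← hx] at he
  have he := congrArg (lin p q) he
  rw [lin_comb, lin_comb] at he
  have e1 : s = 1 - t := by linarith
  have e2 : s' = 1 - t' := by linarith
  have ht0 : t = 0 := by
    by_contra hne
    have : 0 < t := lt_of_le_of_ne ht (Ne.symm hne)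
    have p1 := mul_pos this (sub_pos.mpr k1)
    have p2 := mul_nonneg ht' (sub_pos.mpr k2).le
    rw [e1, e2] at he
    linarith
  rw [← hx, e1, ht0]; simp

theorem shrAny_real {z : Fin 54 → ℝ} (hz : Near z) {v a b : Fin 54}
    (h : shrAny v.1 a.1 b.1 = true) {x : EuclideanSpace ℝ (Fin 2)}
    (h1 : x ∈ segment ℝ (pt z v) (pt z a)) (h2 : x ∈ segment ℝ (pt z v) (pt z b)) :
    x = pt z v := by
  simp only [shrAny, Bool.or_eq_true] at h
  rcases h with (h | h) | h <;> exact shr_real hz h h1 h2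

theorem sepAny_real {z : Fin 54 → ℝ} (hz : Near z) {a b c d : Fin 54}
    (h : sepAny a.1 b.1 c.1 d.1 = true) {x : EuclideanSpace ℝ (Fin 2)}
    (h1 : x ∈ segment ℝ (pt z a) (pt z b)) (h2 : x ∈ segment ℝ (pt z c) (pt z d)) : False := by
  simp only [sepAny, Bool.or_eq_true] at h
  rcases h with ((((h | h) | h) | h) | h) | h <;> exact sep_real hz h h1 h2

theorem cond_beq {α : Type} (i j : ℕ) (x y : α) :
    (bif Nat.beq i j then x else y) = if i = j then x else y := by
  by_cases h : i = j
  · have : Nat.beq i j = true := by rw [Nat.beq_eq]; exact h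
    rw [this, if_pos h]; rfl
  · have : Nat.beq i j = false := by
      rw [← Bool.not_eq_true, Nat.beq_eq]; exact h
    rw [this, if_neg h]; rfl

theorem pr_real {z : Fin 54 → ℝ} (hz : Near z) {a b c d : Fin 54}
    (h : prB a.1 b.1 c.1 d.1 = true) {x : EuclideanSpace ℝ (Fin 2)}
    (h1 : x ∈ segment ℝ (pt z a) (pt z b)) (h2 : x ∈ segment ℝ (pt z c) (pt z d)) :
    (x = pt z a ∨ x = pt z b) ∧ (x = pt z c ∨ x = pt z d) := by
  simp only [prB, cond_beq] at h
  split_ifs at h with k1 k2 k3 k4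
  · have k := Fin.ext k1; subst k
    have := shrAny_real hz h h1 h2
    exact ⟨Or.inl this, Or.inl this⟩
  · have k := Fin.ext k2; subst k
    have := shrAny_real hz h h1 (segment_symm ℝ (pt z a) (pt z c) ▸ h2)
    exact ⟨Or.inl this, Or.inr this⟩
  · have k := Fin.ext k3; subst k
    have := shrAny_real hz h (segment_symm ℝ (pt z a) (pt z b) ▸ h1) h2
    exact ⟨Or.inr this, Or.inl this⟩
  · have k := Fin.ext k4; subst k
    have := shrAny_real hz h (segment_symm ℝ (pt z a) (pt z b) ▸ h1)
      (segment_symm ℝ (pt z c) (pt z b) ▸ h2)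
    exact ⟨Or.inr this, Or.inr this⟩
  · exact (sepAny_real hz h h1 h2).elim

theorem edge_spec (e : Fin 108) : eu e.1 < ev e.1 ∧ ev e.1 < 54 := by
  have h := allB_spec chk_edge e.1 e.2
  simpa only [Bool.and_eq_true, Nat.blt_eq] using h

/-- the edge with index `e` -/
def ed (e : Fin 108) : Fin 54 × Fin 54 :=
  (⟨eu e.1, (edge_spec e).1.trans (edge_spec e).2⟩, ⟨ev e.1, (edge_spec e).2⟩)

theorem ed_inj : Function.Injective ed := by
  have key : ∀ i j : Fin 108, j < i → ed i ≠ ed j := by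
    intro i j hij he
    have h := allB_spec (allB_spec chk_edge_inj i.1 i.2) j.1 hij
    have h1 : eu i.1 = eu j.1 := congrArg (fun p : Fin 54 × Fin 54 => p.1.1) he
    have h2 : ev i.1 = ev j.1 := congrArg (fun p : Fin 54 × Fin 54 => p.2.1) he
    rw [h1, h2] at h
    have h3 : Nat.beq (eu j.1) (eu j.1) = true := by rw [Nat.beq_eq]
    have h4 : Nat.beq (ev j.1) (ev j.1) = true := by rw [Nat.beq_eq]
    rw [h3, h4] at h
    exact absurd h (by decide)
  intro i j he
  rcases lt_trichotomy i j with h | h | h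
  · exact absurd he.symm (key _ _ h)
  · exact h
  · exact absurd he (key _ _ h)

theorem cross {z : Fin 54 → ℝ} (hz : Near z) (e f : Fin 108) (hne : e ≠ f)
    (x : EuclideanSpace ℝ (Fin 2)) (h1 : x ∈ segment ℝ (pt z (ed e).1) (pt z (ed e).2))
    (h2 : x ∈ segment ℝ (pt z (ed f).1) (pt z (ed f).2)) :
    (x = pt z (ed e).1 ∨ x = pt z (ed e).2) ∧ (x = pt z (ed f).1 ∨ x = pt z (ed f).2) := by
  rcases lt_or_gt_of_ne hne with h | h
  · exact (pr_real hz (allB_spec (allB_spec chk_pr f.1 f.2) e.1 h) h2 h1).symm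
  · exact pr_real hz (allB_spec (allB_spec chk_pr e.1 e.2) f.1 h) h1 h2

/-- squared length of an orbit -/
def len2 (z : Fin 54 → ℝ) (k : ℕ) : ℝ := eX z k ^ 2 + eY z k ^ 2

theorem p_lt (z : Fin 54 → ℝ) {i : ℕ} (h : i < 27) :
    px z i = g z (2 * i) ∧ py z i = g z (2 * i + 1) := by
  simp only [px, py, if_pos h, and_self]

theorem p_ge (z : Fin 54 → ℝ) (i : ℕ) :
    px z (i + 27) = -g z (2 * i) ∧ py z (i + 27) = -g z (2 * i + 1) := by
  have h : ¬ (i + 27 < 27) := by omega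
  simp only [px, py, if_neg h, Nat.add_sub_cancel, and_self]

theorem dist_ed (z : Fin 54 → ℝ) (e : Fin 108) :
    dist (pt z (ed e).1) (pt z (ed e).2) = Real.sqrt (len2 z (e.1 % 54)) := by
  have h0 : dist (pt z (ed e).1) (pt z (ed e).2) =
      Real.sqrt ((px z (eu e.1) - px z (ev e.1)) ^ 2 + (py z (eu e.1) - py z (ev e.1)) ^ 2) := by
    rw [EuclideanSpace.dist_eq, Fin.sum_univ_two, Real.dist_eq, Real.dist_eq, sq_abs, sq_abs]
    rfl
  rw [h0]
  congr 1
  unfold len2 eX eY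
  by_cases h : e.1 < 54
  · rw [Nat.mod_eq_of_lt h]
    obtain ⟨o1, o2, -⟩ := orb_spec h
    simp only [eu, ev, blt_true h, cond_true, cond_beq]
    rcases sgn_cases e.1 with ⟨k, k'⟩ | ⟨k, k'⟩
    · rw [if_pos k, k', (p_lt z o1).1, (p_lt z o1).2, (p_lt z o2).1, (p_lt z o2).2]
      push_cast; ring
    · rw [if_neg k, k', (p_lt z o1).1, (p_lt z o1).2, (p_ge z _).1, (p_ge z _).2]
      push_cast; ring
  · have hm : e.1 % 54 = e.1 - 54 := by omega
    rw [hm]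
    obtain ⟨o1, o2, -⟩ := orb_spec (k := e.1 - 54) (by omega)
    simp only [eu, ev, blt_false h, cond_false, cond_beq]
    rcases sgn_cases (e.1 - 54) with ⟨k, k'⟩ | ⟨k, k'⟩
    · rw [if_pos k, if_pos k, k', (p_ge z _).1, (p_ge z _).2, (p_ge z _).1, (p_ge z _).2]
      push_cast; ring
    · rw [if_neg k, if_neg k, k', (p_lt z o2).1, (p_lt z o2).2, (p_ge z _).1, (p_ge z _).2]
      push_cast; ring

theorem d53 : dX 53 = -692600989 ∧ dY 53 = 710430392 := by decide +kernel

theorem rel_len {z : Fin 54 → ℝ} (hz : Near z) :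
    0.983 < len2 z 53 ∧ len2 z 53 < 0.985 := by
  have hb : ∀ m < 54, |g z m - g x0 m| ≤ 1 / 1000000 := by
    intro m hm
    have := hz m hm
    rw [g_x0 hm]
    rw [abs_le] at this ⊢
    constructor <;> linarith [this.1, this.2]
  obtain ⟨o1, o2, -⟩ := orb_spec (k := 53) (by norm_num)
  have a1 : |eX z 53 - eX x0 53| ≤ 2 * (1 / 1000000) := by
    rw [← eX_sub]
    exact sgn_diff 53 (hb _ (by omega)) (hb _ (by omega))
  have a2 : |eY z 53 - eY x0 53| ≤ 2 * (1 / 1000000) := by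
    rw [← eY_sub]
    exact sgn_diff 53 (hb _ (by omega)) (hb _ (by omega))
  rw [eX_x0 (by norm_num), d53.1] at a1
  rw [eY_x0 (by norm_num), d53.2] at a2
  push_cast at a1 a2
  unfold len2
  rw [abs_le] at a1 a2
  norm_num at a1 a2
  constructor <;> nlinarith [a1.1, a1.2, a2.1, a2.2]

theorem chk_106 : (Finset.univ.filter (fun e : Fin 108 => e.1 % 54 ≠ 53)).card = 106 := by
  decide +kernel

end NM

open scoped Classical

theorem near_matchstick_54 :
    ∃ (P : Fin 54 → EuclideanSpace ℝ (Fin 2)) (E : Finset (Fin 54 × Fin 54)),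
      Function.Injective P ∧
      (∀ e ∈ E, e.1 < e.2) ∧
      E.card = 108 ∧
      (∀ v : Fin 54, (E.filter (fun e => e.1 = v ∨ e.2 = v)).card = 4) ∧
      (∀ e ∈ E, ∀ f ∈ E, e ≠ f →
        ∀ x ∈ segment ℝ (P e.1) (P e.2) ∩ segment ℝ (P f.1) (P f.2),
          (x = P e.1 ∨ x = P e.2) ∧ (x = P f.1 ∨ x = P f.2)) ∧
      (E.filter (fun e => dist (P e.1) (P e.2) = 1)).card = 106 ∧
      (∃ t : ℝ, |t - 1| < 0.01 ∧
        ∀ e ∈ E, dist (P e.1) (P e.2) = 1 ∨ dist (P e.1) (P e.2) = t) := by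
  obtain ⟨z, hz, hlen⟩ := NM.exists_sol
  have hrel := NM.rel_len hz
  have hone : ∀ e : Fin 108, e.1 % 54 ≠ 53 →
      dist (NM.pt z (NM.ed e).1) (NM.pt z (NM.ed e).2) = 1 := by
    intro e he
    rw [NM.dist_ed, NM.len2, hlen _ (by omega), Real.sqrt_one]
  have hsq : Real.sqrt (NM.len2 z 53) < 1 ∧ 0.991 < Real.sqrt (NM.len2 z 53) := by
    constructor
    · rw [Real.sqrt_lt' one_pos]; linarith [hrel.2]
    · apply Real.lt_sqrt_of_sq_lt
      norm_num at hrel ⊢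
      linarith [hrel.1]
  refine ⟨NM.pt z, Finset.univ.image NM.ed, NM.pt_inj hz, ?_, ?_, ?_, ?_, ?_, ?_⟩
  · intro e he
    obtain ⟨i, -, rfl⟩ := Finset.mem_image.mp he
    exact (NM.edge_spec i).1
  · rw [Finset.card_image_of_injective _ NM.ed_inj]
    simp
  · intro v
    rw [Finset.filter_image, Finset.card_image_of_injective _ NM.ed_inj, ← NM.chk_deg v]
    congr 1
    ext i
    simp only [Finset.mem_filter, Finset.mem_univ, true_and, NM.ed, Fin.ext_iff]
  · intro e he f hf hne x hx
    obtain ⟨i, -, rfl⟩ := Finset.mem_image.mp he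
    obtain ⟨j, -, rfl⟩ := Finset.mem_image.mp hf
    exact NM.cross hz i j (fun h => hne (by rw [h])) x hx.1 hx.2
  · rw [Finset.filter_image, Finset.card_image_of_injective _ NM.ed_inj, ← NM.chk_106]
    congr 1
    ext i
    simp only [Finset.mem_filter, Finset.mem_univ, true_and]
    constructor
    · intro h h53
      rw [NM.dist_ed, h53] at h
      exact absurd h hsq.1.ne
    · exact hone i
  · refine ⟨Real.sqrt (NM.len2 z 53), ?_, ?_⟩
    · have h1 := hsq.1
      have h2 := hsq.2
      norm_num at h2 ⊢
      rw [abs_lt]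
      constructor <;> linarith
    · intro e he
      obtain ⟨i, -, rfl⟩ := Finset.mem_image.mp he
      by_cases h : i.1 % 54 = 53
      · right; rw [NM.dist_ed, h]
      · left; exact hone i h
end

section
/- There exist 55 distinct points in ℝ² and a set E of 110 unordered pairs of these points such that every point is an endpoint of exactly 4 pairs in E, the closed segments of any two distinct pairs intersect at most in a common endpoint, exactly 108 of the pairs join points at distance exactly 1, and the remaining 2 pairs join points at one common distance t with |t − 1| < 0.17. -/
def Zl : List ℤ := [74082622,277649721,158633788,198574066,97420711,185099814,196508776,106024159,135295699,92549907,234383763,13474252,173170687,272258751,151766099,3220424,250532965,-12435443,349299831,-28091309,313474776,65271239,214707910,80927106,51817968,99003065,88167832,-153155680,-331451327,99857456,-336788786,243962907,-198103462,147884037,-170375303,171910181,-267446124,75831312,-239717965,149396525,-21872933,249348178,-24982121,296631369,-113097386,196679716,-109988198,81664731,-95441976,99857456,-158493140,-163830599,54551103,-247640963,0]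
def Bl0 : List ℤ := [-2282,6495,907,687,-907,7401,907,-219,-907,8308,-3176,-42416,-42416,6578,6578,-2940,-2940,0,0,0,-40253,-6654,7708,-9808,-2573,-3652,2871,183,-83,-6354,5480,-2331,-2331,2331,3149,-2331,39112,39112,843,843,5499,5499,0,0,0,40159,3701,-8680,-1568,183,-100,137,-7528,1485]
def Bl1 : List ℤ := [2079,3687,-550,-1222,550,3136,-550,-671,550,2586,-988,-905,-905,140,140,-9,-9,0,0,0,-800,-188,41,2757,2861,-392,61,4,-2,-136,117,-50,-50,50,67,-50,834,834,18,18,117,117,0,0,0,857,79,-185,-33,4,-2,3,-161,32]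
def Bl2 : List ℤ := [2824,2266,-826,-1489,826,1440,-826,-663,826,614,-235,-44412,-44412,6887,6887,-2961,-2961,0,0,0,-42019,-7070,7799,-3724,3739,529,3006,191,-87,-6653,5738,-2441,-2441,2441,3297,-2441,40952,40952,883,883,5758,5758,0,0,0,42048,3875,-9088,-1642,191,-105,144,-7882,1555]
def Bl3 : List ℤ := [-166,235,331,476,-331,566,331,145,-331,897,-343,-1392,-1392,216,216,-15,-15,0,0,0,-1232,-290,64,4243,4402,-603,94,6,-3,-209,180,-77,-77,77,103,-77,1284,1284,28,28,180,180,0,0,0,1318,121,-285,-51,6,-3,5,-247,49]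
def Bl4 : List ℤ := [-2444,6725,-1965,-3683,1965,4760,-1965,-1718,1965,2795,-1068,-43783,-43783,6790,6790,-2954,-2954,0,0,0,-41462,-6939,7770,-5643,1748,802,2963,189,-86,-6558,5657,-2406,-2406,2406,3250,-2406,40372,40372,870,870,5676,5676,0,0,0,41452,3820,-8960,-1619,189,-103,142,-7771,1533]
def Bl5 : List ℤ := [-72,102,1091,-2272,1096,4727,-1096,-1176,1096,3631,-1388,-603,-603,94,94,-6,-6,0,0,0,-534,-126,28,1838,1907,-261,41,3,-1,-90,78,-33,-33,33,45,-33,556,556,12,12,78,78,0,0,0,571,53,-123,-22,3,-1,2,-107,21]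
def Bl6 : List ℤ := [-2431,6707,3184,-4057,2159,5326,-2159,-1898,2159,3167,-1211,-43675,-43675,6773,6773,-2953,-2953,0,0,0,-41367,-6916,7765,-5970,1409,849,2956,188,-85,-6542,5643,-2400,-2400,2400,3242,-2400,40273,40273,868,868,5662,5662,0,0,0,41351,3811,-8938,-1615,188,-103,141,-7752,1529]
def Bl7 : List ℤ := [-130,184,1972,-4108,-1972,2156,-214,-360,214,1942,-742,-1090,-1090,169,169,-11,-11,0,0,0,-965,-227,50,3324,3449,-472,74,5,-2,-163,141,-60,-60,60,81,-60,1006,1006,22,22,141,141,0,0,0,1032,95,-223,-40,5,-3,4,-194,38]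
def Bl8 : List ℤ := [-2357,6601,2045,-1685,-2045,8647,-3298,-2952,3298,5349,-2044,-43046,-43046,6675,6675,-2946,-2946,0,0,0,-40810,-6785,7737,-7889,-582,1121,2913,186,-84,-6448,5561,-2366,-2366,2366,3196,-2366,39692,39692,855,855,5580,5580,0,0,0,40755,3756,-8809,-1591,186,-101,139,-7640,1507]
def Bl9 : List ℤ := [-36,51,545,-1136,-545,596,545,-1682,1641,4676,-1787,-302,-302,47,47,-3,-3,0,0,0,-267,-63,14,919,954,-131,20,1,-1,-45,39,-17,-17,17,22,-17,278,278,6,6,39,39,0,0,0,286,26,-62,-11,1,-1,1,-54,11]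
def Bl10 : List ℤ := [-2344,6583,1851,-1281,-1851,8434,1851,-3132,3492,5720,-2186,-42938,-42938,6659,6659,-2945,-2945,0,0,0,-40716,-6763,7732,-8216,-922,1168,2906,185,-84,-6432,5547,-2360,-2360,2360,3188,-2360,39593,39593,853,853,5566,5566,0,0,0,40653,3746,-8787,-1588,185,-101,139,-7621,1504]
def Bl11 : List ℤ := [-94,133,1427,-2972,-1427,1560,1427,-4399,-1427,2987,-1142,-789,-789,122,122,-8,-8,0,0,0,-698,-164,36,2405,2495,-342,53,3,-2,-118,102,-43,-43,43,59,-43,727,727,16,16,102,102,0,0,0,747,69,-161,-29,3,-2,3,-140,28]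
def Bl12 : List ℤ := [-2269,6477,713,1091,-713,7189,713,379,-713,7902,-3020,-42309,-42309,6561,6561,-2939,-2939,0,0,0,-40158,-6632,7703,-10135,-2913,1441,2863,182,-83,-6338,5466,-2325,-2325,2325,3141,-2325,39013,39013,841,841,5485,5485,0,0,0,40057,3691,-8658,-1564,182,-100,137,-7509,1481]
def Bl13 : List ℤ := [-2256,6459,518,1495,-518,6977,518,977,-518,7496,2181,-42202,-42202,6544,6544,-2938,-2938,0,0,0,-40064,-6609,7698,-10462,-3252,1487,2856,182,-83,-6322,5452,-2319,-2319,2319,3133,-2319,38914,38914,839,839,5471,5471,0,0,0,39955,3682,-8636,-1560,182,-99,137,-7490,1478]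
def Bl14 : List ℤ := [1961,3082,-530,-1128,530,2551,-530,-597,530,2021,-772,-25319,-25319,3926,3926,-4760,-4760,0,0,0,-22402,-1161,1156,1523,2677,-216,1714,109,-50,-3793,3271,-1391,-1391,1391,1880,-1391,23346,23346,503,503,3282,3282,0,0,0,23971,2209,-5181,-936,109,-60,82,-4494,887]
def Bl15 : List ℤ := [2920,2756,-842,-1565,842,1914,-842,-723,842,1072,-410,-24637,-24637,3821,3821,-5547,-5547,0,0,0,-24522,-6282,6896,-2724,3888,387,1667,106,-48,-3690,3183,-1354,-1354,1354,1829,-1354,22717,22717,490,490,3194,3194,0,0,0,23326,2149,-5042,-911,106,-58,80,-4373,863]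
def Bl16 : List ℤ := [1949,3021,-528,-1118,528,2492,-528,-590,528,1964,-751,-22840,-27778,4308,3856,-4696,-4244,-452,452,-452,-24578,-1259,1269,1398,2659,-199,1880,120,-54,-4161,3589,-1527,-1527,1527,2062,-1527,25614,25614,552,552,3601,3601,0,0,0,26300,2424,-5685,-1027,120,-65,90,-4930,973]
def Bl17 : List ℤ := [2845,2372,-830,-1506,830,1542,-830,-676,830,712,-272,-40935,-40152,6227,3375,-5141,-2289,-2851,2851,-2851,-38250,-6900,7605,-3509,3771,499,2717,173,-79,-6015,5188,-2207,-2207,2207,2981,-2207,37024,37024,798,798,5205,5205,0,0,0,38015,3503,-8217,-1484,173,-95,130,-7126,1406]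
def Bl18 : List ℤ := [1937,2960,-526,-1109,526,2433,-526,-582,526,1907,-729,-24848,-24848,3785,3785,-4631,-4631,0,0,0,-26754,-1357,1381,1274,2640,-181,2046,130,-59,-4529,3907,-1662,-1662,1662,2245,-1662,27882,27882,601,601,3920,3920,0,0,0,28628,2638,-6188,-1118,130,-71,98,-5367,1059]
def Bl19 : List ℤ := [2770,1987,-817,-1446,817,1170,-817,-629,817,353,-135,-53600,-53600,2930,2930,-4734,-4734,0,0,0,-51978,-7518,8313,-4294,3655,610,3767,240,-109,-8339,7192,-3059,-3059,3059,4133,-3059,51331,51331,1106,1106,7217,7217,0,0,0,52705,4857,-11392,-2058,240,-131,180,-9880,1949]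
def Bl20 : List ℤ := [2008,3323,-538,-1165,538,2785,-538,-627,538,2246,-859,-12876,-15571,2415,4206,-5016,-2320,2695,2695,-2695,-13777,-773,711,2016,2751,-287,1054,67,-30,-2332,2012,-856,-856,856,1156,-856,14358,14358,309,309,2019,2019,0,0,0,14743,1359,-3186,-576,67,-37,50,-2764,545]
def Bl21 : List ℤ := [2797,2127,-822,-1468,822,1305,-822,-646,822,483,-185,-49006,-50040,7760,3092,-4882,-3847,1034,1034,-1034,-46999,-7294,8056,-4009,3697,570,3387,216,-98,-7496,6465,-2750,-2750,2750,3715,-2750,46142,46142,994,994,6487,6487,0,0,0,47377,4366,-10240,-1850,216,-118,162,-8881,1752]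
def Bl22 : List ℤ := [2020,3384,-540,-1175,540,2844,-540,-634,540,2303,-880,-10869,-13112,2033,4277,-5080,-1933,2243,-2243,-2243,-11601,-675,599,2140,2769,-304,887,57,-26,-1964,1694,-721,-721,721,973,-721,12090,12090,261,261,1700,1700,0,0,0,12414,1144,-2683,-485,57,-31,42,-2327,459]
def Bl23 : List ℤ := [2872,2511,-834,-1527,834,1677,-834,-693,834,843,-322,-36341,-34524,5354,3537,-5288,-1403,-1817,1817,1817,-33271,-6676,7347,-3224,3814,458,2337,149,-68,-5172,4460,-1897,-1897,1897,2563,-1897,31835,31835,686,686,4476,4476,0,0,0,32687,3012,-7065,-1276,149,-81,112,-6127,1209]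
def Bl24 : List ℤ := [2055,3170,-558,-1178,558,2613,-558,-620,558,2055,-786,-26113,-26113,4049,4049,-4939,-4939,0,0,0,-28195,-1364,1379,1435,2803,-204,1767,113,-51,-3912,3374,-1435,-1435,1435,1939,-1435,24078,24078,519,519,3385,3385,0,0,0,24723,2278,-5344,-965,113,-61,85,-4635,914]
def Bl25 : List ℤ := [-521,739,186,203,-186,924,186,17,-186,1110,-424,-4380,-4380,679,679,-46,-46,0,0,0,-3875,-912,200,3838,-627,-546,296,19,-9,-656,566,-241,-241,241,325,-241,4039,4039,87,87,568,568,0,0,0,4147,382,-896,-162,19,-10,14,-777,153]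
def Bl26 : List ℤ := [1379,1301,-398,-739,398,904,-398,-341,398,506,-193,-11631,-11631,1804,1804,-2619,-2619,0,0,0,-13015,-241,6302,-1286,1836,183,787,50,-23,-1742,1503,-639,-639,639,863,-639,10725,10725,231,231,1508,1508,0,0,0,11012,1015,-2380,-430,50,-27,38,-2064,407]
def Bl27 : List ℤ := [1122,2100,-294,-666,294,1807,-294,-372,294,1513,-578,-11279,-11279,2619,2619,-3007,-3007,0,0,0,-13131,174,-291,1790,1550,-254,3919,250,-113,-8673,7480,-3182,-3182,3182,4298,-3182,9600,9600,1151,1151,7506,7506,0,0,0,16573,-4469,-9749,-2141,250,-136,-8476,-10276,2027]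
def Bl28 : List ℤ := [3445,4030,-972,-1895,972,3059,-972,-924,972,2087,-798,-54123,-54123,5368,5368,-7199,-7199,0,0,0,-55125,-5479,5940,-1095,4629,156,1633,-5862,2660,-11763,6812,-4316,-4316,4316,2497,-4316,52688,52688,-2145,-2145,11132,11132,0,0,0,58161,1732,-14941,50283,-5862,3202,-4404,-13937,-47623]
def Bl29 : List ℤ := [137,114,-40,-72,40,74,-40,-32,40,34,-13,-2524,-2524,162,162,-247,-247,0,0,0,-2474,-333,367,-170,181,24,5012,319,-145,-182,-39,-67,-67,67,-106,-67,2538,2538,-194,-194,214,214,0,0,0,2450,365,-306,-2738,319,-174,240,-216,2593]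
def Bl30 : List ℤ := [6006,6157,-1719,-3250,1719,4438,-1719,-1531,1719,2720,-1040,-101338,-101338,8397,8397,-11819,-11819,0,0,0,-101403,-11709,12806,-4274,8023,608,1730,110,-50,-15169,6076,-5565,-5565,5565,511,-5565,100171,100171,-5777,-5777,15128,15128,0,0,0,103993,8565,-20663,-945,110,-60,83,-17972,895]
def Bl31 : List ℤ := [5192,5850,-1471,-2842,1471,4380,-1471,-1372,1471,2909,-1112,-83352,-83352,7843,7843,-10661,-10661,0,0,0,-84430,-8810,9580,-2257,6964,321,4537,289,-131,-10042,8661,-3684,-3684,3684,4977,-3684,81531,81531,-3755,-3755,13599,13599,0,0,0,86044,5849,-13718,-2479,289,-158,217,-11898,2347]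
def Bl32 : List ℤ := [753,196,-232,-372,232,-36,-232,-140,232,-268,102,-17351,-17351,416,416,-998,-998,0,0,0,-16243,-2901,3234,-2106,975,299,2224,142,-64,-4923,4246,-1806,-1806,1806,2440,-1806,18091,18091,-2077,-2077,1220,1220,0,0,0,17131,2868,-6726,-1215,142,-77,106,-5833,1151]
def Bl33 : List ℤ := [6203,6997,-1757,-3396,1757,5241,-1757,-1639,1757,3484,-1332,-99512,-99512,9379,9379,-12744,-12744,0,0,0,-100816,-10505,11422,-2674,8320,380,4442,283,-128,-16817,8480,-3607,-3607,3607,4873,-3607,97325,97325,-4467,-4467,16275,16275,0,0,0,102757,6945,-16400,-2427,283,-155,213,-14234,2298]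
def Bl34 : List ℤ := [4255,4170,-1223,-2291,1223,2947,-1223,-1068,1223,1724,-659,-73348,-73348,5737,5737,-8213,-8213,0,0,0,-73021,-8773,9616,-3552,5674,505,1895,121,-55,-10368,3618,-1539,-1539,1539,2079,-1539,72816,72816,-4544,-4544,10493,10493,0,0,0,75044,6666,-16018,-1035,121,-66,91,-13927,980]
def Bl35 : List ℤ := [2664,2982,-755,-1457,755,2227,-755,-702,755,1472,-562,-42938,-42938,4002,4002,-5454,-5454,0,0,0,-43452,-4571,4973,-1213,3573,172,4775,304,-138,-7114,3510,126,-3877,3877,5238,-3877,42035,42035,-1975,-1975,6906,6906,0,0,0,44247,3107,-7012,-2608,304,-166,228,-6057,2470]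
def Bl36 : List ℤ := [3380,3177,-975,-1811,975,2201,-975,-836,975,1226,-469,-59345,-59345,4407,4407,-6409,-6409,0,0,0,-58823,-7305,8020,-3190,4499,453,1977,126,-57,-7966,2388,-5766,-1606,1606,2169,-1606,59131,59131,-3927,-3927,8174,8174,0,0,0,60562,5716,-13694,-1080,126,-69,95,-11903,1023]
def Bl37 : List ℤ := [3675,4129,-1041,-2011,1041,3088,-1041,-970,1041,2046,-782,-59098,-59098,5538,5538,-7536,-7536,0,0,0,-59838,-6266,6815,-1631,4929,232,4680,298,-135,-9886,4930,203,-5401,-203,5133,-3800,57828,57828,-2687,-2687,9582,9582,0,0,0,60960,4203,-9694,-2556,298,-163,224,-8393,2421]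
def Bl38 : List ℤ := [6882,7151,-1967,-3730,1967,5184,-1967,-1763,1967,3218,-1230,-115341,-115341,9728,9728,-13624,-13624,0,0,0,-115601,-13178,14402,-4636,9198,659,1648,105,-48,-17570,7306,-5498,-6885,5498,1808,-1338,113856,113856,-6394,-6394,17447,17447,0,0,0,118475,9515,-22986,-900,105,-57,79,-19996,853]
def Bl39 : List ℤ := [1818,2854,-492,-1045,492,2362,-492,-553,492,1870,-715,-22708,-22708,3637,3637,-4411,-4411,0,0,0,-24644,-1085,1081,1403,2482,-199,1955,125,-56,-4328,3733,-1588,-1588,1588,2145,-1588,20832,20832,574,574,3746,3746,0,0,0,26528,2521,-5912,-1068,125,-68,94,-5128,1012]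
def Bl40 : List ℤ := [-1057,-1412,293,592,-293,-1119,293,299,-293,-826,316,15191,15191,-1841,-1841,2356,2356,0,0,0,15838,1245,-1327,-142,-1430,20,839,53,-24,-1857,1602,-681,-681,681,920,-681,-14481,-14481,246,246,1607,1607,0,0,0,-14805,1082,-2537,-458,53,-29,40,-2200,434]
def Bl41 : List ℤ := [1878,2907,-509,-1077,509,2398,-509,-568,509,1888,-722,-23778,-23778,3711,3711,-4521,-4521,0,0,0,-25699,-1221,1231,1338,2561,-190,2001,127,-58,-4429,3820,-1625,-1625,1625,2195,-1625,26901,21903,498,587,3833,3743,90,-90,90,27578,2579,-6050,-1093,127,-70,96,-5247,1035]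
def Bl42 : List ℤ := [856,288,-262,-427,262,26,-262,-165,262,-236,90,-19204,-19204,545,545,-1189,-1189,0,0,0,-18070,-3137,3493,-2218,1112,315,2303,147,-67,-5098,4397,-1870,-1870,1870,2527,-1870,19790,19946,-2209,676,4412,1527,2885,-2885,2885,18950,2969,-6964,-1258,147,-80,110,-6040,1192]
def Bl43 : List ℤ := [3565,4405,-999,-1976,999,3407,-999,-977,999,2408,-920,-54100,-54100,5814,5814,-7646,-7646,0,0,0,-55592,-5084,5480,-491,4802,70,3292,210,-95,-7286,6284,-2673,-2673,2673,3611,-2673,54707,52253,-1667,966,6305,8759,2454,2454,-2454,57336,4243,-9953,-1798,210,-115,158,-8632,1703]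
def Bl44 : List ℤ := [1762,1092,-525,-909,525,567,-525,-384,525,42,-16,-35475,-35475,1673,1673,-2866,-2866,0,0,0,-34111,-5210,5773,-3200,2315,455,2996,191,-87,-6631,5719,-2433,-2433,2433,3286,-2433,34711,36231,-3371,880,5739,4218,-1520,-1520,1520,34918,3862,-9059,-1637,191,-104,143,-7857,1550]
def Bl45 : List ℤ := [3505,4352,-981,-1944,981,3371,-981,-963,981,2390,-913,-53030,-53030,5740,5740,-7536,-7536,0,0,0,-54537,-4947,5330,-427,4723,61,3246,207,-94,-7185,6197,-2636,-2636,2636,3561,-2636,53726,51182,-1591,953,6218,8582,2544,-2544,-2544,56286,4185,-9815,-1773,207,-113,155,-8513,1680]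
def Bl46 : List ℤ := [-152,-608,30,110,-30,-577,30,80,-30,-547,209,-1080,-1080,-712,-712,679,679,0,0,0,-203,-828,953,-1124,-227,160,1532,98,-44,-3390,2924,-1244,-1244,1244,1680,-1244,3170,1805,-915,450,2934,-1472,1365,-1365,-1365,1163,1975,-4631,-837,98,-53,73,-4017,792]
def Bl47 : List ℤ := [1021,1790,-271,-599,271,1519,-271,-328,271,1248,-477,-11255,-11255,2249,2249,-2634,-2634,0,0,0,-12704,-146,81,1296,1404,-184,2588,165,-75,-5728,4940,-2102,-2102,2102,2839,-2102,9915,9915,760,760,4957,4957,0,0,0,14067,-2174,-3578,-1414,165,-90,124,-6787,1339]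
def Bl48 : List ℤ := [-323,-432,90,181,-90,-342,90,92,-90,-253,97,4646,4646,-563,-563,721,721,0,0,0,4844,381,-406,-43,-437,6,257,16,-7,-568,490,-208,-208,208,282,-208,-4429,-4429,75,75,492,492,0,0,0,-3332,-1392,-4687,-140,16,-9,12,-673,133]
def Bl49 : List ℤ := [137,114,-40,-72,40,74,-40,-32,40,34,-13,-2524,-2524,162,162,-247,-247,0,0,0,-2474,-333,367,-170,181,24,-135,-9,163,-182,-39,-67,-67,67,-106,-67,2538,2538,-194,-194,214,214,0,0,0,2450,365,-306,2409,11,153,240,-216,2593]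
def Bl50 : List ℤ := [3682,4227,-1041,-2021,1041,3186,-1041,-980,1041,2145,-820,-58494,-58494,5649,5649,-7627,-7627,0,0,0,-59409,-6056,6575,-1389,4944,197,1400,89,2942,-12079,6744,-4431,-4431,4431,2313,-4431,57084,57084,-2481,-2481,11502,11502,0,0,0,62404,2365,-15471,42924,456,2734,-3989,-14311,-43131]
def Bl51 : List ℤ := [6243,6354,-1788,-3376,1788,4566,-1788,-1588,1788,2778,-1062,-105709,-105709,8678,8678,-12247,-12247,0,0,0,-105687,-12286,13442,-4569,8338,649,-1119,-71,5998,-15484,6008,-5681,-5681,5681,327,-5681,104567,104567,-6113,-6113,15498,15498,0,0,0,108236,9198,-21192,-5688,663,5604,498,-18346,5387]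
def Bl52 : List ℤ := [-2149,-1785,627,1137,-627,-1158,627,510,-627,-531,203,39628,39628,-2543,-2543,3878,3878,0,0,0,38841,5229,-5763,2669,-2848,-379,2114,135,-2565,2858,618,1049,1049,-1049,1667,1049,-39853,-39853,3048,3048,-3354,-3354,0,0,0,-38466,-5735,4802,42996,-5012,2738,-3766,3386,-40722]
def Bl53 : List ℤ := [4844,5192,-1380,-2635,1380,3812,-1380,-1256,1380,2433,-930,-79916,-79916,7023,7023,-9723,-9723,0,0,0,-80406,-8882,9691,-2832,6483,403,257,16,4329,-13624,6410,-4998,-4998,4998,1412,-4998,78628,78628,-4129,-4129,13315,13315,0,0,0,83198,5465,-18067,22297,-2599,1420,-1953,-16142,-21118]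
def Bl : List (List ℤ) := [Bl0,Bl1,Bl2,Bl3,Bl4,Bl5,Bl6,Bl7,Bl8,Bl9,Bl10,Bl11,Bl12,Bl13,Bl14,Bl15,Bl16,Bl17,Bl18,Bl19,Bl20,Bl21,Bl22,Bl23,Bl24,Bl25,Bl26,Bl27,Bl28,Bl29,Bl30,Bl31,Bl32,Bl33,Bl34,Bl35,Bl36,Bl37,Bl38,Bl39,Bl40,Bl41,Bl42,Bl43,Bl44,Bl45,Bl46,Bl47,Bl48,Bl49,Bl50,Bl51,Bl52,Bl53]
def Kl0 : List (ℕ × ℕ × ℕ × ℕ) := [(1,3,2,4),(1,5,2,6),(3,5,4,6),(3,7,4,8),(5,7,6,8),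
  (5,9,6,10),(7,9,8,10),(7,11,8,12),(9,11,10,12),(9,54,10,13),
  (11,54,12,13),(14,16,15,17),(16,18,17,19),(18,20,19,21),(20,1,21,2),
  (1,22,2,23),(22,14,23,15),(16,20,17,21)]
def Kl1 : List (ℕ × ℕ × ℕ × ℕ) := [(20,22,21,23),(22,16,23,17),(14,24,15,54),(14,25,15,26),(24,25,54,26),
  (25,54,26,0),(25,3,26,4),(11,54,12,0),(54,29,28,30),(54,52,28,53),
  (29,52,30,53),(31,33,32,34),(31,35,32,36),(33,35,34,36),(33,37,34,38),
  (35,37,36,38),(35,29,36,30),(37,29,38,30)]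
def Kl2 : List (ℕ × ℕ × ℕ × ℕ) := [(39,41,40,42),(41,18,42,19),(18,43,19,44),(43,31,44,32),(31,45,32,46),
  (45,39,46,40),(41,43,42,44),(43,45,44,46),(45,41,46,42),(39,24,40,54),
  (39,47,40,48),(24,47,54,48),(49,54,50,51),(49,52,50,53),(54,52,51,53),
  (47,54,48,27),(47,33,48,34),(49,54,50,27)]
def Kl : List (ℕ × ℕ × ℕ × ℕ) := Kl0 ++ (Kl1 ++ (Kl2))
def Vl0 : List (ℕ × ℕ × ℤ × ℤ × ℤ) := [(54,0,1,0,7408),(1,2,1,27765,15863),(1,2,-1,-27765,15863),(3,4,1,19857,9742),(3,4,-1,-19857,9742),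
  (5,6,1,18510,19651),(5,6,-1,-18510,19651),(7,8,1,10602,13530),(7,8,-1,-10602,13530),(9,10,1,9255,23438),
  (9,10,-1,-9255,23438)]
def Vl1 : List (ℕ × ℕ × ℤ × ℤ × ℤ) := [(11,12,1,1347,17317),(11,12,-1,-1347,17317),(54,13,1,0,27226),(14,15,1,15177,322),(14,15,-1,-15177,322),
  (16,17,1,25053,-1244),(16,17,-1,-25053,-1244),(18,19,1,34930,-2809),(18,19,-1,-34930,-2809),(20,21,1,31347,6527),
  (20,21,-1,-31347,6527)]
def Vl2 : List (ℕ × ℕ × ℤ × ℤ × ℤ) := [(22,23,1,21471,8093),(22,23,-1,-21471,8093),(24,54,1,5182,0),(24,54,-1,-5182,0),(25,26,1,9900,8817),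
  (25,26,-1,-9900,8817),(54,27,1,0,-15316),(54,28,1,0,-33145),(29,30,1,9986,-33679),(29,30,-1,-9986,-33679),
  (31,32,1,24396,-19810)]
def Vl3 : List (ℕ × ℕ × ℤ × ℤ × ℤ) := [(31,32,-1,-24396,-19810),(33,34,1,14788,-17038),(33,34,-1,-14788,-17038),(35,36,1,17191,-26745),(35,36,-1,-17191,-26745),
  (37,38,1,7583,-23972),(37,38,-1,-7583,-23972),(39,40,1,14940,-2187),(39,40,-1,-14940,-2187),(41,42,1,24935,-2498),
  (41,42,-1,-24935,-2498)]
def Vl4 : List (ℕ × ℕ × ℤ × ℤ × ℤ) := [(43,44,1,29663,-11310),(43,44,-1,-29663,-11310),(45,46,1,19668,-10999),(45,46,-1,-19668,-10999),(47,48,1,8166,-9544),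
  (47,48,-1,-8166,-9544),(49,50,1,9986,-15849),(49,50,-1,-9986,-15849),(54,51,1,0,-16383),(52,53,1,5455,-24764),
  (52,53,-1,-5455,-24764)]
def Vl : List (ℕ × ℕ × ℤ × ℤ × ℤ) := Vl0 ++ (Vl1 ++ (Vl2 ++ (Vl3 ++ (Vl4))))
def El0 : List (Fin 55 × Fin 55 × ℤ × ℤ × ℤ × ℤ) := [(0,11,0,7408,1347,17317),(0,12,0,7408,-1347,17317),(0,26,0,7408,9900,8817),(0,27,0,7408,-9900,8817),(1,3,27765,15863,19857,9742),
  (1,5,27765,15863,18510,19651),(1,20,27765,15863,31347,6527),(1,22,27765,15863,21471,8093),(2,4,-27765,15863,-19857,9742),(2,6,-27765,15863,-18510,19651),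
  (2,21,-27765,15863,-31347,6527)]
def El1 : List (Fin 55 × Fin 55 × ℤ × ℤ × ℤ × ℤ) := [(2,23,-27765,15863,-21471,8093),(3,5,19857,9742,18510,19651),(3,7,19857,9742,10602,13530),(3,26,19857,9742,9900,8817),(4,6,-19857,9742,-18510,19651),
  (4,8,-19857,9742,-10602,13530),(4,27,-19857,9742,-9900,8817),(5,7,18510,19651,10602,13530),(5,9,18510,19651,9255,23438),(6,8,-18510,19651,-10602,13530),
  (6,10,-18510,19651,-9255,23438)]
def El2 : List (Fin 55 × Fin 55 × ℤ × ℤ × ℤ × ℤ) := [(7,9,10602,13530,9255,23438),(7,11,10602,13530,1347,17317),(8,10,-10602,13530,-9255,23438),(8,12,-10602,13530,-1347,17317),(9,11,9255,23438,1347,17317),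
  (9,13,9255,23438,0,27226),(10,12,-9255,23438,-1347,17317),(10,13,-9255,23438,0,27226),(11,13,1347,17317,0,27226),(12,13,-1347,17317,0,27226),
  (14,16,15177,322,25053,-1244)]
def El3 : List (Fin 55 × Fin 55 × ℤ × ℤ × ℤ × ℤ) := [(14,22,15177,322,21471,8093),(14,24,15177,322,5182,0),(14,26,15177,322,9900,8817),(15,17,-15177,322,-25053,-1244),(15,23,-15177,322,-21471,8093),
  (15,25,-15177,322,-5182,0),(15,27,-15177,322,-9900,8817),(16,18,25053,-1244,34930,-2809),(16,20,25053,-1244,31347,6527),(16,22,25053,-1244,21471,8093),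
  (17,19,-25053,-1244,-34930,-2809)]
def El4 : List (Fin 55 × Fin 55 × ℤ × ℤ × ℤ × ℤ) := [(17,21,-25053,-1244,-31347,6527),(17,23,-25053,-1244,-21471,8093),(18,20,34930,-2809,31347,6527),(18,42,34930,-2809,24935,-2498),(18,44,34930,-2809,29663,-11310),
  (19,21,-34930,-2809,-31347,6527),(19,43,-34930,-2809,-24935,-2498),(19,45,-34930,-2809,-29663,-11310),(20,22,31347,6527,21471,8093),(21,23,-31347,6527,-21471,8093),
  (24,26,5182,0,9900,8817)]
def El5 : List (Fin 55 × Fin 55 × ℤ × ℤ × ℤ × ℤ) := [(24,40,5182,0,14940,-2187),(24,48,5182,0,8166,-9544),(25,27,-5182,0,-9900,8817),(25,41,-5182,0,-14940,-2187),(25,49,-5182,0,-8166,-9544),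
  (28,48,0,-15316,8166,-9544),(28,49,0,-15316,-8166,-9544),(28,50,0,-15316,9986,-15849),(28,51,0,-15316,-9986,-15849),(29,30,0,-33145,9986,-33679),
  (29,31,0,-33145,-9986,-33679)]
def El6 : List (Fin 55 × Fin 55 × ℤ × ℤ × ℤ × ℤ) := [(29,53,0,-33145,5455,-24764),(29,54,0,-33145,-5455,-24764),(30,36,9986,-33679,17191,-26745),(30,38,9986,-33679,7583,-23972),(30,53,9986,-33679,5455,-24764),
  (31,37,-9986,-33679,-17191,-26745),(31,39,-9986,-33679,-7583,-23972),(31,54,-9986,-33679,-5455,-24764),(32,34,24396,-19810,14788,-17038),(32,36,24396,-19810,17191,-26745),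
  (32,44,24396,-19810,29663,-11310)]
def El7 : List (Fin 55 × Fin 55 × ℤ × ℤ × ℤ × ℤ) := [(32,46,24396,-19810,19668,-10999),(33,35,-24396,-19810,-14788,-17038),(33,37,-24396,-19810,-17191,-26745),(33,45,-24396,-19810,-29663,-11310),(33,47,-24396,-19810,-19668,-10999),
  (34,36,14788,-17038,17191,-26745),(34,38,14788,-17038,7583,-23972),(34,48,14788,-17038,8166,-9544),(35,37,-14788,-17038,-17191,-26745),(35,39,-14788,-17038,-7583,-23972),
  (35,49,-14788,-17038,-8166,-9544)]
def El8 : List (Fin 55 × Fin 55 × ℤ × ℤ × ℤ × ℤ) := [(36,38,17191,-26745,7583,-23972),(37,39,-17191,-26745,-7583,-23972),(38,50,7583,-23972,9986,-15849),(39,51,-7583,-23972,-9986,-15849),(40,42,14940,-2187,24935,-2498),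
  (40,46,14940,-2187,19668,-10999),(40,48,14940,-2187,8166,-9544),(41,43,-14940,-2187,-24935,-2498),(41,47,-14940,-2187,-19668,-10999),(41,49,-14940,-2187,-8166,-9544),
  (42,44,24935,-2498,29663,-11310)]
def El9 : List (Fin 55 × Fin 55 × ℤ × ℤ × ℤ × ℤ) := [(42,46,24935,-2498,19668,-10999),(43,45,-24935,-2498,-29663,-11310),(43,47,-24935,-2498,-19668,-10999),(44,46,29663,-11310,19668,-10999),(45,47,-29663,-11310,-19668,-10999),
  (50,52,9986,-15849,0,-16383),(50,53,9986,-15849,5455,-24764),(51,52,-9986,-15849,0,-16383),(51,54,-9986,-15849,-5455,-24764),(52,53,0,-16383,5455,-24764),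
  (52,54,0,-16383,-5455,-24764)]
def El : List (Fin 55 × Fin 55 × ℤ × ℤ × ℤ × ℤ) := El0 ++ (El1 ++ (El2 ++ (El3 ++ (El4 ++ (El5 ++ (El6 ++ (El7 ++ (El8 ++ (El9)))))))))
def Dl : List (ℤ × ℤ) := [(0,1),(1,0),(-1,1),(1,1),(-2,1),
  (2,1),(-1,7),(1,7)]

def dot : ℕ → List ℤ → (ℕ → ℝ) → ℝ
  | 0, _, _ => 0
  | n+1, r, u => (r.headD 0 : ℤ) * u 0 + dot n r.tail (fun i => u (i+1))

def l1 : ℕ → List ℤ → ℕ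
  | 0, _ => 0
  | n+1, r => (r.headD 0).natAbs + l1 n r.tail

def un : ℕ → ℤ → List ℤ
  | 0, N => [N]
  | k+1, N => 0 :: un k N

def rs (c d : ℤ) : ℕ → List ℤ → List ℤ → List ℤ → List ℤ → List ℤ → ℕ
  | 0, _, _, _, _, _ => 0
  | n+1, e, p, q, r, s =>
    (e.headD 0 - c * (p.headD 0 - q.headD 0) - d * (r.headD 0 - s.headD 0)).natAbs
      + rs c d n e.tail p.tail q.tail r.tail s.tail

theorem dot_sub (n : ℕ) : ∀ (r : List ℤ) (u v : ℕ → ℝ),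
    dot n r (fun i => u i - v i) = dot n r u - dot n r v := by
  induction n with
  | zero => intros; simp [dot]
  | succ n ih => intro r u v; simp only [dot]; rw [ih r.tail (fun i => u (i+1)) (fun i => v (i+1))]; ring

theorem dot_nil (n : ℕ) : ∀ (u : ℕ → ℝ), dot n [] u = 0 := by
  induction n with
  | zero => intros; simp [dot]
  | succ n ih => intro u; simp [dot, ih]

theorem dot_un (k : ℕ) : ∀ (n : ℕ) (N : ℤ) (u : ℕ → ℝ), k < n → dot n (un k N) u = N * u k := by
  induction k with
  | zero =>
    intro n N u h
    obtain ⟨m, rfl⟩ : ∃ m, n = m + 1 := ⟨n - 1, by omega⟩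
    simp [dot, un, dot_nil]
  | succ k ih =>
    intro n N u h
    obtain ⟨m, rfl⟩ : ∃ m, n = m + 1 := ⟨n - 1, by omega⟩
    simp [dot, un, ih m N _ (by omega : k < m)]

theorem dot_zero (n : ℕ) : ∀ (r : List ℤ), dot n r (fun _ => 0) = 0 := by
  induction n with
  | zero => intros; simp [dot]
  | succ n ih => intro r; simp [dot, ih]

theorem dot_le (n : ℕ) : ∀ (r : List ℤ) (u : ℕ → ℝ) (D : ℝ), (∀ i, |u i| ≤ D) →
    |dot n r u| ≤ (l1 n r : ℝ) * D := by
  induction n with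
  | zero => intros; simp [dot, l1]
  | succ n ih =>
    intro r u D h
    simp only [dot, l1]
    have h1 := ih r.tail (fun i => u (i+1)) D (fun i => h _)
    have h2 : |((r.headD 0 : ℤ) : ℝ) * u 0| ≤ ((r.headD 0).natAbs : ℝ) * D := by
      rw [abs_mul, Nat.cast_natAbs, Int.cast_abs]
      exact mul_le_mul_of_nonneg_left (h 0) (abs_nonneg _)
    push_cast
    calc _ ≤ _ := abs_add_le _ _
      _ ≤ _ := add_le_add h2 h1
      _ = _ := by ring

theorem rs_le (c d : ℤ) (n : ℕ) : ∀ (e p q r s : List ℤ) (u : ℕ → ℝ) (D : ℝ), (∀ i, |u i| ≤ D) →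
    |dot n e u - c * (dot n p u - dot n q u) - d * (dot n r u - dot n s u)|
      ≤ (rs c d n e p q r s : ℝ) * D := by
  induction n with
  | zero => intros; simp [dot, rs]
  | succ n ih =>
    intro e p q r s u D h
    simp only [dot, rs]
    have h1 := ih e.tail p.tail q.tail r.tail s.tail (fun i => u (i+1)) D (fun i => h _)
    set t : ℤ := e.headD 0 - c * (p.headD 0 - q.headD 0) - d * (r.headD 0 - s.headD 0) with ht
    have h2 : |(t : ℝ) * u 0| ≤ (t.natAbs : ℝ) * D := by
      rw [abs_mul, Nat.cast_natAbs, Int.cast_abs]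
      exact mul_le_mul_of_nonneg_left (h 0) (abs_nonneg _)
    have h3 := (abs_add_le _ _).trans (add_le_add h2 h1)
    rw [Nat.cast_add, add_mul]
    refine le_trans (le_of_eq ?_) h3
    congr 1
    rw [ht]; push_cast; ring

attribute [irreducible] dot

def Zc (i : ℕ) : ℤ := Zl.getD i 0
def Br (i : ℕ) : List ℤ := Bl.getD i []

theorem B_bound : ∀ i, l1 54 (Br i) ≤ 980000 := by
  have h : ∀ i < 54, l1 54 (Br i) ≤ 980000 := by decide +kernel
  intro i
  by_cases hi : i < 54
  · exact h i hi
  · have : Br i = [] := by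
      unfold Br
      rw [List.getD_eq_getElem?_getD, List.getElem?_eq_none]
      · rfl
      · have : Bl.length = 54 := by decide +kernel
        omega
    rw [this]; decide +kernel

def kk (k : Fin 54) : ℕ × ℕ × ℕ × ℕ := Kl.getD k.val (0,0,0,0)

def rowOK (k : ℕ) (t : ℕ × ℕ × ℕ × ℕ) : Bool :=
  match t with
  | (a, b, c, d) =>
    let X := Zc a - Zc b
    let Y := Zc c - Zc d
    Nat.ble (rs (2 * X) (2 * Y) 54 (un k 1000000000000) (Br a) (Br b) (Br c) (Br d)) 250000000000
    && Nat.ble (X * X + Y * Y - 10000000000000000).natAbs 5000000000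

theorem row_ok : ∀ k : Fin 54, rowOK k.val (kk k) = true := by decide +kernel

noncomputable section

def ze (u : ℕ → ℝ) (i : ℕ) : ℝ := (Zc i : ℝ) / 100000000 + dot 54 (Br i) u / 10000

def ff (u : ℕ → ℝ) (t : ℕ × ℕ × ℕ × ℕ) : ℝ :=
  (ze u t.1 - ze u t.2.1) ^ 2 + (ze u t.2.2.1 - ze u t.2.2.2) ^ 2 - 1

theorem Bu_bound (u : ℕ → ℝ) (D : ℝ) (h : ∀ i, |u i| ≤ D) (i : ℕ) :
    |dot 54 (Br i) u / 10000| ≤ 98 * D := by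
  have hD : 0 ≤ D := (abs_nonneg _).trans (h 0)
  have h1 := dot_le 54 (Br i) u D h
  have h2 : (l1 54 (Br i) : ℝ) ≤ 980000 := by exact_mod_cast B_bound i
  rw [abs_div, abs_of_pos (by norm_num : (0:ℝ) < 10000), div_le_iff₀ (by norm_num)]
  nlinarith [mul_le_mul_of_nonneg_right h2 hD]

theorem core (X Y w D a b c d a' b' c' d' : ℝ) (hD : 0 ≤ D)
    (h0 : |w - 2*X*((a-a')-(b-b')) - 2*Y*((c-c')-(d-d'))| ≤ D/4)
    (ha : |a| ≤ 98*(1/1000000)) (hb : |b| ≤ 98*(1/1000000)) (hc : |c| ≤ 98*(1/1000000))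
    (hd : |d| ≤ 98*(1/1000000))
    (ha' : |a'| ≤ 98*(1/1000000)) (hb' : |b'| ≤ 98*(1/1000000)) (hc' : |c'| ≤ 98*(1/1000000))
    (hd' : |d'| ≤ 98*(1/1000000))
    (ea : |a-a'| ≤ 98*D) (eb : |b-b'| ≤ 98*D) (ec : |c-c'| ≤ 98*D) (ed : |d-d'| ≤ 98*D) :
    |w - ((X+(a-b))^2-(X+(a'-b'))^2) - ((Y+(c-d))^2-(Y+(c'-d'))^2)| ≤ D/2 := by
  have m : ∀ p q p' q' : ℝ, |p| ≤ 98*(1/1000000) → |q| ≤ 98*(1/1000000) →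
      |p'| ≤ 98*(1/1000000) → |q'| ≤ 98*(1/1000000) → |p-p'| ≤ 98*D → |q-q'| ≤ 98*D →
      |(p-q+p'-q')*((p-p')-(q-q'))| ≤ D/8 := by
    intro p q p' q' h1 h2 h3 h4 h5 h6
    rw [abs_mul]
    have e1 : |p-q+p'-q'| ≤ 4*(98*(1/1000000)) := by
      rw [abs_le] at *; constructor <;> linarith
    have e2 : |(p-p')-(q-q')| ≤ 2*(98*D) := by
      rw [abs_le] at *; constructor <;> linarith
    calc _ ≤ (4*(98*(1/1000000))) * (2*(98*D)) :=
          mul_le_mul e1 e2 (abs_nonneg _) (by norm_num)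
      _ ≤ D/8 := by linarith
  have m1 := m a b a' b' ha hb ha' hb' ea eb
  have m2 := m c d c' d' hc hd hc' hd' ec ed
  have : w - ((X+(a-b))^2-(X+(a'-b'))^2) - ((Y+(c-d))^2-(Y+(c'-d'))^2)
    = (w - 2*X*((a-a')-(b-b')) - 2*Y*((c-c')-(d-d'))) - (a-b+a'-b')*((a-a')-(b-b'))
      - (c-d+c'-d')*((c-c')-(d-d')) := by ring
  rw [this]
  rw [abs_le] at *
  constructor <;> linarith

theorem contr (u v : ℕ → ℝ) (D : ℝ) (hu : ∀ i, |u i| ≤ 1/1000000) (hv : ∀ i, |v i| ≤ 1/1000000)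
    (hD : ∀ i, |u i - v i| ≤ D) (k : Fin 54) :
    |(u k - ff u (kk k)) - (v k - ff v (kk k))| ≤ D / 2 := by
  have hD0 : 0 ≤ D := (abs_nonneg _).trans (hD 0)
  have hr := row_ok k
  rcases hk : kk k with ⟨a, b, c, d⟩
  rw [hk] at hr
  simp only [rowOK, Bool.and_eq_true, Nat.ble_eq] at hr
  have hr1 := hr.1
  have hR := rs_le (2 * (Zc a - Zc b)) (2 * (Zc c - Zc d)) 54 (un k 1000000000000)
    (Br a) (Br b) (Br c) (Br d) (fun i => u i - v i) D hD
  rw [dot_un _ _ _ _ k.2] at hR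
  have hR2 := hR.trans (mul_le_mul_of_nonneg_right (Nat.cast_le.2 hr1) hD0)
  have eu := Bu_bound u _ hu
  have ev := Bu_bound v _ hv
  have ed := Bu_bound _ _ hD
  simp only [ff, ze]
  simp only [dot_sub] at hR2 ed
  have key := core (((Zc a : ℝ) - Zc b) / 100000000) (((Zc c : ℝ) - Zc d) / 100000000) (u k - v k) D
    (dot 54 (Br a) u / 10000) (dot 54 (Br b) u / 10000) (dot 54 (Br c) u / 10000)
    (dot 54 (Br d) u / 10000) (dot 54 (Br a) v / 10000) (dot 54 (Br b) v / 10000)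
    (dot 54 (Br c) v / 10000) (dot 54 (Br d) v / 10000) hD0
    (by
      push_cast at hR2
      rw [abs_le] at hR2 ⊢
      constructor <;> linarith [hR2.1, hR2.2])
    (eu a) (eu b) (eu c) (eu d) (ev a) (ev b) (ev c) (ev d)
    (by simpa only [sub_div] using ed a) (by simpa only [sub_div] using ed b)
    (by simpa only [sub_div] using ed c) (by simpa only [sub_div] using ed d)
  refine le_trans (le_of_eq ?_) key
  congr 1
  ring

theorem ff_zero (k : Fin 54) : |ff (fun _ => 0) (kk k)| ≤ 1/2000000 := by
  have hr := row_ok k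
  rcases hk : kk k with ⟨a, b, c, d⟩
  rw [hk] at hr
  simp only [rowOK, Bool.and_eq_true, Nat.ble_eq] at hr
  have h := hr.2
  have h0 : ∀ r, dot 54 r (fun _ => (0:ℝ)) = 0 := by
    intro r
    exact dot_zero 54 r
  have h2 : |(((Zc a - Zc b) * (Zc a - Zc b) + (Zc c - Zc d) * (Zc c - Zc d)
      - 10000000000000000 : ℤ) : ℝ)| ≤ 5000000000 := by
    rw [← Int.cast_abs, ← Nat.cast_natAbs]
    exact_mod_cast h
  simp only [ff, ze, h0]
  push_cast at h2
  rw [abs_le] at h2 ⊢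
  constructor <;> nlinarith [h2.1, h2.2]

def ex (u : Fin 54 → ℝ) (i : ℕ) : ℝ := if h : i < 54 then u ⟨i, h⟩ else 0

theorem ex_le (u : Fin 54 → ℝ) (D : ℝ) (hD : 0 ≤ D) (h : ∀ i, |u i| ≤ D) (i : ℕ) : |ex u i| ≤ D := by
  unfold ex
  split_ifs
  · exact h _
  · simpa using hD

theorem ex_sub (u v : Fin 54 → ℝ) (i : ℕ) : ex u i - ex v i = ex (u - v) i := by
  unfold ex
  split_ifs <;> simp

theorem ex_val (u : Fin 54 → ℝ) (k : Fin 54) : ex u k = u k := by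
  simp [ex]

attribute [irreducible] ff

theorem exists_sol : ∃ u : ℕ → ℝ, (∀ i, |u i| ≤ 1/1000000) ∧ ∀ k, ff u (kk k) = 0 := by
  let U : (Fin 54 → ℝ) → (Fin 54 → ℝ) := fun u k => u k - ff (ex u) (kk k)
  let s : Set (Fin 54 → ℝ) := Metric.closedBall 0 (1/1000000)
  have hs : ∀ u ∈ s, ∀ i, |ex u i| ≤ 1/1000000 := by
    intro u hu
    apply ex_le _ _ (by norm_num)
    intro i
    have : ‖u‖ ≤ 1/1000000 := by simpa [s] using hu
    exact (norm_le_pi_norm u i).trans this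
  have hU : ∀ u ∈ s, ∀ v ∈ s, dist (U u) (U v) ≤ dist u v / 2 := by
    intro u hu v hv
    rw [dist_pi_le_iff (by positivity)]
    intro k
    have := contr (ex u) (ex v) (dist u v) (hs u hu) (hs v hv) (by
      intro i
      rw [ex_sub]
      apply ex_le _ _ dist_nonneg
      intro i
      exact dist_le_pi_dist u v i) k
    simp only [ex_val] at this
    exact this
  have h0 : (0 : Fin 54 → ℝ) ∈ s := by simp [s]
  have hU0 : dist (U 0) 0 ≤ 1/2000000 := by
    rw [dist_pi_le_iff (by norm_num)]
    intro k
    have := ff_zero k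
    have e : ex 0 = fun _ => 0 := by funext i; simp [ex]
    simp only [U, e, Real.dist_eq, Pi.zero_apply, sub_zero, zero_sub, abs_neg]
    exact this
  have hm : Set.MapsTo U s s := by
    intro u hu
    have h1 := hU u hu 0 h0
    have h2 : dist u 0 ≤ 1/1000000 := hu
    have h3 := dist_triangle (U u) (U 0) 0
    show dist (U u) 0 ≤ 1/1000000
    linarith
  have hc : ContractingWith (1/2) (hm.restrict U s s) := by
    refine ⟨by rw [← NNReal.coe_lt_coe]; norm_num, LipschitzWith.of_dist_le_mul ?_⟩
    rintro ⟨u, hu⟩ ⟨v, hv⟩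
    have := hU u hu v hv
    simp only [Subtype.dist_eq, Set.MapsTo.val_restrict_apply]
    push_cast
    linarith
  have hne : edist (0 : Fin 54 → ℝ) (U 0) ≠ ⊤ := by
    rw [edist_dist]
    exact ENNReal.ofReal_ne_top
  have hcomp : IsComplete s := Metric.isClosed_closedBall.isComplete
  obtain ⟨u, hu, hf, -⟩ := hc.exists_fixedPoint' hcomp hm h0 hne
  refine ⟨ex u, hs u hu, fun k => ?_⟩
  have := congrFun hf k
  simp only [U] at this
  linarith

end

theorem Kl_mem : ∀ t ∈ Kl, ∃ k, kk k = t := by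
  intro t ht
  obtain ⟨n, hn, rfl⟩ := List.getElem_of_mem ht
  have hl : Kl.length = 54 := by decide +kernel
  refine ⟨⟨n, by omega⟩, ?_⟩
  simp only [kk]
  rw [List.getD_eq_getElem _ _ hn]

def vv (v : Fin 55) : ℕ × ℕ × ℤ × ℤ × ℤ := Vl.getD v.val (0, 0, 0, 0, 0)

theorem vv_ok : ∀ v : Fin 55, ((vv v).2.2.1 = 1 ∨ (vv v).2.2.1 = -1) ∧
    ((vv v).2.2.1 * Zc (vv v).1 - 10000 * (vv v).2.2.2.1).natAbs ≤ 10000 ∧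
    (Zc (vv v).2.1 - 10000 * (vv v).2.2.2.2).natAbs ≤ 10000 := by decide +kernel

theorem vv_inj : ∀ v w : Fin 55, v = w ∨ 100 < ((vv v).2.2.2.1 - (vv w).2.2.2.1).natAbs ∨
    100 < ((vv v).2.2.2.2 - (vv w).2.2.2.2).natAbs := by decide +kernel

theorem El_ok : ∀ e ∈ El, e.1 < e.2.1 ∧ (vv e.1).2.2.2.1 = e.2.2.1 ∧ (vv e.1).2.2.2.2 = e.2.2.2.1 ∧
    (vv e.2.1).2.2.2.1 = e.2.2.2.2.1 ∧ (vv e.2.1).2.2.2.2 = e.2.2.2.2.2 := by decide +kernel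

def ltb (p q : ℤ) (i j : ℕ) (xi yi xj yj : ℤ) : Bool :=
  Nat.beq i j || decide (p * xi + q * yi + 100 < p * xj + q * yj)

def sepd (e f : Fin 55 × Fin 55 × ℤ × ℤ × ℤ × ℤ) (p q : ℤ) : Bool :=
  match e, f with
  | (a, b, xa, ya, xb, yb), (c, d, xc, yc, xd, yd) =>
    ltb p q a.val c.val xa ya xc yc && ltb p q a.val d.val xa ya xd yd &&
    ltb p q b.val c.val xb yb xc yc && ltb p q b.val d.val xb yb xd yd

def sep (e f : Fin 55 × Fin 55 × ℤ × ℤ × ℤ × ℤ) : Bool :=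
  Dl.any (fun t => sepd e f t.1 t.2 || sepd f e t.1 t.2)

def pairsOK : List (Fin 55 × Fin 55 × ℤ × ℤ × ℤ × ℤ) → Bool
  | [] => true
  | e :: l => l.all (sep e) && pairsOK l

theorem pairs_ok : pairsOK El = true := by decide +kernel

theorem pairs_pw : ∀ l, pairsOK l = true → l.Pairwise (fun e f => sep e f = true) := by
  intro l
  induction l with
  | nil => intro _; exact List.Pairwise.nil
  | cons e l ih =>
    intro h
    simp only [pairsOK, Bool.and_eq_true, List.all_eq_true] at h
    exact List.Pairwise.cons h.1 (ih h.2)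

theorem sep_symm (e f : Fin 55 × Fin 55 × ℤ × ℤ × ℤ × ℤ) (h : sep e f = true) : sep f e = true := by
  simp only [sep, List.any_eq_true, Bool.or_eq_true] at h ⊢
  obtain ⟨t, ht, h⟩ := h
  exact ⟨t, ht, h.symm⟩

theorem sep_all (e f : Fin 55 × Fin 55 × ℤ × ℤ × ℤ × ℤ) (he : e ∈ El) (hf : f ∈ El) (hne : e ≠ f) :
    sep e f = true := by
  have : Std.Symm (fun e f => sep e f = true) := ⟨fun x y h => sep_symm x y h⟩
  exact List.Pairwise.forall (pairs_pw _ pairs_ok) he hf hne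

theorem Dl_small : ∀ t ∈ Dl, t.1.natAbs ≤ 2 ∧ t.2.natAbs ≤ 7 := by decide +kernel

def Ll : List (Fin 55 × Fin 55) := El.map (fun e => (e.1, e.2.1))

def uT (e : Fin 55 × Fin 55) : Bool :=
  (Nat.beq e.1.val 39 && Nat.beq e.2.val 51) || (Nat.beq e.1.val 38 && Nat.beq e.2.val 50)

theorem Ll_nodup : Ll.Nodup := by decide +kernel
theorem Ll_len : Ll.length = 110 := by decide +kernel
theorem Ll_len2 : (Ll.filter (fun e => !uT e)).length = 108 := by decide +kernel
theorem Ll_deg : ∀ v : Fin 55, (Ll.filter (fun e => decide (e.1 = v ∨ e.2 = v))).length = 4 := by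
  decide +kernel

theorem Ll_unit : ∀ e ∈ Ll, uT e = true ∨
    (((vv e.1).2.2.1 = (vv e.2).2.2.1 ∨ (vv e.1).1 = 54 ∨ (vv e.2).1 = 54) ∧
     (((vv e.1).1, (vv e.2).1, (vv e.1).2.1, (vv e.2).2.1) ∈ Kl ∨
      ((vv e.2).1, (vv e.1).1, (vv e.2).2.1, (vv e.1).2.1) ∈ Kl)) := by decide +kernel

theorem seg_lin (p q : ℝ) (a b x : EuclideanSpace ℝ (Fin 2)) (hx : x ∈ segment ℝ a b) :
    ∃ t : ℝ, 0 ≤ t ∧ t ≤ 1 ∧ x = a + t • (b - a) ∧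
      p * x 0 + q * x 1 = (p * a 0 + q * a 1) + t * ((p * b 0 + q * b 1) - (p * a 0 + q * a 1)) := by
  rw [segment_eq_image'] at hx
  obtain ⟨t, ⟨h0, h1⟩, rfl⟩ := hx
  refine ⟨t, h0, h1, rfl, ?_⟩
  simp
  ring

theorem seg0 (p q : ℝ) (a b c d x : EuclideanSpace ℝ (Fin 2))
    (h1 : p * a 0 + q * a 1 < p * c 0 + q * c 1) (h2 : p * a 0 + q * a 1 < p * d 0 + q * d 1)
    (h3 : p * b 0 + q * b 1 < p * c 0 + q * c 1) (h4 : p * b 0 + q * b 1 < p * d 0 + q * d 1)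
    (hx : x ∈ segment ℝ a b) (hy : x ∈ segment ℝ c d) : False := by
  obtain ⟨t, t0, t1, -, e1⟩ := seg_lin p q a b x hx
  obtain ⟨s, s0, s1, -, e2⟩ := seg_lin p q c d x hy
  rw [e2] at e1
  generalize p * a 0 + q * a 1 = A at *
  generalize p * b 0 + q * b 1 = B at *
  generalize p * c 0 + q * c 1 = C at *
  generalize p * d 0 + q * d 1 = D at *
  rcases le_total A B with h | h <;> rcases le_total C D with h' | h' <;> nlinarith

theorem seg1 (p q : ℝ) (a b d x : EuclideanSpace ℝ (Fin 2))
    (h1 : p * a 0 + q * a 1 < p * d 0 + q * d 1)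
    (h2 : p * b 0 + q * b 1 < p * a 0 + q * a 1)
    (hx : x ∈ segment ℝ a b) (hy : x ∈ segment ℝ a d) : x = a := by
  obtain ⟨t, t0, t1, hxa, e1⟩ := seg_lin p q a b x hx
  obtain ⟨s, s0, s1, -, e2⟩ := seg_lin p q a d x hy
  have : t = 0 := by
    rw [e2] at e1
    generalize p * a 0 + q * a 1 = A at *
    generalize p * b 0 + q * b 1 = B at *
    generalize p * d 0 + q * d 1 = D at *
    rcases eq_or_lt_of_le t0 with h | h
    · exact h.symm
    · nlinarith [mul_nonneg s0 (sub_nonneg.2 h1.le), mul_pos h (sub_pos.2 h2)]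
  rw [hxa, this]; simp

noncomputable section

def vx (u : ℕ → ℝ) (v : Fin 55) : ℝ := ((vv v).2.2.1 : ℝ) * ze u (vv v).1
def vy (u : ℕ → ℝ) (v : Fin 55) : ℝ := ze u (vv v).2.1
def PP (u : ℕ → ℝ) (v : Fin 55) : EuclideanSpace ℝ (Fin 2) := !₂[vx u v, vy u v]

end

theorem dist_PP (u : ℕ → ℝ) (v w : Fin 55) :
    dist (PP u v) (PP u w) = √((vx u v - vx u w)^2 + (vy u v - vy u w)^2) := by
  rw [EuclideanSpace.dist_eq]
  simp [PP, Fin.sum_univ_two, Real.dist_eq, sq_abs]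

theorem approx (u : ℕ → ℝ) (hu : ∀ i, |u i| ≤ 1/1000000) (v : Fin 55) :
    |vx u v - ((vv v).2.2.2.1 : ℝ) / 10000| ≤ 2/10000 ∧
    |vy u v - ((vv v).2.2.2.2 : ℝ) / 10000| ≤ 2/10000 := by
  obtain ⟨hs, h1, h2⟩ := vv_ok v
  have b1 := Bu_bound u _ hu (vv v).1
  have b2 := Bu_bound u _ hu (vv v).2.1
  have h1' : |(((vv v).2.2.1 * Zc (vv v).1 - 10000 * (vv v).2.2.2.1 : ℤ) : ℝ)| ≤ 10000 := by
    rw [← Int.cast_abs, ← Nat.cast_natAbs]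
    exact_mod_cast h1
  have h2' : |((Zc (vv v).2.1 - 10000 * (vv v).2.2.2.2 : ℤ) : ℝ)| ≤ 10000 := by
    rw [← Int.cast_abs, ← Nat.cast_natAbs]
    exact_mod_cast h2
  simp only [vx, vy, ze]
  generalize dot 54 (Br (vv v).1) u = A at *
  generalize dot 54 (Br (vv v).2.1) u = B at *
  generalize vv v = t at *
  push_cast at h1' h2'
  rw [abs_le] at *
  constructor
  · rcases hs with hs | hs <;> rw [hs] at h1' ⊢ <;> push_cast at h1' ⊢ <;>
      constructor <;> linarith [h1'.1, h1'.2, b1.1, b1.2]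
  · rw [abs_le]
    constructor <;> linarith [h2'.1, h2'.2, b2.1, b2.2]

theorem PP_inj (u : ℕ → ℝ) (hu : ∀ i, |u i| ≤ 1/1000000) : Function.Injective (PP u) := by
  intro v w h
  have hx : vx u v = vx u w := by
    have := congrArg (fun z : EuclideanSpace ℝ (Fin 2) => z 0) h
    simpa [PP] using this
  have hy : vy u v = vy u w := by
    have := congrArg (fun z : EuclideanSpace ℝ (Fin 2) => z 1) h
    simpa [PP] using this
  obtain ⟨a1, a2⟩ := approx u hu v
  obtain ⟨b1, b2⟩ := approx u hu w
  rw [hx] at a1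
  rw [hy] at a2
  have key : ∀ (m n : ℤ) (x : ℝ), |x - (m:ℝ)/10000| ≤ 2/10000 → |x - (n:ℝ)/10000| ≤ 2/10000 →
      ¬ (100 < (m - n).natAbs) := by
    intro m n x hm hn hh
    rw [abs_le] at hm hn
    have c1 : ((m - n : ℤ) : ℝ) ≤ 4 := by push_cast; linarith [hm.1, hm.2, hn.1, hn.2]
    have c2 : ((-4 : ℤ) : ℝ) ≤ ((m - n : ℤ) : ℝ) := by
      push_cast; linarith [hm.1, hm.2, hn.1, hn.2]
    have c1' : m - n ≤ 4 := by exact_mod_cast c1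
    have c2' : -4 ≤ m - n := by exact_mod_cast c2
    omega
  rcases vv_inj v w with h | h | h
  · exact h
  · exact absurd h (key _ _ _ a1 b1)
  · exact absurd h (key _ _ _ a2 b2)

theorem ltb_ok (u : ℕ → ℝ) (hu : ∀ i, |u i| ≤ 1/1000000) (p q : ℤ) (hp : p.natAbs ≤ 2)
    (hq : q.natAbs ≤ 7) (i j : Fin 55)
    (h : ltb p q i j (vv i).2.2.2.1 (vv i).2.2.2.2 (vv j).2.2.2.1 (vv j).2.2.2.2 = true) :
    i = j ∨ (p:ℝ) * (PP u i) 0 + q * (PP u i) 1 < p * (PP u j) 0 + q * (PP u j) 1 := by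
  simp only [ltb, Bool.or_eq_true, decide_eq_true_eq, Nat.beq_eq] at h
  rcases h with h | h
  · exact Or.inl (Fin.ext h)
  right
  have h' : ((p * (vv i).2.2.2.1 + q * (vv i).2.2.2.2 + 100 : ℤ) : ℝ)
      < ((p * (vv j).2.2.2.1 + q * (vv j).2.2.2.2 : ℤ) : ℝ) := by exact_mod_cast h
  push_cast at h'
  obtain ⟨a1, a2⟩ := approx u hu i
  obtain ⟨b1, b2⟩ := approx u hu j
  have hp' : |(p:ℝ)| ≤ 2 := by
    rw [← Int.cast_abs, ← Nat.cast_natAbs]; exact_mod_cast hp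
  have hq' : |(q:ℝ)| ≤ 7 := by
    rw [← Int.cast_abs, ← Nat.cast_natAbs]; exact_mod_cast hq
  have m : ∀ r x c : ℝ, |r| ≤ c → |x| ≤ 2/10000 → |r * x| ≤ c * (2/10000) := by
    intro r x c h1 h2
    rw [abs_mul]
    exact mul_le_mul h1 h2 (abs_nonneg _) ((abs_nonneg _).trans h1)
  have c1 := abs_le.1 (m _ _ _ hp' a1)
  have c2 := abs_le.1 (m _ _ _ hq' a2)
  have c3 := abs_le.1 (m _ _ _ hp' b1)
  have c4 := abs_le.1 (m _ _ _ hq' b2)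
  simp only [PP, PiLp.toLp_apply, Matrix.cons_val_zero, Matrix.cons_val_one]
  linarith [c1.1, c1.2, c2.1, c2.2, c3.1, c3.2, c4.1, c4.2]

theorem sepd_ok (u : ℕ → ℝ) (hu : ∀ i, |u i| ≤ 1/1000000) (p q : ℤ) (hp : p.natAbs ≤ 2)
    (hq : q.natAbs ≤ 7) (e f : Fin 55 × Fin 55 × ℤ × ℤ × ℤ × ℤ) (he : e ∈ El) (hf : f ∈ El)
    (hne : (e.1, e.2.1) ≠ (f.1, f.2.1)) (h : sepd e f p q = true)
    (x : EuclideanSpace ℝ (Fin 2)) (hx : x ∈ segment ℝ (PP u e.1) (PP u e.2.1))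
    (hy : x ∈ segment ℝ (PP u f.1) (PP u f.2.1)) :
    (x = PP u e.1 ∨ x = PP u e.2.1) ∧ (x = PP u f.1 ∨ x = PP u f.2.1) := by
  obtain ⟨l1, e1, e2, e3, e4⟩ := El_ok e he
  obtain ⟨l2, f1, f2, f3, f4⟩ := El_ok f hf
  obtain ⟨a, b, xa, ya, xb, yb⟩ := e
  obtain ⟨c, d, xc, yc, xd, yd⟩ := f
  simp only at *
  subst e1 e2 e3 e4 f1 f2 f3 f4
  simp only [sepd, Bool.and_eq_true] at h
  obtain ⟨⟨⟨h1, h2⟩, h3⟩, h4⟩ := h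
  have g1 := ltb_ok u hu p q hp hq _ _ h1
  have g2 := ltb_ok u hu p q hp hq _ _ h2
  have g3 := ltb_ok u hu p q hp hq _ _ h3
  have g4 := ltb_ok u hu p q hp hq _ _ h4
  clear h1 h2 h3 h4 he hf
  by_cases q1 : a = c
  · subst q1
    have n2 : a ≠ d := l2.ne
    have n3 : b ≠ a := l1.ne'
    have := seg1 p q _ _ _ x (g2.resolve_left n2) (g3.resolve_left n3) hx hy
    exact ⟨Or.inl this, Or.inl this⟩
  by_cases q2 : a = d
  · subst q2
    have n3 : b ≠ a := l1.ne'
    rw [segment_symm ℝ (PP u c)] at hy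
    have := seg1 p q _ _ _ x (g1.resolve_left q1) (g4.resolve_left n3) hx hy
    exact ⟨Or.inl this, Or.inr this⟩
  by_cases q3 : b = c
  · subst q3
    have n3 : b ≠ d := l2.ne
    rw [segment_symm ℝ (PP u a)] at hx
    have := seg1 p q _ _ _ x (g4.resolve_left n3) (g1.resolve_left q1) hx hy
    exact ⟨Or.inr this, Or.inl this⟩
  by_cases q4 : b = d
  · subst q4
    rw [segment_symm ℝ (PP u a)] at hx
    rw [segment_symm ℝ (PP u c)] at hy
    have := seg1 p q _ _ _ x (g3.resolve_left q3) (g2.resolve_left q2) hx hy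
    exact ⟨Or.inr this, Or.inr this⟩
  exact (seg0 p q _ _ _ _ x (g1.resolve_left q1) (g2.resolve_left q2) (g3.resolve_left q3)
    (g4.resolve_left q4) hx hy).elim

theorem noncross (u : ℕ → ℝ) (hu : ∀ i, |u i| ≤ 1/1000000) (e f : Fin 55 × Fin 55)
    (he : e ∈ Ll) (hf : f ∈ Ll) (hne : e ≠ f)
    (x : EuclideanSpace ℝ (Fin 2)) (hx : x ∈ segment ℝ (PP u e.1) (PP u e.2))
    (hy : x ∈ segment ℝ (PP u f.1) (PP u f.2)) :
    (x = PP u e.1 ∨ x = PP u e.2) ∧ (x = PP u f.1 ∨ x = PP u f.2) := by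
  simp only [Ll, List.mem_map] at he hf
  obtain ⟨e', he', rfl⟩ := he
  obtain ⟨f', hf', rfl⟩ := hf
  have hs := sep_all e' f' he' hf' (fun h => hne (by rw [h]))
  simp only [sep, List.any_eq_true, Bool.or_eq_true] at hs
  obtain ⟨t, ht, h | h⟩ := hs
  · exact sepd_ok u hu t.1 t.2 (Dl_small t ht).1 (Dl_small t ht).2 e' f' he' hf' hne h x hx hy
  · exact (sepd_ok u hu t.1 t.2 (Dl_small t ht).1 (Dl_small t ht).2 f' e' hf' he' hne.symm h x hy hx).symm

theorem Zc54 : Zc 54 = 0 ∧ Br 54 = [] := by decide +kernel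

theorem ze54 (u : ℕ → ℝ) : ze u 54 = 0 := by
  simp only [ze, Zc54.1, Zc54.2, dot_nil]; norm_num

theorem dist_unit (u : ℕ → ℝ) (hs : ∀ k, ff u (kk k) = 0) (e : Fin 55 × Fin 55) (he : e ∈ Ll)
    (hT : uT e = false) : dist (PP u e.1) (PP u e.2) = 1 := by
  have h := (Ll_unit e he).resolve_left (by simp [hT])
  have hK : ∀ a b c d, (a, b, c, d) ∈ Kl → (ze u a - ze u b)^2 + (ze u c - ze u d)^2 = 1 := by
    intro a b c d hm
    obtain ⟨k, hk⟩ := Kl_mem _ hm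
    have := hs k
    rw [hk] at this
    unfold ff at this
    simp only at this
    linarith
  have h1 : (ze u (vv e.1).1 - ze u (vv e.2).1)^2 + (ze u (vv e.1).2.1 - ze u (vv e.2).2.1)^2 = 1 := by
    rcases h.2 with h | h
    · exact hK _ _ _ _ h
    · have := hK _ _ _ _ h
      linarith
  have s1 := (vv_ok e.1).1
  have s2 := (vv_ok e.2).1
  have sq1 : ((vv e.1).2.2.1 : ℝ)^2 = 1 := by rcases s1 with s | s <;> rw [s] <;> norm_num
  have sq2 : ((vv e.2).2.2.1 : ℝ)^2 = 1 := by rcases s2 with s | s <;> rw [s] <;> norm_num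
  have h2 : (vx u e.1 - vx u e.2)^2 = (ze u (vv e.1).1 - ze u (vv e.2).1)^2 := by
    simp only [vx]
    rcases h.1 with g | g | g
    · rw [g, ← mul_sub, mul_pow, sq2, one_mul]
    · rw [g, ze54]; rw [mul_zero, zero_sub, zero_sub, neg_sq, neg_sq, mul_pow, sq2, one_mul]
    · rw [g, ze54]; rw [mul_zero, sub_zero, sub_zero, mul_pow, sq1, one_mul]
  rw [dist_PP, h2]
  simp only [vy]
  rw [h1, Real.sqrt_one]

theorem T_data : (vv 38).1 = (vv 39).1 ∧ (vv 38).2.1 = (vv 39).2.1 ∧ (vv 50).1 = (vv 51).1 ∧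
    (vv 50).2.1 = (vv 51).2.1 ∧ (vv 38).2.2.1 = 1 ∧ (vv 39).2.2.1 = -1 ∧ (vv 50).2.2.1 = 1 ∧
    (vv 51).2.2.1 = -1 ∧
    ((vv 38).2.2.2.1 - (vv 50).2.2.2.1)^2 + ((vv 38).2.2.2.2 - (vv 50).2.2.2.2)^2 < 73000000 ∧
    70500000 < ((vv 38).2.2.2.1 - (vv 50).2.2.2.1)^2 + ((vv 38).2.2.2.2 - (vv 50).2.2.2.2)^2 ∧
    ((vv 38).2.2.2.1 - (vv 50).2.2.2.1).natAbs ≤ 10000 ∧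
    ((vv 38).2.2.2.2 - (vv 50).2.2.2.2).natAbs ≤ 10000 := by
  decide +kernel

theorem T_eq (u : ℕ → ℝ) : dist (PP u 39) (PP u 51) = dist (PP u 38) (PP u 50) := by
  obtain ⟨a1, a2, a3, a4, a5, a6, a7, a8, -⟩ := T_data
  rw [dist_PP, dist_PP]
  simp only [vx, vy, a1, a2, a3, a4, a5, a6, a7, a8]
  congr 1
  push_cast
  ring

theorem T_bd (u : ℕ → ℝ) (hu : ∀ i, |u i| ≤ 1/1000000) :
    0.83 < dist (PP u 38) (PP u 50) ∧ dist (PP u 38) (PP u 50) < 1 := by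
  obtain ⟨-, -, -, -, -, -, -, -, hlt, hgt, hX, hY⟩ := T_data
  obtain ⟨a1, a2⟩ := approx u hu 38
  obtain ⟨b1, b2⟩ := approx u hu 50
  rw [dist_PP]
  generalize vx u 38 = x1 at *
  generalize vx u 50 = x2 at *
  generalize vy u 38 = y1 at *
  generalize vy u 50 = y2 at *
  generalize vv 38 = v at *
  generalize vv 50 = w at *
  have hX' : |((v.2.2.2.1 - w.2.2.2.1 : ℤ) : ℝ)| ≤ 10000 := by
    rw [← Int.cast_abs, ← Nat.cast_natAbs]; exact_mod_cast hX
  have hY' : |((v.2.2.2.2 - w.2.2.2.2 : ℤ) : ℝ)| ≤ 10000 := by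
    rw [← Int.cast_abs, ← Nat.cast_natAbs]; exact_mod_cast hY
  have hlt' : (((v.2.2.2.1 - w.2.2.2.1)^2 + (v.2.2.2.2 - w.2.2.2.2)^2 : ℤ) : ℝ) < 73000000 := by
    exact_mod_cast hlt
  have hgt' : (70500000 : ℝ) < (((v.2.2.2.1 - w.2.2.2.1)^2 + (v.2.2.2.2 - w.2.2.2.2)^2 : ℤ) : ℝ) := by
    exact_mod_cast hgt
  push_cast at hX' hY' hlt' hgt'
  have key : ∀ z m : ℝ, |m| ≤ 10000 → |z - m / 10000| ≤ 4/10000 →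
      |z^2 - m^2 / 100000000| ≤ 9/10000 := by
    intro z m hm hz
    have e : z^2 - m^2/100000000 = (z - m/10000) * (z + m/10000) := by ring
    rw [e, abs_mul]
    have h2 : |z + m/10000| ≤ 2 + 4/10000 := by
      rw [abs_le] at *; constructor <;> linarith [hm.1, hm.2, hz.1, hz.2]
    calc _ ≤ 4/10000 * (2 + 4/10000) := mul_le_mul hz h2 (abs_nonneg _) (by norm_num)
      _ ≤ _ := by norm_num
  have k1 := key (x1 - x2) _ hX' (by
    rw [abs_le] at *; constructor <;> linarith [a1.1, a1.2, b1.1, b1.2])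
  have k2 := key (y1 - y2) _ hY' (by
    rw [abs_le] at *; constructor <;> linarith [a2.1, a2.2, b2.1, b2.2])
  rw [abs_le] at k1 k2
  constructor
  · apply Real.lt_sqrt_of_sq_lt
    norm_num
    linarith [k1.1, k2.1]
  · rw [Real.sqrt_lt' (by norm_num)]
    linarith [k1.2, k2.2]

theorem uT_cases (e : Fin 55 × Fin 55) (h : uT e = true) : e = (39, 51) ∨ e = (38, 50) := by
  simp only [uT, Bool.or_eq_true, Bool.and_eq_true, Nat.beq_eq] at h
  rcases h with h | h
  · exact Or.inl (Prod.ext (Fin.ext h.1) (Fin.ext h.2))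
  · exact Or.inr (Prod.ext (Fin.ext h.1) (Fin.ext h.2))

theorem dist_T (u : ℕ → ℝ) (e : Fin 55 × Fin 55) (h : uT e = true) :
    dist (PP u e.1) (PP u e.2) = dist (PP u 38) (PP u 50) := by
  rcases uT_cases e h with rfl | rfl
  · exact T_eq u
  · rfl

open scoped Classical

theorem near_matchstick_55 :
    ∃ (P : Fin 55 → EuclideanSpace ℝ (Fin 2)) (E : Finset (Fin 55 × Fin 55)),
      Function.Injective P ∧
      (∀ e ∈ E, e.1 < e.2) ∧
      E.card = 110 ∧
      (∀ v : Fin 55, (E.filter (fun e => e.1 = v ∨ e.2 = v)).card = 4) ∧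
      (∀ e ∈ E, ∀ f ∈ E, e ≠ f →
        ∀ x ∈ segment ℝ (P e.1) (P e.2) ∩ segment ℝ (P f.1) (P f.2),
          (x = P e.1 ∨ x = P e.2) ∧ (x = P f.1 ∨ x = P f.2)) ∧
      (E.filter (fun e => dist (P e.1) (P e.2) = 1)).card = 108 ∧
      (∃ t : ℝ, |t - 1| < 0.17 ∧
        ∀ e ∈ E, dist (P e.1) (P e.2) = 1 ∨ dist (P e.1) (P e.2) = t) := by
  obtain ⟨u, hu, hs⟩ := exists_sol
  refine ⟨PP u, Ll.toFinset, PP_inj u hu, ?_, ?_, ?_, ?_, ?_, ?_⟩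
  · intro e he
    rw [List.mem_toFinset, Ll, List.mem_map] at he
    obtain ⟨e', he', rfl⟩ := he
    exact (El_ok e' he').1
  · rw [List.toFinset_card_of_nodup Ll_nodup, Ll_len]
  · intro v
    rw [← Ll_deg v, ← List.toFinset_card_of_nodup (Ll_nodup.filter _), List.toFinset_filter]
    refine congrArg Finset.card (Finset.ext fun e => ?_)
    simp
  · intro e he f hf hne x hx
    exact noncross u hu e f (List.mem_toFinset.1 he) (List.mem_toFinset.1 hf) hne x hx.1 hx.2
  · rw [← Ll_len2, ← List.toFinset_card_of_nodup (Ll_nodup.filter _)]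
    refine congrArg Finset.card (Finset.ext fun e => ?_)
    simp only [Finset.mem_filter, List.mem_toFinset, List.mem_filter, Bool.not_eq_true']
    refine and_congr_right fun he => ⟨fun h => ?_, fun h => dist_unit u hs e he h⟩
    by_contra hc
    rw [dist_T u e (by simpa using hc)] at h
    exact (T_bd u hu).2.ne h
  · refine ⟨dist (PP u 38) (PP u 50), ?_, ?_⟩
    · have := T_bd u hu
      rw [abs_lt]
      constructor <;> linarith [this.1, this.2]
    · intro e he
      rw [List.mem_toFinset] at he
      cases hT : uT e with
      | false => exact Or.inl (dist_unit u hs e he hT)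
      | true => exact Or.inr (dist_T u e hT)
end
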